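/- arXiv:2210.07854 — 3 statements merged into one kernel-verified Lean document; each statement's English description precedes it below -/
import Mathlib

section
/- Let k ∈ ℂ with Re(k) < 0 and δ > 0. Let f : ℚ → ℂ satisfy weak periodicity (f(x+1) = f(x) for all x ∈ ℚ\[−1,0]) and the reciprocity relation f(x) − |x|^{−k}·f(−1/x) = h(x) for all x ∈ ([−1,1] ∩ ℚ)\{0}, where h : ℝ\{0} → ℂ satisfies condition (coh) with parameter δ. Let f† be the Lebesgue-measurable function defined on a full-measure set X ⊆ ℝ\ℚ by f†(x) := lim_{j→∞} f(x_j) along the continued-fraction convergents x_j of x. Then for every bounded continuous function G : ℂ → ℝ, (1/φ(q))·Σ_{a=1, gcd(a,q)=1}^{q} G(f(a/q)) → ∫_{[0,1]} G(f†(x)) dx as q → ∞, where φ is Euler's totient function. Equivalently, the multisets {f(a/q) : 1 ≤ a ≤ q, gcd(a,q)=1} become distributed, as q → ∞, according to the pushforward of Lebesgue measure on [0,1] under f†. -/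
open Filter Topology MeasureTheory Set

/-- Partial quotients of the regular continued fraction expansion of `x`
(with the convention that `cfb j x = 0` for `j` beyond the length of the expansion). -/
noncomputable def cfb : ℕ → ℝ → ℤ
  | 0, x => ⌊x⌋
  | n + 1, x => cfb n (Int.fract x)⁻¹

/-- Numerators and denominators of the continued fraction convergents of `x`. -/
noncomputable def cfPQ (x : ℝ) : ℕ → ℤ × ℤ
  | 0 => (cfb 0 x, 1)
  | 1 => (cfb 1 x * cfb 0 x + 1, cfb 1 x)
  | n + 2 => (cfb (n + 2) x * (cfPQ x (n + 1)).1 + (cfPQ x n).1,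
              cfb (n + 2) x * (cfPQ x (n + 1)).2 + (cfPQ x n).2)

/-- The `n`-th continued fraction convergent of `x`, as a rational number. -/
noncomputable def cfConv (x : ℝ) (n : ℕ) : ℚ := ((cfPQ x n).1 : ℚ) / ((cfPQ x n).2 : ℚ)

/-- Condition (coh) on the period function `h`, with parameter `δ`:
(i) `sup {|h x - h y| : |x-y| < exp(-ε^(δ-1)), |x| > 2ε} → 0` as `ε → 0⁺`, and
(ii) `|h x| ≤ C · exp(|x|^(δ-1))` on `[-1,1] \ {0}`. -/
def cohCond (δ : ℝ) (h : ℝ → ℂ) : Prop :=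
  (∀ η : ℝ, 0 < η → ∃ ε₀ : ℝ, 0 < ε₀ ∧ ∀ ε : ℝ, 0 < ε → ε < ε₀ →
    ∀ x y : ℝ, x ∈ Set.Icc (-1 : ℝ) 1 → y ∈ Set.Icc (-1 : ℝ) 1 → x ≠ 0 → y ≠ 0 →
      |x - y| < Real.exp (-(ε ^ (δ - 1))) → 2 * ε < |x| → ‖h x - h y‖ ≤ η) ∧
  (∃ C : ℝ, 0 < C ∧ ∀ x : ℝ, x ∈ Set.Icc (-1 : ℝ) 1 → x ≠ 0 →
    ‖h x‖ ≤ C * Real.exp (|x| ^ (δ - 1)))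

theorem sum_divisors_moebius_indicator (m y : ℕ) (hm : m ≠ 0) :
    ∑ e ∈ m.divisors, (if e ∣ y then (ArithmeticFunction.moebius e : ℝ) else 0)
      = if Nat.Coprime y m then 1 else 0 := by
  have h1 : ∑ e ∈ (Nat.gcd y m).divisors, (ArithmeticFunction.moebius e : ℤ)
      = if Nat.gcd y m = 1 then 1 else 0 := by
    rw [← ArithmeticFunction.coe_zeta_mul_apply, ArithmeticFunction.coe_zeta_mul_moebius,
      ArithmeticFunction.one_apply]
  have h2 : m.divisors.filter (· ∣ y) = (Nat.gcd y m).divisors := by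
    ext e
    simp [Nat.mem_divisors, Nat.dvd_gcd_iff, hm]
    tauto
  rw [← Finset.sum_filter, h2]
  exact_mod_cast h1

theorem sum_divisors_moebius_div (m : ℕ) (hm : 0 < m) :
    ∑ e ∈ m.divisors, (ArithmeticFunction.moebius e : ℝ) / e = (m.totient : ℝ) / m := by
  have h := (ArithmeticFunction.sum_eq_iff_sum_mul_moebius_eq (R := ℝ)
    (f := fun n => (n.totient : ℝ)) (g := fun n => (n : ℝ))).1
    (fun n _ => by exact_mod_cast Nat.sum_totient n) m hm
  rw [← h, Nat.sum_divisorsAntidiagonal (fun a b => (ArithmeticFunction.moebius a : ℝ) * (b : ℝ)),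
    Finset.sum_div]
  refine Finset.sum_congr rfl fun e he => ?_
  have hd := Nat.dvd_of_mem_divisors he
  have he0 : (e : ℝ) ≠ 0 := by exact_mod_cast (Nat.pos_of_mem_divisors he).ne'
  have hm0 : (m : ℝ) ≠ 0 := by exact_mod_cast hm.ne'
  rw [Nat.cast_div hd he0]
  field_simp

/-- The count of integers in `[1, N]` coprime to `m`, with the divisor function as error. -/
theorem abs_card_coprime_sub_le (m N : ℕ) (hm : 0 < m) :
    |(((Finset.Icc 1 N).filter fun y => Nat.Coprime y m).card : ℝ) - N * (m.totient / m)|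
      ≤ m.divisors.card := by
  have h1 : (((Finset.Icc 1 N).filter fun y => Nat.Coprime y m).card : ℝ)
      = ∑ e ∈ m.divisors, (ArithmeticFunction.moebius e : ℝ) * (N / e : ℕ) := by
    rw [Finset.card_filter]
    push_cast
    simp_rw [← sum_divisors_moebius_indicator m _ hm.ne']
    rw [Finset.sum_comm]
    refine Finset.sum_congr rfl fun e _ => ?_
    rw [← Finset.sum_filter, Finset.sum_const, nsmul_eq_mul, mul_comm]
    congr 2
    rw [← Nat.Ioc_filter_dvd_card_eq_div]
    rfl
  rw [h1, ← sum_divisors_moebius_div m hm, Finset.mul_sum, ← Finset.sum_sub_distrib]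
  refine (Finset.abs_sum_le_sum_abs _ _).trans ?_
  calc _ ≤ ∑ e ∈ m.divisors, (1 : ℝ) := Finset.sum_le_sum fun e he => ?_
    _ = _ := by simp
  have he0 : 0 < e := Nat.pos_of_mem_divisors he
  have : (ArithmeticFunction.moebius e : ℝ) * (N / e : ℕ) - N * (ArithmeticFunction.moebius e / e)
      = (ArithmeticFunction.moebius e : ℝ) * ((N / e : ℕ) - (N : ℝ) / e) := by ring
  rw [this, abs_mul]
  have h2 : |(ArithmeticFunction.moebius e : ℝ)| ≤ 1 := by
    exact_mod_cast ArithmeticFunction.abs_moebius_le_one (n := e)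
  have h3 : |((N / e : ℕ) : ℝ) - (N : ℝ) / e| ≤ 1 := by
    have := Nat.floor_div_eq_div (K := ℝ) N e
    rw [← this, abs_sub_comm, abs_le]
    have a := Nat.floor_le (a := (N : ℝ) / e) (by positivity)
    have b := Nat.lt_floor_add_one ((N : ℝ) / e)
    constructor <;> linarith
  nlinarith [abs_nonneg (ArithmeticFunction.moebius e : ℝ), abs_nonneg (((N / e : ℕ) : ℝ) - (N : ℝ) / e)]

theorem le_totient_mul_card_divisors (n : ℕ) : n ≤ n.totient * n.divisors.card := by
  rcases n.eq_zero_or_pos with rfl | hn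
  · simp
  have h := Nat.totient_eq_mul_prod_factors n
  have h2 : (1 : ℚ) ≤ (∏ p ∈ n.primeFactors, (1 - (p : ℚ)⁻¹)) * n.divisors.card := by
    rw [Nat.card_divisors hn.ne']
    push_cast
    rw [← Finset.prod_mul_distrib]
    refine (Finset.prod_const_one (s := n.primeFactors)).symm.le.trans ?_
    refine Finset.prod_le_prod (fun _ _ => zero_le_one) fun p hp => ?_
    have hp2 : (2 : ℚ) ≤ p := by exact_mod_cast (Nat.prime_of_mem_primeFactors hp).two_le
    have hf : (1 : ℚ) ≤ n.factorization p := by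
      exact_mod_cast (Nat.prime_of_mem_primeFactors hp).factorization_pos_of_dvd hn.ne'
        (Nat.dvd_of_mem_primeFactors hp)
    have hinv : (p : ℚ)⁻¹ ≤ 2⁻¹ := by gcongr
    nlinarith
  have : (n : ℚ) ≤ n.totient * n.divisors.card := by
    rw [h, mul_assoc]
    exact le_mul_of_one_le_right (by positivity) h2
  exact_mod_cast this

/-- The divisor bound. -/
theorem exists_card_divisors_le_rpow (ε : ℝ) (hε : 0 < ε) :
    ∃ C : ℝ, 0 < C ∧ ∀ n : ℕ, 0 < n → (n.divisors.card : ℝ) ≤ C * (n : ℝ) ^ ε := by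
  obtain ⟨K, hK1, hK⟩ : ∃ K : ℝ, 1 ≤ K ∧ ∀ e : ℕ, (e + 1 : ℝ) ≤ K * (2 : ℝ) ^ (ε * e) := by
    have hlog : 0 < ε * Real.log 2 := by have := Real.log_pos one_lt_two; positivity
    refine ⟨max 1 (1 / (ε * Real.log 2)), le_max_left _ _, fun e => ?_⟩
    have h1 : (2 : ℝ) ^ (ε * e) = Real.exp (ε * Real.log 2 * e) := by
      rw [Real.rpow_def_of_pos two_pos]; ring_nf
    rw [h1]
    have h2 := Real.add_one_le_exp (ε * Real.log 2 * e)
    have h3 : (e : ℝ) ≤ max 1 (1 / (ε * Real.log 2)) * (ε * Real.log 2 * e) := by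
      have : (1 / (ε * Real.log 2)) * (ε * Real.log 2 * e) = e := by field_simp
      calc (e : ℝ) = (1 / (ε * Real.log 2)) * (ε * Real.log 2 * e) := this.symm
        _ ≤ _ := by gcongr; exact le_max_right _ _
    have h4 : (1 : ℝ) ≤ max 1 (1 / (ε * Real.log 2)) := le_max_left _ _
    nlinarith
  obtain ⟨P, hP⟩ := exists_nat_ge ((2 : ℝ) ^ (1 / ε))
  refine ⟨K ^ P, by positivity, fun n hn => ?_⟩
  rw [Nat.card_divisors hn.ne']
  have hn' : (n : ℝ) ^ ε = ∏ p ∈ n.primeFactors, (p : ℝ) ^ (ε * n.factorization p) := by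
    conv_lhs => rw [← Nat.prod_factorization_pow_eq_self hn.ne']
    rw [Finsupp.prod, Nat.support_factorization]
    push_cast
    rw [← Real.finsetProd_rpow _ _ (fun i _ => by positivity)]
    refine Finset.prod_congr rfl fun p _ => ?_
    rw [mul_comm, Real.rpow_mul (by positivity), Real.rpow_natCast]
  have hKP : ∏ p ∈ n.primeFactors, (if p < P then K else 1) ≤ K ^ P := by
    rw [← Finset.prod_filter, Finset.prod_const]
    refine pow_le_pow_right₀ hK1 ?_
    calc _ ≤ (Finset.range P).card := Finset.card_le_card fun p hp => by
          simp at hp ⊢; exact hp.2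
      _ = P := by simp
  rw [hn']
  push_cast
  calc ∏ p ∈ n.primeFactors, ((n.factorization p : ℝ) + 1)
      ≤ ∏ p ∈ n.primeFactors, ((if p < P then K else 1) * (p : ℝ) ^ (ε * n.factorization p)) := by
        refine Finset.prod_le_prod (fun _ _ => by positivity) fun p hp => ?_
        have hp2 : (2 : ℝ) ≤ p := by exact_mod_cast (Nat.prime_of_mem_primeFactors hp).two_le
        split_ifs with hpP
        · refine (hK _).trans ?_
          gcongr
        · have h5 : (2 : ℝ) ≤ (p : ℝ) ^ ε := by
            have : (2 : ℝ) ^ (1 / ε) ≤ p := hP.trans (by exact_mod_cast not_lt.1 hpP)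
            calc (2 : ℝ) = ((2 : ℝ) ^ (1 / ε)) ^ ε := by
                  rw [← Real.rpow_mul (by norm_num)]; simp [hε.ne']
              _ ≤ _ := by gcongr
          rw [one_mul, Real.rpow_mul (by positivity), Real.rpow_natCast]
          calc ((n.factorization p : ℝ) + 1) ≤ 2 ^ (n.factorization p) := by
                exact_mod_cast Nat.lt_two_pow_self
            _ ≤ _ := by gcongr
    _ = (∏ p ∈ n.primeFactors, (if p < P then K else 1)) * _ := Finset.prod_mul_distrib
    _ ≤ _ := by gcongr

theorem card_ker_unitsMap_mul_totient {q d : ℕ} [NeZero q] (hd : d ∣ q) :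
    Nat.card (ZMod.unitsMap hd).ker * d.totient = q.totient := by
  have : NeZero d := ⟨fun h => NeZero.ne q (Nat.eq_zero_of_zero_dvd (h ▸ hd))⟩
  have h1 := (ZMod.unitsMap hd).ker.card_mul_index
  rw [Subgroup.index_ker, MonoidHom.range_eq_top.2 (ZMod.unitsMap_surjective hd)] at h1
  simpa [Nat.card_eq_fintype_card, ZMod.card_units_eq_totient] using h1

theorem card_ker_unitsMap_le {d e : ℕ} [NeZero (d * e)] (hd : e ∣ d * e) :
    Nat.card (ZMod.unitsMap hd).ker ≤ d := by
  have he : 0 < e := Nat.pos_of_ne_zero fun h => NeZero.ne (d * e) (by simp [h])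
  have : NeZero e := ⟨he.ne'⟩
  have hlt : ∀ a : (ZMod (d * e))ˣ, (a : ZMod (d * e)).val / e < d := fun a =>
    Nat.div_lt_of_lt_mul ((ZMod.val_lt _).trans_eq (mul_comm d e))
  refine (Nat.card_le_card_of_injective
    (fun a : (ZMod.unitsMap hd).ker => (⟨((a : (ZMod (d * e))ˣ) : ZMod (d * e)).val / e, hlt _⟩ : Fin d))
    fun a b hab => ?_).trans_eq (Nat.card_fin d)
  have key : ∀ c : (ZMod.unitsMap hd).ker,
      (((c : (ZMod (d * e))ˣ) : ZMod (d * e)).val : ZMod e) = 1 := by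
    intro c
    have := congrArg (Units.val) (MonoidHom.mem_ker.1 c.2)
    rw [ZMod.unitsMap_val] at this
    rw [ZMod.natCast_val]
    simpa using this
  have hmod := (ZMod.natCast_eq_natCast_iff' _ _ _).1 ((key a).trans (key b).symm)
  simp only [Fin.mk.injEq] at hab
  refine Subtype.ext (Units.ext (ZMod.val_injective _ ?_))
  rw [← Nat.div_add_mod ((a : (ZMod (d * e))ˣ) : ZMod (d * e)).val e, hmod, hab, Nat.div_add_mod]

open Classical in
/-- Units `a` modulo `q` such that `a * m` has a representative in `[-Y, Y] \ {0}`. -/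
noncomputable def unitsNearZero (q m : ℕ) [NeZero q] (Y : ℝ) : Finset (ZMod q)ˣ :=
  Finset.univ.filter fun a => ∃ y : ℕ, 1 ≤ y ∧ (y : ℝ) ≤ Y ∧
    ((a : ZMod q) * m = y ∨ (a : ZMod q) * m = -y)

theorem mem_unitsNearZero {q m : ℕ} [NeZero q] {Y : ℝ} {a : (ZMod q)ˣ} :
    a ∈ unitsNearZero q m Y ↔ ∃ y : ℕ, 1 ≤ y ∧ (y : ℝ) ≤ Y ∧
      ((a : ZMod q) * m = y ∨ (a : ZMod q) * m = -y) := by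
  simp [unitsNearZero]

open Classical in
theorem card_units_mul_eq_le (q m : ℕ) [NeZero q] (Y : ℝ) (hY : 0 ≤ Y) :
    ((Finset.univ.filter fun a : (ZMod q)ˣ =>
        ∃ y : ℕ, 1 ≤ y ∧ (y : ℝ) ≤ Y ∧ (a : ZMod q) * m = y).card : ℝ)
      ≤ q.totient * Y / q + Nat.gcd m q * q.divisors.card := by
  obtain ⟨d, e, m', hd0, hq, hm, hco, hgcd⟩ : ∃ d e m' : ℕ, 0 < d ∧ q = d * e ∧ m = d * m' ∧
      Nat.Coprime m' e ∧ Nat.gcd m q = d := by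
    have hd0 : 0 < Nat.gcd m q := Nat.gcd_pos_of_pos_right _ (NeZero.pos q)
    refine ⟨Nat.gcd m q, q / Nat.gcd m q, m / Nat.gcd m q, hd0, ?_, ?_,
      Nat.coprime_div_gcd_div_gcd hd0, rfl⟩
    · exact (Nat.mul_div_cancel' (Nat.gcd_dvd_right _ _)).symm
    · exact (Nat.mul_div_cancel' (Nat.gcd_dvd_left _ _)).symm
  rw [hgcd]
  subst hq hm
  have he : 0 < e := Nat.pos_of_ne_zero fun h => NeZero.ne (d * e) (by simp [h])
  have : NeZero e := ⟨he.ne'⟩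
  have hdvd : e ∣ d * e := Dvd.intro_left d rfl
  set N := ⌊Y / d⌋₊ with hN
  set κ := Nat.card (ZMod.unitsMap hdvd).ker with hκ
  set S := (Finset.Icc 1 N).filter fun y => Nat.Coprime y e with hS
  have hsub : (Finset.univ.filter fun a : (ZMod (d * e))ˣ =>
        ∃ y : ℕ, 1 ≤ y ∧ (y : ℝ) ≤ Y ∧ (a : ZMod (d * e)) * (d * m' : ℕ) = y) ⊆
      S.biUnion fun y => Finset.univ.filter fun a : (ZMod (d * e))ˣ =>
        (ZMod.unitsMap hdvd a : ZMod e) * m' = y := by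
    intro a ha
    obtain ⟨y, hy1, hyY, hay⟩ := (Finset.mem_filter.1 ha).2
    have hay' : ((((a : ZMod (d * e)).val * (d * m') : ℕ)) : ZMod (d * e)) = (y : ℕ) := by
      push_cast at hay ⊢
      rw [ZMod.natCast_zmod_val]; exact hay
    rw [ZMod.natCast_eq_natCast_iff] at hay'
    have hdy : d ∣ y := by
      refine (Nat.modEq_zero_iff_dvd).1 ?_
      refine ((hay'.of_dvd (Dvd.intro e rfl)).symm).trans ?_
      exact (Nat.modEq_zero_iff_dvd).2 ⟨(a : ZMod (d * e)).val * m', by ring⟩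
    obtain ⟨y', rfl⟩ := hdy
    have h2 : (a : ZMod (d * e)).val * m' ≡ y' [MOD e] := by
      refine Nat.ModEq.mul_left_cancel' hd0.ne' ?_
      convert hay' using 1; ring
    have h3 : (ZMod.unitsMap hdvd a : ZMod e) * m' = y' := by
      rw [← ZMod.natCast_eq_natCast_iff] at h2
      push_cast at h2
      rw [ZMod.unitsMap_val, ← h2, ZMod.natCast_val]
    simp only [Finset.mem_biUnion, Finset.mem_filter, Finset.mem_univ, true_and, hS,
      Finset.mem_Icc]
    refine ⟨y', ⟨⟨Nat.pos_of_ne_zero fun h => by simp [h] at hy1, ?_⟩, ?_⟩, h3⟩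
    · rw [hN, Nat.le_floor_iff (by positivity), le_div_iff₀ (by exact_mod_cast hd0)]
      push_cast at hyY; linarith
    · rw [← ZMod.isUnit_iff_coprime, ← h3]
      exact (Units.isUnit _).mul ((ZMod.isUnit_iff_coprime _ _).2 hco)
  have hfib : ∀ y ∈ S, (Finset.univ.filter fun a : (ZMod (d * e))ˣ =>
        (ZMod.unitsMap hdvd a : ZMod e) * m' = y).card ≤ κ := by
    intro y _
    rcases (Finset.univ.filter fun a : (ZMod (d * e))ˣ =>
        (ZMod.unitsMap hdvd a : ZMod e) * m' = y).eq_empty_or_nonempty with h | ⟨b, hb⟩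
    · simp [h]
    rw [hκ, ← SetLike.coe_sort_coe, Nat.card_coe_set_eq, ← Set.ncard_coe_finset]
    refine Set.ncard_le_ncard_of_injOn (fun a => a * b⁻¹) ?_ ?_ (Set.toFinite _)
    · intro a ha
      have ha' := (Finset.mem_filter.1 (Finset.mem_coe.1 ha)).2
      have hb' := (Finset.mem_filter.1 hb).2
      rw [SetLike.mem_coe, MonoidHom.mem_ker, map_mul, map_inv, mul_inv_eq_one]
      refine Units.ext ?_
      exact ((ZMod.isUnit_iff_coprime _ _).2 hco).mul_right_cancel (ha'.trans hb'.symm)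
    · intro a _ c _ hac
      exact mul_right_cancel hac
  have hcard : ((Finset.univ.filter fun a : (ZMod (d * e))ˣ =>
        ∃ y : ℕ, 1 ≤ y ∧ (y : ℝ) ≤ Y ∧ (a : ZMod (d * e)) * (d * m' : ℕ) = y).card : ℝ)
      ≤ S.card * κ := by
    exact_mod_cast (Finset.card_le_card hsub).trans (Finset.card_biUnion_le_card_mul _ _ _ hfib)
  have hScard : (S.card : ℝ) ≤ N * (e.totient / e) + e.divisors.card := by
    have := (abs_le.1 (abs_card_coprime_sub_le e N he)).2
    linarith
  have hNle : (N : ℝ) ≤ Y / d := Nat.floor_le (by positivity)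
  have hκφ : (κ : ℝ) * e.totient = (d * e).totient := by
    exact_mod_cast card_ker_unitsMap_mul_totient hdvd
  have hκd : (κ : ℝ) ≤ d := by exact_mod_cast card_ker_unitsMap_le hdvd
  have hdiv : (e.divisors.card : ℝ) ≤ (d * e).divisors.card := by
    exact_mod_cast Finset.card_le_card (Nat.divisors_subset_of_dvd (NeZero.ne _) hdvd)
  have he' : (0 : ℝ) < e := by exact_mod_cast he
  have hd' : (0 : ℝ) < d := by exact_mod_cast hd0
  calc _ ≤ (S.card : ℝ) * κ := hcard
    _ ≤ (Y / d * (e.totient / e) + e.divisors.card) * κ := by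
      gcongr
      exact hScard.trans (by gcongr)
    _ = (κ * e.totient) * Y / (d * e) + κ * e.divisors.card := by field_simp
    _ ≤ _ := by
      rw [hκφ]; push_cast; gcongr

theorem card_unitsNearZero_le (q m : ℕ) [NeZero q] (Y : ℝ) (hY : 0 ≤ Y) :
    ((unitsNearZero q m Y).card : ℝ)
      ≤ 2 * (q.totient * Y / q + Nat.gcd m q * q.divisors.card) := by
  classical
  set E := Finset.univ.filter fun a : (ZMod q)ˣ =>
        ∃ y : ℕ, 1 ≤ y ∧ (y : ℝ) ≤ Y ∧ (a : ZMod q) * m = y with hE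
  have hsub : unitsNearZero q m Y ⊆ E ∪ E.image (fun a => -a) := by
    intro a ha
    obtain ⟨y, hy1, hyY, h | h⟩ := mem_unitsNearZero.1 ha
    · exact Finset.mem_union_left _ (Finset.mem_filter.2 ⟨Finset.mem_univ _, y, hy1, hyY, h⟩)
    · refine Finset.mem_union_right _ (Finset.mem_image.2 ⟨-a, Finset.mem_filter.2
        ⟨Finset.mem_univ _, y, hy1, hyY, ?_⟩, neg_neg a⟩)
      rw [Units.val_neg, neg_mul, h, neg_neg]
  have h1 : (unitsNearZero q m Y).card ≤ E.card + E.card :=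
    (Finset.card_le_card hsub).trans ((Finset.card_union_le _ _).trans
      (Nat.add_le_add_left Finset.card_image_le _))
  have h2 := card_units_mul_eq_le q m Y hY
  have h3 : ((unitsNearZero q m Y).card : ℝ) ≤ E.card + E.card := by exact_mod_cast h1
  rw [← hE] at h2
  linarith

theorem tendsto_card_divisors_sq_mul_sqrt_div_totient :
    Tendsto (fun q : ℕ => (q.divisors.card : ℝ) ^ 2 * Real.sqrt q / q.totient) atTop (𝓝 0) := by
  obtain ⟨C, hC, hτ⟩ := exists_card_divisors_le_rpow (1 / 12) (by norm_num)
  have hlim : Tendsto (fun q : ℕ => C ^ 3 * ((q : ℝ) ^ (-(1 / 4) : ℝ))) atTop (𝓝 0) := by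
    have := ((tendsto_rpow_neg_atTop (y := 1 / 4) (by norm_num)).comp
      tendsto_natCast_atTop_atTop).const_mul (C ^ 3)
    simpa using this
  refine squeeze_zero' (Eventually.of_forall fun q => by positivity) ?_ hlim
  filter_upwards [eventually_gt_atTop 0] with q hq
  have hq' : (0 : ℝ) < q := by exact_mod_cast hq
  have hφ : (0 : ℝ) < q.totient := by exact_mod_cast Nat.totient_pos.2 hq
  rw [div_le_iff₀ hφ]
  have h1 : (q : ℝ) ≤ q.totient * q.divisors.card := by
    exact_mod_cast le_totient_mul_card_divisors q
  have h2 := hτ q hq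
  set t : ℝ := (q.divisors.card : ℝ)
  have ht : 0 < t := by
    have : 0 < q.divisors.card := Finset.card_pos.2 ⟨1, by simp [hq.ne']⟩
    exact Nat.cast_pos.2 this
  have h3 : t ^ 3 ≤ C ^ 3 * (q : ℝ) ^ (1 / 4 : ℝ) := by
    calc t ^ 3 ≤ (C * (q : ℝ) ^ (1 / 12 : ℝ)) ^ 3 := by gcongr
      _ = _ := by rw [mul_pow, ← Real.rpow_natCast ((q : ℝ) ^ _), ← Real.rpow_mul hq'.le]; norm_num
  refine le_of_mul_le_mul_right ?_ ht
  calc t ^ 2 * Real.sqrt q * t = t ^ 3 * Real.sqrt q := by ring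
    _ ≤ (C ^ 3 * (q : ℝ) ^ (1 / 4 : ℝ)) * Real.sqrt q := by gcongr
    _ = C ^ 3 * (q : ℝ) ^ (-(1 / 4) : ℝ) * q := by
      have e1 : Real.sqrt q = (q : ℝ) ^ (1 / 2 : ℝ) := Real.sqrt_eq_rpow _
      have e2 : (q : ℝ) = (q : ℝ) ^ (1 : ℝ) := (Real.rpow_one _).symm
      rw [e1, mul_assoc, mul_assoc, ← Real.rpow_add hq']
      conv_rhs => rw [e2]
      rw [← Real.rpow_mul hq'.le, ← Real.rpow_add hq']
      norm_num
    _ ≤ C ^ 3 * (q : ℝ) ^ (-(1 / 4) : ℝ) * (q.totient * t) := by gcongr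
    _ = _ := by ring

theorem sum_gcd_le (q R : ℕ) (hq : 0 < q) :
    ∑ r ∈ Finset.Icc 1 R, Nat.gcd r q ≤ q.divisors.card * R := by
  have h1 : ∀ r ∈ Finset.Icc 1 R, Nat.gcd r q ≤ ∑ d ∈ q.divisors, if d ∣ r then d else 0 := by
    intro r _
    refine le_trans ?_ (Finset.single_le_sum (f := fun d => if d ∣ r then d else 0)
      (fun _ _ => Nat.zero_le _) (Nat.mem_divisors.2 ⟨Nat.gcd_dvd_right r q, hq.ne'⟩))
    simp [Nat.gcd_dvd_left]
  calc _ ≤ ∑ r ∈ Finset.Icc 1 R, ∑ d ∈ q.divisors, (if d ∣ r then d else 0) :=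
        Finset.sum_le_sum h1
    _ = ∑ d ∈ q.divisors, ∑ r ∈ Finset.Icc 1 R, (if d ∣ r then d else 0) := Finset.sum_comm
    _ ≤ ∑ d ∈ q.divisors, R := by
      refine Finset.sum_le_sum fun d _ => ?_
      rw [← Finset.sum_filter, Finset.sum_const, smul_eq_mul]
      have : ((Finset.Icc 1 R).filter fun r => d ∣ r).card = R / d := by
        rw [← Nat.Ioc_filter_dvd_card_eq_div]; rfl
      rw [this]
      exact Nat.div_mul_le_self R d
    _ = _ := by simp

/-- Reals `x` admitting a denominator `r ≥ J` with `0 < ‖r x‖ < ψ r / r`. -/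
def wellApprox (ψ : ℕ → ℝ) (J : ℕ) : Set ℝ :=
  {x | ∃ r : ℕ, J ≤ r ∧ ∃ p : ℤ, 0 < |r * x - p| ∧ r * |r * x - p| < ψ r}

theorem exists_tail_sum_le {g : ℕ → ℝ} (hg : Summable g) (ε : ℝ) (hε : 0 < ε) :
    ∃ J₀ : ℕ, ∀ t : Finset ℕ, (∀ r ∈ t, J₀ ≤ r) → ∑ r ∈ t, g r ≤ ε := by
  obtain ⟨s, hs⟩ := hg.vanishing (Metric.ball_mem_nhds 0 hε)
  refine ⟨s.sup id + 1, fun t ht => ?_⟩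
  have := hs t (Finset.disjoint_left.2 fun r hrt hrs => by
    have h1 := ht r hrt
    have h2 : r ≤ s.sup id := Finset.le_sup (f := id) hrs
    omega)
  rw [mem_ball_zero_iff, Real.norm_eq_abs] at this
  exact (le_abs_self _).trans this.le

theorem mem_unitsNearZero_or_inv {ψ : ℕ → ℝ} (hanti : Antitone ψ) {J : ℕ} (hJ1 : 1 ≤ J)
    (hψ1 : ∀ r, J ≤ r → ψ r ≤ 1) {q : ℕ} [NeZero q] {a : ℕ} (u : (ZMod q)ˣ)
    (hu : (u : ZMod q) = a) (hbad : (a / q : ℝ) ∈ wellApprox ψ J) :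
    (∃ r ∈ Finset.Icc J (Nat.sqrt q), u ∈ unitsNearZero q r (q * ψ r / r)) ∨
    (∃ n ∈ Finset.Icc 1 (Nat.sqrt q), u⁻¹ ∈ unitsNearZero q n (q * ψ (Nat.sqrt q) / n)) := by
  obtain ⟨r, hJr, p, hpos, hlt⟩ := hbad
  have hq : (0 : ℝ) < q := by exact_mod_cast NeZero.pos q
  have hr0 : 0 < r := by omega
  have hr0' : (0 : ℝ) < r := by exact_mod_cast hr0
  set z : ℤ := a * r - p * q with hz
  set n := z.natAbs with hn
  have habs : |(r : ℝ) * (a / q) - p| = n / q := by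
    have h1 : (n : ℝ) = |(z : ℝ)| := by
      rw [hn, ← Int.cast_abs, Int.abs_eq_natAbs]; rfl
    have : (r : ℝ) * (a / q) - p = z / q := by rw [hz]; push_cast; field_simp
    rw [this, abs_div, h1, abs_of_pos hq]
  rw [habs] at hpos hlt
  have hn1 : 1 ≤ n := by
    by_contra h
    have : n = 0 := by omega
    simp [this] at hpos
  have hn0' : (0 : ℝ) < n := by exact_mod_cast hn1
  have hcong : (u : ZMod q) * r = n ∨ (u : ZMod q) * r = -n := by
    have h1 : (u : ZMod q) * r = (z : ZMod q) := by rw [hu, hz]; push_cast; simp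
    rcases Int.natAbs_eq z with h | h
    · left; rw [h1, h, Int.cast_natCast]
    · right; rw [h1, h, Int.cast_neg, Int.cast_natCast]
  have hlt' : (r : ℝ) * n < q * ψ r := by
    rw [← mul_div_assoc, div_lt_iff₀ hq] at hlt; linarith
  by_cases hrR : r ≤ Nat.sqrt q
  · refine Or.inl ⟨r, Finset.mem_Icc.2 ⟨hJr, hrR⟩, ?_⟩
    refine mem_unitsNearZero.2 ⟨n, hn1, ?_, hcong⟩
    rw [le_div_iff₀ hr0']; linarith
  · have hrR' : Nat.sqrt q + 1 ≤ r := by omega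
    have hnq : r * n < q := by
      have : (r : ℝ) * n < q := hlt'.trans_le (by nlinarith [hψ1 r hJr])
      exact_mod_cast this
    have hnR : n ≤ Nat.sqrt q := by
      by_contra h
      have h1 : Nat.sqrt q + 1 ≤ n := by omega
      have := Nat.mul_le_mul hrR' h1
      have := Nat.lt_succ_sqrt q
      simp only [Nat.succ_eq_add_one] at this
      omega
    refine Or.inr ⟨n, Finset.mem_Icc.2 ⟨hn1, hnR⟩, ?_⟩
    refine mem_unitsNearZero.2 ⟨r, hr0, ?_, ?_⟩
    · rw [le_div_iff₀ hn0']
      have : ψ r ≤ ψ (Nat.sqrt q) := hanti (by omega)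
      nlinarith
    · rcases hcong with h | h
      · left; rw [← h, Units.inv_mul_cancel_left]
      · right
        have : (n : ZMod q) = u * (-r) := by rw [mul_neg, h, neg_neg]
        rw [this, Units.inv_mul_cancel_left]

open Classical in
/-- The proportion of reduced fractions with denominator `q` in `wellApprox ψ J` is small when
`J` is large, uniformly for large `q`. -/
theorem exists_card_wellApprox_le {ψ : ℕ → ℝ} (hψ0 : ∀ r, 0 ≤ ψ r) (hanti : Antitone ψ)
    (hlim : Tendsto ψ atTop (𝓝 0)) (hsum : Summable fun r : ℕ => ψ r / r) (ε : ℝ) (hε : 0 < ε) :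
    ∃ J₀ : ℕ, ∀ J ≥ J₀, ∀ᶠ q : ℕ in atTop,
      ((((Finset.Icc 1 q).filter fun a => Nat.Coprime a q).filter
        fun a : ℕ => (a / q : ℝ) ∈ wellApprox ψ J).card : ℝ) ≤ ε * q.totient := by
  obtain ⟨J₁, hJ₁⟩ := exists_tail_sum_le hsum (ε / 16) (by positivity)
  obtain ⟨J₂, hJ₂⟩ := eventually_atTop.1 (hlim.eventually (ge_mem_nhds zero_lt_one))
  refine ⟨J₁ + J₂ + 1, fun J hJ => ?_⟩
  have hsqrt : Tendsto Nat.sqrt atTop atTop :=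
    tendsto_atTop.2 fun b => eventually_atTop.2 ⟨b * b, fun n hn => Nat.le_sqrt.2 hn⟩
  have hev1 : ∀ᶠ q : ℕ in atTop, ψ (Nat.sqrt q) * J ≤ ε / 16 := by
    have : Tendsto (fun q : ℕ => ψ (Nat.sqrt q) * J) atTop (𝓝 0) := by
      simpa using (hlim.comp hsqrt).mul_const (J : ℝ)
    exact this.eventually (ge_mem_nhds (by positivity))
  have hev2 := tendsto_card_divisors_sq_mul_sqrt_div_totient.eventually
    (ge_mem_nhds (show 0 < ε / 16 by positivity))
  filter_upwards [hev1, hev2, eventually_gt_atTop 0] with q h1 h2 hq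
  have : NeZero q := ⟨hq.ne'⟩
  have hq' : (0 : ℝ) < q := by exact_mod_cast hq
  have hφ : (0 : ℝ) < q.totient := by exact_mod_cast Nat.totient_pos.2 hq
  set R := Nat.sqrt q with hR
  set τ : ℝ := (q.divisors.card : ℝ) with hτ
  set φ : ℝ := (q.totient : ℝ) with hφdef
  set U₁ := (Finset.Icc J R).biUnion fun r => unitsNearZero q r (q * ψ r / r) with hU₁
  set U₂ := (Finset.Icc 1 R).biUnion fun n => unitsNearZero q n (q * ψ R / n) with hU₂
  set Bq := ((Finset.Icc 1 q).filter fun a => Nat.Coprime a q).filter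
        fun a : ℕ => (a / q : ℝ) ∈ wellApprox ψ J with hBq
  have hcard : Bq.card ≤ (U₁ ∪ U₂.image (·⁻¹)).card := by
    refine Finset.card_le_card_of_injOn
      (fun a => if h : Nat.Coprime a q then ZMod.unitOfCoprime a h else 1) ?_ ?_
    · intro a ha
      obtain ⟨ha1, hbad⟩ := Finset.mem_filter.1 (Finset.mem_coe.1 ha)
      have hco := (Finset.mem_filter.1 ha1).2
      beta_reduce
      rw [dif_pos hco, Finset.mem_coe, Finset.mem_union]
      rcases mem_unitsNearZero_or_inv hanti (by omega) (fun r hr => hJ₂ r (by omega))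
        (ZMod.unitOfCoprime a hco) (ZMod.coe_unitOfCoprime a hco) hbad with ⟨r, hr, h⟩ | ⟨n, hn, h⟩
      · exact Or.inl (Finset.mem_biUnion.2 ⟨r, hr, h⟩)
      · exact Or.inr (Finset.mem_image.2 ⟨_, Finset.mem_biUnion.2 ⟨n, hn, h⟩, inv_inv _⟩)
    · intro a ha b hb hab
      obtain ⟨ha1, hco⟩ := Finset.mem_filter.1 (Finset.mem_filter.1 (Finset.mem_coe.1 ha)).1
      obtain ⟨hb1, hco'⟩ := Finset.mem_filter.1 (Finset.mem_filter.1 (Finset.mem_coe.1 hb)).1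
      dsimp only at hab
      rw [dif_pos hco, dif_pos hco'] at hab
      have := congrArg Units.val hab
      rw [ZMod.coe_unitOfCoprime, ZMod.coe_unitOfCoprime, ZMod.natCast_eq_natCast_iff] at this
      rw [Finset.mem_Icc] at ha1 hb1
      have h3 : a - 1 ≡ b - 1 [MOD q] := by
        refine Nat.ModEq.add_right_cancel' 1 ?_
        rwa [Nat.sub_add_cancel ha1.1, Nat.sub_add_cancel hb1.1]
      have h4 := h3.eq_of_lt_of_lt (by omega) (by omega)
      omega
  have hcard' : (Bq.card : ℝ) ≤ ∑ r ∈ Finset.Icc J R, ((unitsNearZero q r (q * ψ r / r)).card : ℝ)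
      + ∑ n ∈ Finset.Icc 1 R, ((unitsNearZero q n (q * ψ R / n)).card : ℝ) := by
    exact_mod_cast hcard.trans ((Finset.card_union_le _ _).trans (add_le_add
      Finset.card_biUnion_le (Finset.card_image_le.trans Finset.card_biUnion_le)))
  have hterm : ∀ (m : ℕ) (c : ℝ), 0 ≤ c → ((unitsNearZero q m (q * c / m)).card : ℝ)
      ≤ 2 * (φ * (c / m) + Nat.gcd m q * τ) := by
    intro m c hc
    refine (card_unitsNearZero_le q m _ (by positivity)).trans_eq ?_
    rw [← hφdef, ← hτ]
    field_simp
  have hgcd : ∑ r ∈ Finset.Icc 1 R, (Nat.gcd r q : ℝ) ≤ τ * R := by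
    rw [hτ]; exact_mod_cast sum_gcd_le q R hq
  have hgcd' : ∑ r ∈ Finset.Icc J R, (Nat.gcd r q : ℝ) ≤ τ * R :=
    (Finset.sum_le_sum_of_subset_of_nonneg (Finset.Icc_subset_Icc_left (by omega))
      fun _ _ _ => by positivity).trans hgcd
  have hS₁ : ∑ r ∈ Finset.Icc J R, ψ r / r ≤ ε / 16 :=
    hJ₁ _ fun r hr => by rw [Finset.mem_Icc] at hr; omega
  have hS₂ : ∑ n ∈ Finset.Icc 1 R, ψ R / n ≤ ε / 16 + ε / 16 := by
    calc _ ≤ ∑ n ∈ Finset.Icc 1 R, ((if J ≤ n then ψ n / n else 0)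
          + if n < J then ψ R else 0) := by
          refine Finset.sum_le_sum fun n hn => ?_
          rw [Finset.mem_Icc] at hn
          have hn1 : (1 : ℝ) ≤ n := by exact_mod_cast hn.1
          by_cases hJn : J ≤ n
          · rw [if_pos hJn, if_neg (by omega), add_zero]
            gcongr
            exact hanti hn.2
          · rw [if_neg hJn, if_pos (by omega), zero_add]
            exact div_le_self (hψ0 R) hn1
      _ ≤ _ := by
          rw [Finset.sum_add_distrib, ← Finset.sum_filter, ← Finset.sum_filter, Finset.sum_const]
          refine add_le_add (hJ₁ _ fun r hr => ?_) (le_trans ?_ h1)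
          · have := (Finset.mem_filter.1 hr).2; omega
          · rw [nsmul_eq_mul, mul_comm]
            gcongr
            · exact hψ0 R
            calc _ ≤ (Finset.range J).card := Finset.card_le_card fun n hn => by
                  simpa using (Finset.mem_filter.1 hn).2
              _ = J := Finset.card_range J
  have hR' : (R : ℝ) ≤ Real.sqrt q := Real.nat_sqrt_le_real_sqrt
  have h3 : τ * (τ * R) ≤ ε / 16 * φ := by
    rw [div_le_iff₀ hφ] at h2
    calc τ * (τ * R) = τ ^ 2 * R := by ring
      _ ≤ τ ^ 2 * Real.sqrt q := by gcongr
      _ ≤ _ := h2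
  have hτ0 : 0 ≤ τ := by positivity
  calc (Bq.card : ℝ) ≤ ∑ r ∈ Finset.Icc J R, 2 * (φ * (ψ r / r) + Nat.gcd r q * τ)
      + ∑ n ∈ Finset.Icc 1 R, 2 * (φ * (ψ R / n) + Nat.gcd n q * τ) :=
        hcard'.trans (add_le_add (Finset.sum_le_sum fun r _ => hterm r _ (hψ0 r))
          (Finset.sum_le_sum fun r _ => hterm r _ (hψ0 R)))
    _ = 2 * (φ * (∑ r ∈ Finset.Icc J R, ψ r / r) + τ * ∑ r ∈ Finset.Icc J R, (Nat.gcd r q : ℝ))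
      + 2 * (φ * (∑ n ∈ Finset.Icc 1 R, ψ R / n) + τ * ∑ n ∈ Finset.Icc 1 R, (Nat.gcd n q : ℝ)) := by
        simp only [Finset.mul_sum, Finset.sum_add_distrib, mul_add, mul_comm _ τ]
    _ ≤ 2 * (φ * (ε / 16) + τ * (τ * R)) + 2 * (φ * (ε / 16 + ε / 16) + τ * (τ * R)) := by
        gcongr
    _ ≤ ε * φ := by nlinarith

/-- `u` satisfies `1 / u j = b j + u (j + 1)` for `j < n`, with positive integers `b j`. -/
structure IsCFChain (u : ℕ → ℝ) (b : ℕ → ℕ) (n : ℕ) : Prop where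
  pos : ∀ j < n, 0 < u j
  nonneg : ∀ j ≤ n, 0 ≤ u j
  one_le : ∀ j < n, 1 ≤ b j
  rel : ∀ j < n, u j * (b j + u (j + 1)) = 1

/-- Denominators of the convergents of `1 / (b 0 + 1 / (b 1 + ⋯))`. -/
def cfDen (b : ℕ → ℕ) : ℕ → ℕ
  | 0 => 1
  | 1 => b 0
  | i + 2 => b (i + 1) * cfDen b (i + 1) + cfDen b i

/-- Numerators of the convergents of `1 / (b 0 + 1 / (b 1 + ⋯))`. -/
def cfNum (b : ℕ → ℕ) : ℕ → ℕ
  | 0 => 0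
  | 1 => 1
  | i + 2 => b (i + 1) * cfNum b (i + 1) + cfNum b i

/-- The product `u 0 * ⋯ * u (i - 1)`. -/
def cfProd (u : ℕ → ℝ) (i : ℕ) : ℝ := ∏ j ∈ Finset.range i, u j

theorem cfProd_zero (u : ℕ → ℝ) : cfProd u 0 = 1 := by simp [cfProd]

theorem cfProd_succ (u : ℕ → ℝ) (i : ℕ) : cfProd u (i + 1) = cfProd u i * u i :=
  Finset.prod_range_succ _ _

namespace IsCFChain

variable {u : ℕ → ℝ} {b : ℕ → ℕ} {n : ℕ}

theorem mono (hc : IsCFChain u b n) {m : ℕ} (hm : m ≤ n) : IsCFChain u b m :=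
  ⟨fun j hj => hc.pos j (by omega), fun j hj => hc.nonneg j (by omega),
    fun j hj => hc.one_le j (by omega), fun j hj => hc.rel j (by omega)⟩

theorem le_one (hc : IsCFChain u b n) {j : ℕ} (hj : j < n) : u j ≤ 1 := by
  have h1 := hc.rel j hj
  have h2 : (1 : ℝ) ≤ b j := by exact_mod_cast hc.one_le j hj
  have h3 := hc.nonneg (j + 1) (by omega)
  have h4 := hc.pos j hj
  nlinarith

theorem cfProd_nonneg (hc : IsCFChain u b n) {i : ℕ} (hi : i ≤ n + 1) : 0 ≤ cfProd u i :=
  Finset.prod_nonneg fun j hj => hc.nonneg j (by rw [Finset.mem_range] at hj; omega)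

theorem cfProd_pos (hc : IsCFChain u b n) {i : ℕ} (hi : i ≤ n) : 0 < cfProd u i :=
  Finset.prod_pos fun j hj => hc.pos j (by rw [Finset.mem_range] at hj; omega)

theorem cfDen_mul_cfProd_add (hc : IsCFChain u b n) {i : ℕ} (hi : i + 1 ≤ n) :
    cfDen b (i + 1) * cfProd u (i + 1) + cfDen b i * cfProd u (i + 2) = 1 := by
  induction i with
  | zero =>
    have := hc.rel 0 (by omega)
    simp only [cfDen, cfProd_succ, cfProd_zero, zero_add, Nat.cast_one] at *
    linarith
  | succ i ih =>
    have h1 := ih (by omega)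
    have h2 := hc.rel (i + 1) (by omega)
    rw [cfProd_succ u (i + 1 + 1), cfProd_succ u (i + 1), cfDen]
    rw [cfProd_succ u (i + 1)] at h1
    push_cast
    linear_combination h1 + (cfDen b (i + 1) * cfProd u (i + 1)) * h2

theorem cfDen_mul_sub_cfNum (hc : IsCFChain u b n) {i : ℕ} (hi : i ≤ n) :
    cfDen b i * u 0 - cfNum b i = (-1) ^ i * cfProd u (i + 1) := by
  induction i using Nat.twoStepInduction with
  | zero => simp [cfDen, cfNum, cfProd_succ, cfProd_zero]
  | one =>
    have := hc.rel 0 (by omega)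
    simp only [cfDen, cfNum, cfProd_succ, cfProd_zero, zero_add, Nat.cast_one] at *
    linarith
  | more i ih1 ih2 =>
    have h1 := ih1 (by omega)
    have h2 := ih2 (by omega)
    have h3 := hc.rel (i + 1) (by omega)
    simp only [cfDen, cfNum]
    rw [cfProd_succ u (i + 2), cfProd_succ u (i + 1)]
    rw [cfProd_succ u (i + 1)] at h2
    push_cast
    linear_combination h1 + b (i + 1) * h2 - (-1) ^ i * cfProd u (i + 1) * h3

theorem pow_le_cfDen (hc : IsCFChain u b n) {i : ℕ} (hi : i ≤ n) :
    (2 / 3 : ℝ) * (3 / 2) ^ i ≤ cfDen b i := by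
  induction i using Nat.twoStepInduction with
  | zero => norm_num [cfDen]
  | one =>
    have : (1 : ℝ) ≤ b 0 := by exact_mod_cast hc.one_le 0 (by omega)
    norm_num [cfDen]; exact_mod_cast this
  | more i ih1 ih2 =>
    have h1 := ih1 (by omega)
    have h2 := ih2 (by omega)
    have h3 : (1 : ℝ) ≤ b (i + 1) := by exact_mod_cast hc.one_le (i + 1) (by omega)
    have h4 : (0 : ℝ) ≤ cfDen b (i + 1) := by positivity
    have h5 : (0 : ℝ) ≤ (3 / 2) ^ i := by positivity
    rw [pow_succ] at *
    simp only [cfDen]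
    rw [pow_succ]
    push_cast
    nlinarith

theorem cfDen_pos (hc : IsCFChain u b n) {i : ℕ} (hi : i ≤ n) : 0 < cfDen b i := by
  have h := hc.pow_le_cfDen hi
  have : (0 : ℝ) < cfDen b i := lt_of_lt_of_le (by positivity) h
  exact_mod_cast this

theorem le_cfDen (hc : IsCFChain u b n) {i : ℕ} (hi : i ≤ n) : i ≤ cfDen b i := by
  induction i using Nat.twoStepInduction with
  | zero => simp
  | one => exact hc.one_le 0 (by omega)
  | more i ih1 ih2 =>
    have h2 := ih2 (by omega)
    have h3 := hc.one_le (i + 1) (by omega)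
    have h4 := hc.cfDen_pos (i := i) (by omega)
    simp only [cfDen]
    nlinarith

theorem cfDen_mul_cfProd_le_one (hc : IsCFChain u b n) {i : ℕ} (hi : i ≤ n) :
    cfDen b i * cfProd u i ≤ 1 := by
  rcases i with _ | i
  · simp [cfDen, cfProd_zero]
  · have h1 := hc.cfDen_mul_cfProd_add hi
    have h2 := hc.cfProd_nonneg (i := i + 2) (by omega)
    have : (0 : ℝ) ≤ cfDen b i := by positivity
    nlinarith [mul_nonneg this h2]

theorem cfProd_le_inv (hc : IsCFChain u b n) {i : ℕ} (hi : i ≤ n) :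
    cfProd u i ≤ (cfDen b i : ℝ)⁻¹ := by
  have h1 := hc.cfDen_mul_cfProd_le_one hi
  have h2 : (0 : ℝ) < cfDen b i := by exact_mod_cast hc.cfDen_pos hi
  rw [← one_div, le_div_iff₀ h2]; linarith

theorem le_of_notMem_wellApprox (hc : IsCFChain u b n) {ψ : ℕ → ℝ} {J : ℕ}
    (hx : u 0 ∉ wellApprox ψ J) {i : ℕ} (hJ : J ≤ i) (hi : i < n) :
    ψ (cfDen b i) ≤ u i := by
  by_contra! hlt
  refine hx ⟨cfDen b i, hJ.trans (hc.le_cfDen hi.le), cfNum b i, ?_⟩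
  have h0 := hc.cfProd_pos (i := i + 1) (by omega)
  have h1 : |(cfDen b i : ℝ) * u 0 - ((cfNum b i : ℕ) : ℤ)| = cfProd u (i + 1) := by
    rw [Int.cast_natCast, hc.cfDen_mul_sub_cfNum hi.le, abs_mul, abs_pow, abs_neg, abs_one,
      one_pow, one_mul, abs_of_pos h0]
  rw [h1]
  refine ⟨h0, lt_of_le_of_lt ?_ hlt⟩
  rw [cfProd_succ, ← mul_assoc]
  exact mul_le_of_le_one_left (hc.nonneg i hi.le) (hc.cfDen_mul_cfProd_le_one hi.le)

end IsCFChain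

/-- The partial sum `∑ j < J, (u 0 ⋯ u (j - 1)) ^ (-k) * h ((-1) ^ j * u j)`. -/
noncomputable def cfSum (k : ℂ) (h : ℝ → ℂ) (u : ℕ → ℝ) (J : ℕ) : ℂ :=
  ∑ j ∈ Finset.range J, ((cfProd u j : ℝ) : ℂ) ^ (-k) * h ((-1) ^ j * u j)

/-- The value `f (s * v)`, replaced by `f s` when `v = 0`. -/
def signedVal (f : ℚ → ℂ) (s v : ℚ) : ℂ := if v = 0 then f s else f (s * v)

section Reciprocity

variable {f : ℚ → ℂ}

theorem apply_add_nat_of_pos (hper : ∀ x : ℚ, x ∉ Set.Icc (-1 : ℚ) 0 → f (x + 1) = f x)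
    {x : ℚ} (hx : 0 < x) (n : ℕ) : f (x + n) = f x := by
  induction n with
  | zero => simp
  | succ n ih =>
    rw [← ih, ← hper (x + n) fun h => absurd h.2 (not_le.2 (by positivity))]
    push_cast; ring_nf

theorem apply_sub_nat_of_neg (hper : ∀ x : ℚ, x ∉ Set.Icc (-1 : ℚ) 0 → f (x + 1) = f x)
    {x : ℚ} (hx : x < 0) (n : ℕ) : f (x - n) = f x := by
  induction n with
  | zero => simp
  | succ n ih =>
    have hn : (0 : ℚ) ≤ n := by positivity
    rw [← ih, ← hper (x - (n + 1 : ℕ)) fun h => by have := h.1; push_cast at this; linarith]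
    push_cast; ring_nf

theorem apply_eq_add_signedVal {k : ℂ} {h : ℝ → ℂ}
    (hper : ∀ x : ℚ, x ∉ Set.Icc (-1 : ℚ) 0 → f (x + 1) = f x)
    (hrec : ∀ x : ℚ, x ∈ Set.Icc (-1 : ℚ) 1 → x ≠ 0 →
      f x - ((|((x : ℚ) : ℝ)| : ℝ) : ℂ) ^ (-k) * f (-1 / x) = h x)
    {s u v : ℚ} {b : ℕ} (hs : s = 1 ∨ s = -1) (hu : 0 < u) (hv : 0 ≤ v) (hb : 1 ≤ b)
    (huv : u * (b + v) = 1) :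
    f (s * u) = h ((s * u : ℚ) : ℝ) + (((u : ℚ) : ℝ) : ℂ) ^ (-k) * signedVal f (-s) v := by
  have hb' : (1 : ℚ) ≤ b := by exact_mod_cast hb
  have hu1 : u ≤ 1 := by nlinarith
  obtain ⟨b, rfl⟩ := Nat.exists_eq_add_of_le' hb
  have hinv : u⁻¹ = v + (b + 1 : ℕ) := by
    exact inv_eq_of_mul_eq_one_right (by rw [add_comm v]; exact huv)
  have hval : f (-1 / (s * u)) = signedVal f (-s) v := by
    unfold signedVal
    rcases hs with rfl | rfl
    · have e : -1 / (1 * u) = -v - (b + 1 : ℕ) := by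
        rw [one_mul, neg_div, one_div, hinv]; ring
      rw [e]
      split_ifs with h0
      · rw [h0, ← apply_sub_nat_of_neg hper (x := -1) (by norm_num) b]; push_cast; ring_nf
      · have : 0 < v := lt_of_le_of_ne hv (Ne.symm h0)
        rw [apply_sub_nat_of_neg hper (by linarith)]; ring_nf
    · have e : -1 / (-1 * u) = v + (b + 1 : ℕ) := by
        rw [← hinv]; field_simp
      rw [e]
      split_ifs with h0
      · rw [h0, neg_neg, ← apply_add_nat_of_pos hper (x := 1) (by norm_num) b]; push_cast; ring_nf
      · have : 0 < v := lt_of_le_of_ne hv (Ne.symm h0)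
        rw [apply_add_nat_of_pos hper this]; ring_nf
  have habs : |((s * u : ℚ) : ℝ)| = ((u : ℚ) : ℝ) := by
    rw [← Rat.cast_abs]
    congr 1
    rcases hs with rfl | rfl <;> simp [abs_of_pos hu]
  have := hrec (s * u) (by rcases hs with rfl | rfl <;> constructor <;> linarith)
    (by rcases hs with rfl | rfl <;> simp [hu.ne'])
  rw [habs, hval] at this
  rw [← this]; ring

theorem signedVal_eq_cfSum_add {k : ℂ} {h : ℝ → ℂ}
    (hper : ∀ x : ℚ, x ∉ Set.Icc (-1 : ℚ) 0 → f (x + 1) = f x)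
    (hrec : ∀ x : ℚ, x ∈ Set.Icc (-1 : ℚ) 1 → x ≠ 0 →
      f x - ((|((x : ℚ) : ℝ)| : ℝ) : ℂ) ^ (-k) * f (-1 / x) = h x)
    {u : ℕ → ℝ} {b : ℕ → ℕ} {n : ℕ} (hc : IsCFChain u b n) {w : ℕ → ℚ}
    (hw : ∀ j ≤ n, u j = w j) {m : ℕ} (hm : m ≤ n) :
    signedVal f 1 (w 0) =
      cfSum k h u m + ((cfProd u m : ℝ) : ℂ) ^ (-k) * signedVal f ((-1) ^ m) (w m) := by
  induction m with
  | zero => simp [cfSum, cfProd_zero]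
  | succ m ih =>
    have hpos : 0 < w m := by
      have := hc.pos m (by omega); rw [hw m (by omega)] at this; exact_mod_cast this
    have hnn : 0 ≤ w (m + 1) := by
      have := hc.nonneg (m + 1) (by omega); rw [hw (m + 1) hm] at this; exact_mod_cast this
    have hrel : w m * (b m + w (m + 1)) = 1 := by
      have := hc.rel m (by omega)
      rw [hw (m + 1) hm, hw m (by omega)] at this; exact_mod_cast this
    have hstep := apply_eq_add_signedVal hper hrec (neg_one_pow_eq_or ℚ m) hpos hnn
      (hc.one_le m (by omega)) hrel
    rw [ih (by omega), cfSum, cfSum, Finset.sum_range_succ]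
    have e : signedVal f ((-1) ^ m) (w m) = f ((-1) ^ m * w m) := if_neg hpos.ne'
    rw [e, hstep, cfProd_succ, Complex.ofReal_mul,
      Complex.mul_cpow_ofReal_nonneg (hc.cfProd_nonneg (by omega)) (hc.nonneg m (by omega)),
      hw m (by omega), pow_succ, mul_neg_one]
    push_cast
    ring

end Reciprocity

/-- The threshold `(1 + c log r) ^ (-1 / (1 - δ))`. -/
noncomputable def cfGap (c δ : ℝ) (r : ℕ) : ℝ := ((1 + c * Real.log r) ^ ((1 - δ)⁻¹))⁻¹

section Gap

variable {c δ : ℝ}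

theorem one_le_one_add_mul_log (hc : 0 ≤ c) (r : ℕ) : 1 ≤ 1 + c * Real.log r := by
  have := mul_nonneg hc (Real.log_natCast_nonneg r)
  linarith

theorem cfGap_pos (hc : 0 ≤ c) (r : ℕ) : 0 < cfGap c δ r := by
  have := one_le_one_add_mul_log hc r
  unfold cfGap; positivity

theorem cfGap_antitone (hc : 0 ≤ c) (hδ : δ < 1) : Antitone (cfGap c δ) := by
  intro r s hrs
  have h1 := one_le_one_add_mul_log hc r
  have hlog : Real.log r ≤ Real.log s := by
    rcases r.eq_zero_or_pos with rfl | hr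
    · simpa using Real.log_natCast_nonneg s
    · exact Real.log_le_log (by exact_mod_cast hr) (by exact_mod_cast hrs)
  have : 0 < 1 - δ := by linarith
  unfold cfGap
  gcongr

theorem tendsto_cfGap (hc : 0 < c) (hδ : δ < 1) : Tendsto (cfGap c δ) atTop (𝓝 0) := by
  refine tendsto_inv_atTop_zero.comp ((tendsto_rpow_atTop (inv_pos.2 (by linarith))).comp ?_)
  exact tendsto_atTop_add_const_left _ _ ((Real.tendsto_log_atTop.comp
    tendsto_natCast_atTop_atTop).const_mul_atTop hc)

theorem summable_cfGap_div (hc : 0 < c) (hδ0 : 0 < δ) (hδ : δ < 1) :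
    Summable fun r : ℕ => cfGap c δ r / r := by
  rw [← summable_condensed_iff_of_nonneg (fun r => div_nonneg (cfGap_pos hc.le r).le (by simp))]
  · have hs : 1 < (1 - δ)⁻¹ := (one_lt_inv₀ (by linarith)).2 (by linarith)
    have hl : 0 < c * Real.log 2 := by positivity
    have := ((Real.summable_nat_rpow_inv (p := (1 - δ)⁻¹)).2 hs).mul_left
      (((c * Real.log 2) ^ ((1 - δ)⁻¹))⁻¹)
    rw [← summable_nat_add_iff 1] at this
    rw [← summable_nat_add_iff 1]
    refine this.of_nonneg_of_le (fun n => ?_) fun n => ?_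
    · have := (cfGap_pos (δ := δ) hc.le (2 ^ (n + 1))).le
      positivity
    · push_cast
      rw [mul_div_cancel₀ _ (by positivity), ← mul_inv,
        ← Real.mul_rpow hl.le (by positivity)]
      unfold cfGap
      push_cast
      rw [Real.log_pow]
      have : 0 < 1 - δ := by linarith
      gcongr
      push_cast
      nlinarith
  · intro m n hm hmn
    have := cfGap_antitone hc.le hδ hmn
    have h2 := (cfGap_pos (δ := δ) hc.le m).le
    have hm' : (0 : ℝ) < m := by exact_mod_cast hm
    gcongr

theorem rpow_le_of_cfGap_le (hc : 0 ≤ c) (hδ : δ < 1) {r : ℕ} {u : ℝ} (hu : cfGap c δ r ≤ u) :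
    u ^ (δ - 1) ≤ 1 + c * Real.log r := by
  have h1 := one_le_one_add_mul_log hc r
  refine (Real.rpow_le_rpow_of_nonpos (cfGap_pos hc r) hu (by linarith)).trans_eq ?_
  unfold cfGap
  rw [Real.inv_rpow (by positivity), ← Real.rpow_neg (by positivity), ← Real.rpow_mul (by positivity)]
  have : 1 - δ ≠ 0 := by linarith
  rw [show (1 - δ)⁻¹ * -(δ - 1) = 1 by field_simp; ring, Real.rpow_one]

end Gap

theorem norm_cfSum_term_le {k : ℂ} (hk : k.re < 0) {δ : ℝ} (hδ : δ < 1) {h : ℝ → ℂ} {C : ℝ}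
    (hC : 0 < C) (hbd : ∀ x : ℝ, x ∈ Set.Icc (-1 : ℝ) 1 → x ≠ 0 →
      ‖h x‖ ≤ C * Real.exp (|x| ^ (δ - 1)))
    {u : ℕ → ℝ} {b : ℕ → ℕ} {n : ℕ} (hc : IsCFChain u b n) {j : ℕ} (hj : j < n)
    (hgap : cfGap (-k.re / 2) δ (cfDen b j) ≤ u j) :
    ‖((cfProd u j : ℝ) : ℂ) ^ (-k) * h ((-1) ^ j * u j)‖ ≤
      C * Real.exp 1 * (2 / 3 : ℝ) ^ (k.re / 2) * ((3 / 2 : ℝ) ^ (k.re / 2)) ^ j := by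
  have hq : (0 : ℝ) < cfDen b j := by exact_mod_cast hc.cfDen_pos hj.le
  have hu := hc.pos j hj
  have hu1 := hc.le_one hj
  have habs : |(-1) ^ j * u j| = u j := by
    rw [abs_mul, abs_pow, abs_neg, abs_one, one_pow, one_mul, abs_of_pos hu]
  have h1 : ‖h ((-1) ^ j * u j)‖ ≤ C * (Real.exp 1 * (cfDen b j : ℝ) ^ (-k.re / 2)) := by
    refine (hbd _ (abs_le.1 (habs.trans_le hu1)) (by
      intro h0; rw [h0, abs_zero] at habs; linarith)).trans ?_
    rw [habs]
    have := rpow_le_of_cfGap_le (by linarith) hδ hgap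
    rw [Real.rpow_def_of_pos hq, ← Real.exp_add]
    gcongr
    linarith
  have h2 : ‖((cfProd u j : ℝ) : ℂ) ^ (-k)‖ ≤ (cfDen b j : ℝ) ^ k.re := by
    rw [Complex.norm_cpow_eq_rpow_re_of_pos (hc.cfProd_pos hj.le), Complex.neg_re]
    calc _ ≤ ((cfDen b j : ℝ)⁻¹) ^ (-k.re) :=
          Real.rpow_le_rpow (hc.cfProd_nonneg (by omega)) (hc.cfProd_le_inv hj.le) (by linarith)
      _ = _ := by rw [Real.inv_rpow hq.le, ← Real.rpow_neg hq.le, neg_neg]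
  have h3 : (cfDen b j : ℝ) ^ (k.re / 2) ≤ (2 / 3 : ℝ) ^ (k.re / 2) * ((3 / 2 : ℝ) ^ (k.re / 2)) ^ j := by
    rw [← Real.rpow_natCast, ← Real.rpow_mul (by norm_num), mul_comm (k.re / 2) (j : ℝ),
      Real.rpow_mul (by norm_num), Real.rpow_natCast, ← Real.mul_rpow (by norm_num) (by positivity)]
    exact Real.rpow_le_rpow_of_nonpos (by positivity) (hc.pow_le_cfDen hj.le) (by linarith)
  rw [norm_mul]
  calc _ ≤ (cfDen b j : ℝ) ^ k.re * (C * (Real.exp 1 * (cfDen b j : ℝ) ^ (-k.re / 2))) := by gcongr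
    _ = C * Real.exp 1 * (cfDen b j : ℝ) ^ (k.re / 2) := by
      rw [show k.re / 2 = k.re + (-k.re / 2) by ring, Real.rpow_add hq]; ring
    _ ≤ _ := by rw [mul_assoc _ ((2 / 3 : ℝ) ^ _)]; gcongr

/-- The tail of `cfSum` decays geometrically as long as the entries of the chain stay above the
threshold `cfGap`. -/
theorem exists_norm_cfSum_sub_le {k : ℂ} (hk : k.re < 0) {δ : ℝ} (hδ : δ < 1) {h : ℝ → ℂ} {C : ℝ}
    (hC : 0 < C) (hbd : ∀ x : ℝ, x ∈ Set.Icc (-1 : ℝ) 1 → x ≠ 0 →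
      ‖h x‖ ≤ C * Real.exp (|x| ^ (δ - 1))) :
    ∃ E : ℕ → ℝ, (∀ J, 0 ≤ E J) ∧ Tendsto E atTop (𝓝 0) ∧
      ∀ (u : ℕ → ℝ) (b : ℕ → ℕ) (n J : ℕ), IsCFChain u b n →
      J ≤ n → (∀ i, J ≤ i → i < n → cfGap (-k.re / 2) δ (cfDen b i) ≤ u i) →
      ‖cfSum k h u n - cfSum k h u J‖ ≤ E J := by
  set ρ : ℝ := (3 / 2 : ℝ) ^ (k.re / 2) with hρ
  have hρ0 : 0 < ρ := by positivity
  have hρ1 : ρ < 1 := Real.rpow_lt_one_of_one_lt_of_neg (by norm_num) (by linarith)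
  set D : ℝ := C * Real.exp 1 * (2 / 3 : ℝ) ^ (k.re / 2) with hD
  have hD0 : 0 < D := by positivity
  have hρ2 : 0 < 1 - ρ := by linarith
  refine ⟨fun J => D * (ρ ^ J / (1 - ρ)), fun J => by positivity, ?_, fun u b n J hc hJ hgap => ?_⟩
  · simpa using ((tendsto_pow_atTop_nhds_zero_of_lt_one hρ0.le hρ1).div_const (1 - ρ)).const_mul D
  · rw [cfSum, cfSum, ← Finset.sum_Ico_eq_sub _ hJ]
    calc _ ≤ ∑ j ∈ Finset.Ico J n, D * ρ ^ j := by
          refine norm_sum_le_of_le _ fun j hj => ?_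
          rw [Finset.mem_Ico] at hj
          exact norm_cfSum_term_le hk hδ hC hbd hc hj.2 (hgap j hj.1 hj.2)
      _ = D * ∑ j ∈ Finset.Ico J n, ρ ^ j := by rw [Finset.mul_sum]
      _ ≤ _ := by
          refine mul_le_mul_of_nonneg_left ?_ hD0.le
          rw [geom_sum_Ico' hρ1.ne hJ]
          have : 0 < ρ ^ n := by positivity
          gcongr
          linarith

/-- The Gauss map. -/
noncomputable def gaussMap (x : ℝ) : ℝ := Int.fract x⁻¹

/-- The partial quotients generated by the Gauss map. -/
noncomputable def gaussDigit (x : ℝ) (j : ℕ) : ℕ := ⌊(gaussMap^[j] x)⁻¹⌋₊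

theorem gaussMap_mul {x : ℝ} (hx : 0 < x) : x * (⌊x⁻¹⌋₊ + gaussMap x) = 1 := by
  have : ((⌊x⁻¹⌋₊ : ℕ) : ℝ) = (⌊x⁻¹⌋ : ℝ) := natCast_floor_eq_intCast_floor (by positivity)
  rw [this, gaussMap, Int.floor_add_fract, mul_inv_cancel₀ hx.ne']

theorem gaussMap_iterate_mem {x : ℝ} (hx : x ∈ Icc (0 : ℝ) 1) (j : ℕ) :
    gaussMap^[j] x ∈ Icc (0 : ℝ) 1 := by
  rcases j with _ | j
  · exact hx
  · rw [Function.iterate_succ_apply']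
    exact ⟨Int.fract_nonneg _, (Int.fract_lt_one _).le⟩

theorem isCFChain_gaussMap {x : ℝ} (hx : x ∈ Icc (0 : ℝ) 1) {n : ℕ}
    (hn : ∀ j < n, gaussMap^[j] x ≠ 0) :
    IsCFChain (fun j => gaussMap^[j] x) (gaussDigit x) n := by
  have hpos : ∀ j < n, 0 < gaussMap^[j] x := fun j hj =>
    lt_of_le_of_ne (gaussMap_iterate_mem hx j).1 (hn j hj).symm
  refine ⟨hpos, fun j _ => (gaussMap_iterate_mem hx j).1, fun j hj => ?_, fun j hj => ?_⟩
  · exact Nat.le_floor (by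
      simpa using (one_le_inv₀ (hpos j hj)).2 (gaussMap_iterate_mem hx j).2)
  · simp only [Function.iterate_succ_apply']
    exact gaussMap_mul (hpos j hj)

theorem Irrational.gaussMap_mem {x : ℝ} (hx : Irrational x) :
    Irrational (gaussMap x) ∧ gaussMap x ∈ Ioo (0 : ℝ) 1 := by
  have h1 : Irrational (gaussMap x) := by
    unfold gaussMap Int.fract
    exact hx.inv.sub_intCast _
  exact ⟨h1, lt_of_le_of_ne (Int.fract_nonneg _) h1.ne_zero.symm, Int.fract_lt_one _⟩

theorem Irrational.gaussMap_iterate {x : ℝ} (hx : Irrational x) (h01 : x ∈ Ioo (0 : ℝ) 1) (j : ℕ) :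
    Irrational (gaussMap^[j] x) ∧ gaussMap^[j] x ∈ Ioo (0 : ℝ) 1 := by
  induction j with
  | zero => exact ⟨hx, h01⟩
  | succ j ih => rw [Function.iterate_succ_apply']; exact ih.1.gaussMap_mem

theorem Irrational.isCFChain_gaussMap {x : ℝ} (hx : Irrational x) (h01 : x ∈ Ioo (0 : ℝ) 1)
    (n : ℕ) : IsCFChain (fun j => gaussMap^[j] x) (gaussDigit x) n :=
  _root_.isCFChain_gaussMap (Ioo_subset_Icc_self h01) fun j _ =>
    (hx.gaussMap_iterate h01 j).1.ne_zero

theorem Irrational.continuousAt_gaussMap {x : ℝ} (hx : Irrational x) : ContinuousAt gaussMap x := by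
  have h1 : ContinuousAt (fun y : ℝ => Int.fract y) x⁻¹ := by
    have := hx.inv
    refine ContinuousOn.continuousAt (s := Ioo (⌊x⁻¹⌋ : ℝ) (⌊x⁻¹⌋ + 1)) ?_ ?_
    · exact (continuousOn_fract ⌊x⁻¹⌋).mono Ioo_subset_Ico_self
    · exact Ioo_mem_nhds (lt_of_le_of_ne (Int.floor_le _) (this.ne_int _).symm)
        (Int.lt_floor_add_one _)
  exact ContinuousAt.comp (g := fun y : ℝ => Int.fract y) h1 (continuousAt_inv₀ hx.ne_zero)

theorem Irrational.continuousAt_gaussMap_iterate {x : ℝ} (hx : Irrational x)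
    (h01 : x ∈ Ioo (0 : ℝ) 1) (j : ℕ) : ContinuousAt (gaussMap^[j]) x := by
  induction j with
  | zero => exact continuousAt_id
  | succ j ih =>
    rw [Function.iterate_succ']
    exact (hx.gaussMap_iterate h01 j).1.continuousAt_gaussMap.comp ih

theorem exists_gaussMap_iterate_ratCast (w : ℚ) (j : ℕ) : ∃ v : ℚ, gaussMap^[j] (w : ℝ) = v := by
  induction j with
  | zero => exact ⟨w, rfl⟩
  | succ j ih =>
    obtain ⟨v, hv⟩ := ih
    refine ⟨Int.fract v⁻¹, ?_⟩
    rw [Function.iterate_succ_apply', hv, gaussMap, Rat.cast_fract, Rat.cast_inv]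

/-- The Gauss map expansion of a reduced fraction `a / q` terminates, and the product of its
entries is at most `1 / q`. -/
theorem exists_gaussMap_iterate_eq_zero {a q : ℕ} (hq : 0 < q) (haq : a ≤ q)
    (hco : Nat.Coprime a q) :
    ∃ n, gaussMap^[n] (a / q : ℝ) = 0 ∧ (∀ j < n, gaussMap^[j] (a / q : ℝ) ≠ 0) ∧
      cfProd (fun j => gaussMap^[j] (a / q : ℝ)) n ≤ (q : ℝ)⁻¹ := by
  have hq' : (0 : ℝ) < q := by exact_mod_cast hq
  set x : ℝ := a / q with hx
  have hx01 : x ∈ Icc (0 : ℝ) 1 :=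
    ⟨by positivity, div_le_one_of_le₀ (by exact_mod_cast haq) hq'.le⟩
  have hex : ∃ n, gaussMap^[n] x = 0 := by
    by_contra! hne
    have hc := isCFChain_gaussMap hx01 (n := q + 1) fun j _ => hne j
    have h1 := hc.cfDen_mul_sub_cfNum (i := q) (by omega)
    have h2 := hc.cfProd_pos (i := q + 1) le_rfl
    have h3 := hc.cfProd_le_inv (i := q + 1) le_rfl
    have h4 := hc.le_cfDen (i := q + 1) le_rfl
    set d := cfDen (gaussDigit x) q
    set p := cfNum (gaussDigit x) q
    have h5 : ((d * a - p * q : ℤ) : ℝ) =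
        q * ((-1) ^ q * cfProd (fun j => gaussMap^[j] x) (q + 1)) := by
      rw [← h1]; simp only [Function.iterate_zero, id, hx]; push_cast; field_simp
    have h6 : |((d * a - p * q : ℤ) : ℝ)| = q * cfProd (fun j => gaussMap^[j] x) (q + 1) := by
      rw [h5, abs_mul, abs_mul, abs_pow, abs_neg, abs_one, one_pow, one_mul, abs_of_pos hq',
        abs_of_pos h2]
    have h7 : q * cfProd (fun j => gaussMap^[j] x) (q + 1) < 1 := by
      have : (cfDen (gaussDigit x) (q + 1) : ℝ)⁻¹ ≤ ((q + 1 : ℕ) : ℝ)⁻¹ := by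
        gcongr
      calc _ ≤ q * ((q + 1 : ℕ) : ℝ)⁻¹ := by gcongr; exact h3.trans this
        _ < 1 := by rw [← div_eq_mul_inv, div_lt_one (by positivity)]; push_cast; linarith
    have h8 : |(d * a - p * q : ℤ)| < 1 := by rw [← h6] at h7; exact_mod_cast h7
    have h9 : 0 < |((d * a - p * q : ℤ) : ℝ)| := by rw [h6]; positivity
    rw [Int.abs_lt_one_iff.1 h8] at h9
    simp at h9
  classical
  refine ⟨Nat.find hex, Nat.find_spec hex, fun j hj => Nat.find_min hex hj, ?_⟩
  set n := Nat.find hex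
  have hn : gaussMap^[n] x = 0 := Nat.find_spec hex
  have hc := isCFChain_gaussMap hx01 (n := n) fun j hj => Nat.find_min hex hj
  refine (hc.cfProd_le_inv le_rfl).trans ?_
  have h1 := hc.cfDen_mul_sub_cfNum (i := n) le_rfl
  rw [cfProd_succ, hn, mul_zero, mul_zero, sub_eq_zero] at h1
  simp only [Function.iterate_zero, id, hx] at h1
  rw [← mul_div_assoc, div_eq_iff hq'.ne'] at h1
  have h2 : cfDen (gaussDigit x) n * a = cfNum (gaussDigit x) n * q := by exact_mod_cast h1
  have h3 : q ∣ cfDen (gaussDigit x) n :=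
    hco.symm.dvd_of_dvd_mul_right (Dvd.intro_left _ h2.symm)
  have h4 := Nat.le_of_dvd (hc.cfDen_pos le_rfl) h3
  gcongr

theorem cfPQ_succ (y : ℝ) (j : ℕ) :
    cfPQ y (j + 1) = (⌊y⌋ * (cfPQ (Int.fract y)⁻¹ j).1 + (cfPQ (Int.fract y)⁻¹ j).2,
      (cfPQ (Int.fract y)⁻¹ j).1) := by
  induction j using Nat.twoStepInduction with
  | zero => simp [cfPQ, cfb, mul_comm]
  | one => simp [cfPQ, cfb]; ring
  | more j ih1 ih2 =>
    have e : ∀ (z : ℝ) (n : ℕ), cfPQ z (n + 2) =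
      (cfb (n + 2) z * (cfPQ z (n + 1)).1 + (cfPQ z n).1,
        cfb (n + 2) z * (cfPQ z (n + 1)).2 + (cfPQ z n).2) := fun z n => by rw [cfPQ]
    have e2 : cfb (j + 1 + 2) y = cfb (j + 2) (Int.fract y)⁻¹ := rfl
    rw [e y (j + 1), ih1, ih2, e (Int.fract y)⁻¹ j, e2]
    exact Prod.ext (by ring) rfl

theorem cfPQ_pos (j : ℕ) : ∀ {y : ℝ}, Irrational y → 1 < y →
    0 < (cfPQ y j).1 ∧ 0 < (cfPQ y j).2 := by
  induction j with
  | zero =>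
    intro y _ hy
    exact ⟨Int.floor_pos.2 hy.le, one_pos⟩
  | succ j ih =>
    intro y hirr hy
    have h1 : Irrational (Int.fract y) := hirr.sub_intCast _
    have h2 : 0 < Int.fract y := lt_of_le_of_ne (Int.fract_nonneg _) h1.ne_zero.symm
    obtain ⟨h3, h4⟩ := ih h1.inv ((one_lt_inv₀ h2).2 (Int.fract_lt_one _))
    rw [cfPQ_succ]
    have : 0 < ⌊y⌋ := Int.floor_pos.2 hy.le
    exact ⟨by positivity, h3⟩

theorem cfConv_zero (y : ℝ) : cfConv y 0 = ⌊y⌋ := by simp [cfConv, cfPQ, cfb]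

theorem cfConv_zero_of_mem {t : ℝ} (h01 : t ∈ Ioo (0 : ℝ) 1) : cfConv t 0 = 0 := by
  rw [cfConv_zero, Int.floor_eq_zero_iff.2 ⟨h01.1.le, h01.2⟩, Int.cast_zero]

theorem cfConv_succ {y : ℝ} (hy : Irrational y) (j : ℕ) :
    cfConv y (j + 1) = ⌊y⌋ + (cfConv (Int.fract y)⁻¹ j)⁻¹ := by
  have h1 : Irrational (Int.fract y) := hy.sub_intCast _
  have h2 : 0 < Int.fract y := lt_of_le_of_ne (Int.fract_nonneg _) h1.ne_zero.symm
  obtain ⟨h3, h4⟩ := cfPQ_pos j h1.inv ((one_lt_inv₀ h2).2 (Int.fract_lt_one _))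
  have h3' : ((cfPQ (Int.fract y)⁻¹ j).1 : ℚ) ≠ 0 := by exact_mod_cast h3.ne'
  rw [cfConv, cfConv, cfPQ_succ]
  push_cast
  rw [inv_div, add_div, mul_div_cancel_right₀ _ h3']

theorem cfConv_succ_of_mem {t : ℝ} (ht : Irrational t) (h01 : t ∈ Ioo (0 : ℝ) 1) (j : ℕ) :
    cfConv t (j + 1) = (⌊t⁻¹⌋₊ + cfConv (gaussMap t) j)⁻¹ := by
  have hfl : ⌊t⌋ = 0 := Int.floor_eq_zero_iff.2 ⟨h01.1.le, h01.2⟩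
  have hcast : ((⌊t⁻¹⌋₊ : ℕ) : ℚ) = (⌊t⁻¹⌋ : ℚ) :=
    by exact_mod_cast natCast_floor_eq_intCast_floor (R := ℝ) (inv_nonneg.2 h01.1.le)
  have hfr : Int.fract t = t := Int.fract_eq_self.2 ⟨h01.1.le, h01.2⟩
  obtain ⟨hT, hT01⟩ := ht.gaussMap_mem
  rw [cfConv_succ ht, hfl, hfr, Int.cast_zero, zero_add, hcast]
  congr 1
  rcases j with _ | j
  · rw [cfConv_zero_of_mem hT01, cfConv_zero, add_zero]
  · have hfl' : ⌊gaussMap t⌋ = 0 := Int.floor_eq_zero_iff.2 ⟨hT01.1.le, hT01.2⟩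
    have hfr' : Int.fract (gaussMap t) = gaussMap t := Int.fract_eq_self.2 ⟨hT01.1.le, hT01.2⟩
    rw [cfConv_succ ht.inv, cfConv_succ hT, hfl', hfr', Int.cast_zero, zero_add, gaussMap]

theorem cfConv_nonneg (j : ℕ) : ∀ {t : ℝ}, Irrational t → t ∈ Ioo (0 : ℝ) 1 → 0 ≤ cfConv t j := by
  induction j with
  | zero => intro t _ h01; rw [cfConv_zero_of_mem h01]
  | succ j ih =>
    intro t ht h01
    have := ih ht.gaussMap_mem.1 ht.gaussMap_mem.2
    rw [cfConv_succ_of_mem ht h01]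
    positivity

/-- The successive remainders `cfConv (T ^ i t) (n - i)` of the `n`-th convergent of `t`. -/
noncomputable def convChain (t : ℝ) (n i : ℕ) : ℚ := cfConv (gaussMap^[i] t) (n - i)

theorem isCFChain_convChain {t : ℝ} (ht : Irrational t) (h01 : t ∈ Ioo (0 : ℝ) 1) (n : ℕ) :
    IsCFChain (fun i => (convChain t n i : ℝ)) (gaussDigit t) n := by
  have hG := ht.isCFChain_gaussMap h01 n
  have hnn : ∀ i, 0 ≤ convChain t n i := fun i =>
    cfConv_nonneg _ (ht.gaussMap_iterate h01 i).1 (ht.gaussMap_iterate h01 i).2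
  have hrec : ∀ j < n, convChain t n j = (gaussDigit t j + convChain t n (j + 1))⁻¹ := by
    intro j hj
    obtain ⟨h1, h2⟩ := ht.gaussMap_iterate h01 j
    rw [convChain, show n - j = n - (j + 1) + 1 by omega, cfConv_succ_of_mem h1 h2, convChain,
      Function.iterate_succ_apply', gaussDigit]
  have hpos : ∀ j < n, (0 : ℚ) < gaussDigit t j + convChain t n (j + 1) := fun j hj => by
    have h1 : (1 : ℚ) ≤ gaussDigit t j := by exact_mod_cast hG.one_le j hj
    linarith [hnn (j + 1)]
  refine ⟨fun j hj => ?_, fun j _ => by exact_mod_cast hnn j, hG.one_le, fun j hj => ?_⟩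
  · rw [hrec j hj]; exact_mod_cast inv_pos.2 (hpos j hj)
  · have : convChain t n j * (gaussDigit t j + convChain t n (j + 1)) = 1 := by
      rw [hrec j hj]; exact inv_mul_cancel₀ (hpos j hj).ne'
    exact_mod_cast this

theorem convChain_self {t : ℝ} (ht : Irrational t) (h01 : t ∈ Ioo (0 : ℝ) 1) (n : ℕ) :
    convChain t n n = 0 := by
  rw [convChain, Nat.sub_self, cfConv_zero_of_mem (ht.gaussMap_iterate h01 n).2]

theorem abs_sub_cfConv_le {t : ℝ} (ht : Irrational t) (h01 : t ∈ Ioo (0 : ℝ) 1) (n : ℕ) :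
    |cfConv t n - t| ≤ 3 / 2 * (2 / 3 : ℝ) ^ n := by
  have hG := ht.isCFChain_gaussMap h01 (n + 1)
  have hC := isCFChain_convChain ht h01 n
  have h1 := hG.cfDen_mul_sub_cfNum (i := n) (by omega)
  have h2 := hC.cfDen_mul_sub_cfNum (i := n) le_rfl
  have hq := hG.pow_le_cfDen (i := n) (by omega)
  have hβ := hG.cfProd_pos (i := n + 1) (by omega)
  rw [cfProd_succ, convChain_self ht h01, Rat.cast_zero, mul_zero, mul_zero] at h2
  simp only [Function.iterate_zero, id, convChain, Nat.sub_zero] at h1 h2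
  set d : ℝ := (cfDen (gaussDigit t) n : ℝ)
  have hd : 0 < d := lt_of_lt_of_le (by positivity) hq
  have h3 : d * |cfConv t n - t| = cfProd (fun j => gaussMap^[j] t) (n + 1) := by
    nth_rewrite 1 [← abs_of_pos hd]
    rw [← abs_mul]
    rw [show d * (cfConv t n - t) = -((-1) ^ n * cfProd (fun j => gaussMap^[j] t) (n + 1)) by
      linear_combination h2 - h1]
    rw [abs_neg, abs_mul, abs_pow, abs_neg, abs_one, one_pow, one_mul, abs_of_pos hβ]
  have h4 : cfProd (fun j => gaussMap^[j] t) (n + 1) ≤ 1 :=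
    Finset.prod_le_one (fun j _ => (gaussMap_iterate_mem (Ioo_subset_Icc_self h01) j).1)
      fun j _ => (gaussMap_iterate_mem (Ioo_subset_Icc_self h01) j).2
  have h5 : |cfConv t n - t| ≤ d⁻¹ := by
    rw [← one_div, le_div_iff₀ hd, mul_comm, h3]; exact h4
  calc _ ≤ d⁻¹ := h5
    _ ≤ ((2 / 3 : ℝ) * (3 / 2) ^ n)⁻¹ := by gcongr
    _ = _ := by rw [mul_inv, ← inv_pow]; norm_num

theorem tendsto_convChain {t : ℝ} (ht : Irrational t) (h01 : t ∈ Ioo (0 : ℝ) 1) (i : ℕ) :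
    Tendsto (fun n => (convChain t n i : ℝ)) atTop (𝓝 (gaussMap^[i] t)) := by
  obtain ⟨h1, h2⟩ := ht.gaussMap_iterate h01 i
  have : Tendsto (fun n => (cfConv (gaussMap^[i] t) n : ℝ)) atTop (𝓝 (gaussMap^[i] t)) := by
    rw [tendsto_iff_dist_tendsto_zero]
    refine squeeze_zero (fun _ => dist_nonneg) (fun n => abs_sub_cfConv_le h1 h2 n) ?_
    simpa using (tendsto_pow_atTop_nhds_zero_of_lt_one (r := (2 / 3 : ℝ)) (by norm_num)
      (by norm_num)).const_mul (3 / 2)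
  exact this.comp (tendsto_sub_atTop_nat i)

theorem half_gaussMap_le_convChain {t : ℝ} (ht : Irrational t) (h01 : t ∈ Ioo (0 : ℝ) 1) {n i : ℕ}
    (hi : i < n) : gaussMap^[i] t / 2 ≤ convChain t n i := by
  have hG := ht.isCFChain_gaussMap h01 n
  have hC := isCFChain_convChain ht h01 n
  have h1 : (convChain t n (i + 1) : ℝ) ≤ 1 := by
    rcases (show i + 1 ≤ n from hi).lt_or_eq with h | h
    · exact hC.le_one h
    · rw [h, convChain_self ht h01]; simp
  have h2 := hC.rel i hi
  have h3 := hC.pos i hi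
  have h4 := hG.rel i hi
  have h5 := hG.pos i hi
  have h6 := hG.nonneg (i + 1) hi
  have h7 : (1 : ℝ) ≤ gaussDigit t i := by exact_mod_cast hG.one_le i hi
  have h8 : gaussMap^[i] t * gaussDigit t i ≤ 1 := by
    rw [← h4]; nlinarith
  have h9 : (1 : ℝ) ≤ convChain t n i * (2 * gaussDigit t i) := by
    rw [← h2]; gcongr; linarith
  nlinarith

theorem continuousAt_of_cohCond {δ : ℝ} {h : ℝ → ℂ} (hcoh : cohCond δ h) {y : ℝ}
    (hy0 : y ≠ 0) (hy1 : |y| < 1) : ContinuousAt h y := by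
  rw [Metric.continuousAt_iff']
  intro η hη
  obtain ⟨ε₀, hε₀, H⟩ := hcoh.1 (η / 2) (by positivity)
  have hy : 0 < |y| := abs_pos.2 hy0
  set ε := min (ε₀ / 2) (|y| / 4) with hε
  have h1 : 0 < ε := by positivity
  have h2 : ε < ε₀ := (min_le_left _ _).trans_lt (by linarith)
  have h3 : 2 * ε < |y| := by
    have := min_le_right (ε₀ / 2) (|y| / 4)
    linarith
  filter_upwards [Metric.ball_mem_nhds y (Real.exp_pos (-(ε ^ (δ - 1)))),
    (isOpen_lt continuous_abs continuous_const).mem_nhds hy1, isOpen_ne.mem_nhds hy0]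
    with x hx hx1 hx0
  rw [Metric.mem_ball, dist_comm, Real.dist_eq] at hx
  rw [dist_comm, dist_eq_norm]
  have := H ε h1 h2 y x (abs_le.1 hy1.le) (abs_le.1 (le_of_lt hx1)) hy0 hx0 hx h3
  linarith

theorem tendsto_cfSum {ι : Type*} {l : Filter ι} {U : ι → ℕ → ℝ} {t : ℕ → ℝ} (k : ℂ) {δ : ℝ}
    {h : ℝ → ℂ} (hcoh : cohCond δ h) (ht : ∀ i, t i ∈ Ioo (0 : ℝ) 1)
    (hU : ∀ i, Tendsto (fun a => U a i) l (𝓝 (t i))) (J : ℕ) :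
    Tendsto (fun a => cfSum k h (U a) J) l (𝓝 (cfSum k h t J)) := by
  refine tendsto_finsetSum _ fun j _ => Tendsto.mul ?_ ?_
  · have h1 : Tendsto (fun a => cfProd (U a) j) l (𝓝 (cfProd t j)) :=
      tendsto_finsetProd _ fun i _ => hU i
    have h2 : 0 < cfProd t j := Finset.prod_pos fun i _ => (ht i).1
    have h3 : ContinuousAt (fun z : ℝ => ((z : ℝ) : ℂ) ^ (-k)) (cfProd t j) :=
      (Complex.continuous_ofReal.continuousAt).cpow continuousAt_const
        (Complex.ofReal_mem_slitPlane.2 h2)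
    exact h3.tendsto.comp h1
  · refine Tendsto.comp (continuousAt_of_cohCond hcoh ?_ ?_).tendsto ((hU j).const_mul _)
    · exact mul_ne_zero (by simp) (ht j).1.ne'
    · rw [abs_mul, abs_pow, abs_neg, abs_one, one_pow, one_mul, abs_of_pos (ht j).1]
      exact (ht j).2

theorem norm_signedVal_zero_le (f : ℚ → ℂ) (m : ℕ) :
    ‖signedVal f ((-1) ^ m) 0‖ ≤ ‖f 1‖ + ‖f (-1)‖ := by
  rw [signedVal, if_pos rfl]
  rcases neg_one_pow_eq_or ℚ m with h | h <;> rw [h] <;>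
    linarith [norm_nonneg (f 1), norm_nonneg (f (-1))]

section

variable {k : ℂ} {δ : ℝ} {f : ℚ → ℂ} {h : ℝ → ℂ}

theorem norm_apply_div_sub_cfSum_le (hk : k.re < 0) (h0 : h 0 = 0)
    (hper : ∀ x : ℚ, x ∉ Set.Icc (-1 : ℚ) 0 → f (x + 1) = f x)
    (hrec : ∀ x : ℚ, x ∈ Set.Icc (-1 : ℚ) 1 → x ≠ 0 →
      f x - ((|((x : ℚ) : ℝ)| : ℝ) : ℂ) ^ (-k) * f (-1 / x) = h x)
    {E : ℕ → ℝ} (hE0 : ∀ J, 0 ≤ E J)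
    (hE : ∀ (u : ℕ → ℝ) (b : ℕ → ℕ) (n J : ℕ), IsCFChain u b n →
      J ≤ n → (∀ i, J ≤ i → i < n → cfGap (-k.re / 2) δ (cfDen b i) ≤ u i) →
      ‖cfSum k h u n - cfSum k h u J‖ ≤ E J)
    {a q J : ℕ} (hq : 0 < q) (ha : 0 < a) (haq : a ≤ q) (hco : Nat.Coprime a q)
    (hx : (a / q : ℝ) ∉ wellApprox (fun r => 2 * cfGap (-k.re / 2) δ r) J) :
    ‖f ((a : ℚ) / q) - cfSum k h (fun j => gaussMap^[j] (a / q : ℝ)) J‖ ≤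
      E J + (q : ℝ) ^ k.re * (‖f 1‖ + ‖f (-1)‖) := by
  have hq' : (0 : ℝ) < q := by exact_mod_cast hq
  have hqq : (0 : ℚ) < q := by exact_mod_cast hq
  have haa : (0 : ℚ) < a := by exact_mod_cast ha
  obtain ⟨n, hn0, hne, hprod⟩ := exists_gaussMap_iterate_eq_zero hq haq hco
  have hcast : (((a : ℚ) / q : ℚ) : ℝ) = a / q := by push_cast; rfl
  have hx01 : (a / q : ℝ) ∈ Icc (0 : ℝ) 1 :=
    ⟨by positivity, div_le_one_of_le₀ (by exact_mod_cast haq) hq'.le⟩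
  have hc := isCFChain_gaussMap hx01 hne
  choose w hw using exists_gaussMap_iterate_ratCast ((a : ℚ) / q)
  rw [hcast] at hw
  have hw0 : w 0 = (a : ℚ) / q := by
    have := hw 0
    rw [Function.iterate_zero, id, ← hcast] at this
    exact_mod_cast this.symm
  have hwn : w n = 0 := by
    have := hw n
    rw [hn0] at this
    exact_mod_cast this.symm
  have hkey := signedVal_eq_cfSum_add hper hrec hc (fun j _ => hw j) le_rfl
  rw [hw0, hwn, signedVal, if_neg (by positivity), one_mul] at hkey
  set u : ℕ → ℝ := fun j => gaussMap^[j] (a / q : ℝ)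
  have hlast : ‖((cfProd u n : ℝ) : ℂ) ^ (-k) * signedVal f ((-1) ^ n) 0‖ ≤
      (q : ℝ) ^ k.re * (‖f 1‖ + ‖f (-1)‖) := by
    rw [norm_mul, Complex.norm_cpow_eq_rpow_re_of_pos (hc.cfProd_pos le_rfl), Complex.neg_re]
    have : cfProd u n ^ (-k.re) ≤ (q : ℝ) ^ k.re := by
      calc _ ≤ ((q : ℝ)⁻¹) ^ (-k.re) :=
          Real.rpow_le_rpow (hc.cfProd_pos le_rfl).le hprod (by linarith)
        _ = _ := by rw [Real.inv_rpow hq'.le, ← Real.rpow_neg hq'.le, neg_neg]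
    exact mul_le_mul this (norm_signedVal_zero_le f n) (norm_nonneg _) (by positivity)
  have hmain : ‖cfSum k h u n - cfSum k h u J‖ ≤ E J := by
    rcases le_or_gt J n with hJ | hJ
    · refine hE u _ n J hc hJ fun i hi hin => ?_
      have h1 := hc.le_of_notMem_wellApprox hx hi hin
      have h2 := cfGap_pos (c := -k.re / 2) (δ := δ) (by linarith)
        (cfDen (gaussDigit (a / q : ℝ)) i)
      linarith
    · have : cfSum k h u J = cfSum k h u n := by
        refine (Finset.sum_subset (Finset.range_mono hJ.le) fun j hj hjn => ?_).symm
        rw [Finset.mem_range, not_lt] at hjn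
        rcases hjn.eq_or_lt with rfl | hlt
        · rw [show u n = 0 from hn0, mul_zero, h0, mul_zero]
        · have : cfProd u j = 0 := Finset.prod_eq_zero (Finset.mem_range.2 hlt) hn0
          rw [this, Complex.ofReal_zero, Complex.zero_cpow (fun hk0 => by
            rw [neg_eq_zero] at hk0; simp [hk0] at hk), zero_mul]
      rw [this, sub_self, norm_zero]
      exact hE0 J
  rw [hkey, add_sub_right_comm]
  exact (norm_add_le _ _).trans (add_le_add hmain hlast)

theorem norm_sub_cfSum_le_of_tendsto (hk : k.re < 0) (hcoh : cohCond δ h)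
    (hper : ∀ x : ℚ, x ∉ Set.Icc (-1 : ℚ) 0 → f (x + 1) = f x)
    (hrec : ∀ x : ℚ, x ∈ Set.Icc (-1 : ℚ) 1 → x ≠ 0 →
      f x - ((|((x : ℚ) : ℝ)| : ℝ) : ℂ) ^ (-k) * f (-1 / x) = h x)
    {E : ℕ → ℝ}
    (hE : ∀ (u : ℕ → ℝ) (b : ℕ → ℕ) (n J : ℕ), IsCFChain u b n →
      J ≤ n → (∀ i, J ≤ i → i < n → cfGap (-k.re / 2) δ (cfDen b i) ≤ u i) →
      ‖cfSum k h u n - cfSum k h u J‖ ≤ E J)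
    {x : ℝ} (hirr : Irrational x) (h01 : x ∈ Ioo (0 : ℝ) 1) {J : ℕ}
    (hx : x ∉ wellApprox (fun r => 2 * cfGap (-k.re / 2) δ r) J)
    {z : ℂ} (hz : Tendsto (fun j : ℕ => f (cfConv x j)) atTop (𝓝 z)) :
    ‖z - cfSum k h (fun j => gaussMap^[j] x) J‖ ≤ E J := by
  set K := ‖f 1‖ + ‖f (-1)‖ with hK
  have hlim1 : Tendsto (fun n => ‖f (cfConv x n) - cfSum k h (fun i => (convChain x n i : ℝ)) J‖)
      atTop (𝓝 ‖z - cfSum k h (fun j => gaussMap^[j] x) J‖) :=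
    (hz.sub (tendsto_cfSum k hcoh (fun i => (hirr.gaussMap_iterate h01 i).2)
      (fun i => tendsto_convChain hirr h01 i) J)).norm
  have hlim2 : Tendsto (fun n : ℕ => E J + (n : ℝ) ^ k.re * K) atTop (𝓝 (E J)) := by
    have := (((tendsto_rpow_neg_atTop (y := -k.re) (by linarith)).comp
      tendsto_natCast_atTop_atTop).mul_const K).const_add (E J)
    simpa using this
  refine le_of_tendsto_of_tendsto hlim1 hlim2 ?_
  filter_upwards [eventually_ge_atTop (J + 1)] with n hn
  have hc := isCFChain_convChain hirr h01 n
  have hG := hirr.isCFChain_gaussMap h01 n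
  have hn' : (0 : ℝ) < n := by exact_mod_cast (by omega : 0 < n)
  have hkey := signedVal_eq_cfSum_add hper hrec hc (w := convChain x n) (fun j _ => rfl) le_rfl
  have hw0 : convChain x n 0 ≠ 0 := by
    have := hc.pos 0 (by omega)
    exact_mod_cast this.ne'
  rw [convChain_self hirr h01, signedVal, if_neg hw0, one_mul] at hkey
  have e : convChain x n 0 = cfConv x n := rfl
  rw [← e, hkey, add_sub_right_comm]
  refine (norm_add_le _ _).trans (add_le_add ?_ ?_)
  · refine hE _ _ n J hc (by omega) fun i hi hin => ?_
    have h1 := hG.le_of_notMem_wellApprox hx hi hin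
    have h2 := half_gaussMap_le_convChain hirr h01 hin
    linarith
  · rw [norm_mul, Complex.norm_cpow_eq_rpow_re_of_pos (hc.cfProd_pos le_rfl), Complex.neg_re]
    refine mul_le_mul ?_ (norm_signedVal_zero_le f n) (norm_nonneg _) (by positivity)
    have hle : cfProd (fun i => (convChain x n i : ℝ)) n ≤ (n : ℝ)⁻¹ := by
      refine (hc.cfProd_le_inv le_rfl).trans ?_
      have := hc.le_cfDen (i := n) le_rfl
      gcongr
    calc _ ≤ ((n : ℝ)⁻¹) ^ (-k.re) :=
        Real.rpow_le_rpow (hc.cfProd_pos le_rfl).le hle (by linarith)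
      _ = _ := by rw [Real.inv_rpow hn'.le, ← Real.rpow_neg hn'.le, neg_neg]

end

theorem wellApprox_eq_iUnion (ψ : ℕ → ℝ) (J : ℕ) : wellApprox ψ J =
    ⋃ r ∈ Ici J, ⋃ p : ℤ, {x : ℝ | 0 < |r * x - p| ∧ r * |r * x - p| < ψ r} := by
  ext x; simp [wellApprox]

theorem measurableSet_wellApprox (ψ : ℕ → ℝ) (J : ℕ) : MeasurableSet (wellApprox ψ J) := by
  rw [wellApprox_eq_iUnion]
  refine MeasurableSet.biUnion (to_countable _) fun r _ => MeasurableSet.iUnion fun p => ?_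
  exact (measurableSet_lt (f := fun _ => (0 : ℝ)) (g := fun x : ℝ => |r * x - p|)
    (by fun_prop) (by fun_prop)).inter
    (measurableSet_lt (f := fun x : ℝ => r * |r * x - p|) (g := fun _ => ψ r)
      (by fun_prop) (by fun_prop))

theorem wellApprox_inter_subset {ψ : ℕ → ℝ} {J : ℕ} (hJ : 1 ≤ J) (hψ : ∀ r, J ≤ r → ψ r ≤ 1) :
    wellApprox ψ J ∩ Icc 0 1 ⊆ ⋃ i : ℕ, ⋃ p ∈ Finset.Icc (-1 : ℤ) ((i + J : ℕ) + 1),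
      Metric.ball ((p : ℝ) / (i + J : ℕ)) (ψ (i + J) / ((i + J : ℕ) : ℝ) ^ 2) := by
  rintro x ⟨⟨r, hJr, p, -, hlt⟩, hx0, hx1⟩
  obtain ⟨i, rfl⟩ := Nat.exists_eq_add_of_le' hJr
  have hr : (1 : ℝ) ≤ (i + J : ℕ) := by exact_mod_cast (by omega : 1 ≤ i + J)
  have h1 := hψ _ hJr
  set r := i + J
  have h2 : |(r : ℝ) * x - p| < 1 := by nlinarith [abs_nonneg ((r : ℝ) * x - p)]
  rw [abs_lt] at h2
  have h3 : (0 : ℝ) ≤ r * x := by positivity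
  have h4 : (r : ℝ) * x ≤ r := by nlinarith
  refine mem_iUnion.2 ⟨i, mem_iUnion₂.2 ⟨p, Finset.mem_Icc.2 ⟨?_, ?_⟩, ?_⟩⟩
  · have : (-1 : ℝ) ≤ p := by linarith
    exact_mod_cast this
  · have : (p : ℝ) ≤ r + 1 := by linarith
    exact_mod_cast this
  · have hr0 : (0 : ℝ) < r := by linarith
    have e : (r : ℝ) * x - p = r * (x - p / r) := by field_simp
    rw [e, abs_mul, abs_of_pos hr0] at hlt
    rw [Metric.mem_ball, Real.dist_eq, lt_div_iff₀ (by positivity)]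
    linarith

theorem exists_measureReal_wellApprox_le {ψ : ℕ → ℝ} (hψ0 : ∀ r, 0 ≤ ψ r)
    (hlim : Tendsto ψ atTop (𝓝 0)) (hsum : Summable fun r : ℕ => ψ r / r) (ε : ℝ) (hε : 0 < ε) :
    ∃ J₀ : ℕ, ∀ J ≥ J₀, (volume (wellApprox ψ J ∩ Icc 0 1)).toReal ≤ ε := by
  obtain ⟨J₁, hJ₁⟩ := eventually_atTop.1 (hlim.eventually (ge_mem_nhds zero_lt_one))
  obtain ⟨J₂, hJ₂⟩ := eventually_atTop.1 ((tendsto_sum_nat_add fun r : ℕ => 8 * (ψ r / r)).eventually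
    (ge_mem_nhds hε))
  refine ⟨J₁ + J₂ + 1, fun J hJ => ?_⟩
  have hsum' : Summable fun i : ℕ => 8 * (ψ (i + J) / (i + J : ℕ)) :=
    ((summable_nat_add_iff (f := fun r : ℕ => ψ r / r) J).2 hsum).mul_left 8
  refine ENNReal.toReal_le_of_le_ofReal hε.le ?_
  calc _ ≤ _ := measure_mono (wellApprox_inter_subset (by omega) fun r hr => hJ₁ r (by omega))
    _ ≤ _ := measure_iUnion_le _
    _ ≤ ∑' i : ℕ, ENNReal.ofReal (8 * (ψ (i + J) / (i + J : ℕ))) := by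
      refine ENNReal.tsum_le_tsum fun i => ?_
      have hr : (1 : ℝ) ≤ (i + J : ℕ) := by exact_mod_cast (by omega : 1 ≤ i + J)
      refine (measure_biUnion_finset_le _ _).trans ?_
      simp only [Real.volume_ball, Finset.sum_const, Int.card_Icc, nsmul_eq_mul]
      have h0 := hψ0 (i + J)
      set r := i + J
      have e : ((r : ℤ) + 1 + 1 - -1).toNat = r + 3 := by omega
      rw [e, ← ENNReal.ofReal_natCast, ← ENNReal.ofReal_mul (by positivity)]
      refine ENNReal.ofReal_le_ofReal ?_
      have hr0 : (0 : ℝ) < r := by linarith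
      have : ((r + 3 : ℕ) : ℝ) ≤ 4 * r := by push_cast; linarith
      calc _ ≤ 4 * (r : ℝ) * (2 * (ψ r / (r : ℝ) ^ 2)) := by gcongr
        _ = _ := by field_simp; ring
    _ = ENNReal.ofReal (∑' i : ℕ, 8 * (ψ (i + J) / (i + J : ℕ))) :=
      (ENNReal.ofReal_tsum_of_nonneg (fun i => mul_nonneg (by norm_num)
        (div_nonneg (hψ0 _) (Nat.cast_nonneg _))) hsum').symm
    _ ≤ _ := ENNReal.ofReal_le_ofReal (hJ₂ J (by omega))

/-- The numerators of the reduced fractions with denominator `q` in `(0, 1]`. -/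
abbrev reducedNum (q : ℕ) : Finset ℕ := (Finset.Icc 1 q).filter fun a => Nat.Coprime a q

theorem card_reducedNum (q : ℕ) : (reducedNum q).card = q.totient := by
  rw [← Nat.filter_coprime_Ico_eq_totient q 1]
  congr 1
  ext a
  simp only [Finset.mem_filter, Finset.mem_Icc, Finset.mem_Ico, Nat.coprime_comm]
  exact and_congr_left fun _ => by omega

theorem tendsto_card_divisors_div_totient :
    Tendsto (fun q : ℕ => (q.divisors.card : ℝ) / q.totient) atTop (𝓝 0) := by
  refine squeeze_zero' (Eventually.of_forall fun q => by positivity) ?_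
    tendsto_card_divisors_sq_mul_sqrt_div_totient
  filter_upwards [eventually_gt_atTop 0] with q hq
  have h1 : (1 : ℝ) ≤ q.divisors.card := by
    exact_mod_cast Finset.card_pos.2 ⟨1, by simp [hq.ne']⟩
  have h2 : (1 : ℝ) ≤ Real.sqrt q := Real.one_le_sqrt.2 (by exact_mod_cast hq)
  gcongr
  nlinarith

theorem tendsto_card_reducedNum_le {c : ℝ} (hc0 : 0 ≤ c) (hc1 : c ≤ 1) :
    Tendsto (fun q : ℕ => (((reducedNum q).filter fun a : ℕ => (a / q : ℝ) ≤ c).card : ℝ)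
      / q.totient) atTop (𝓝 c) := by
  rw [tendsto_iff_dist_tendsto_zero]
  have hlim := tendsto_card_divisors_div_totient.add
    (tendsto_inv_atTop_zero.comp (tendsto_natCast_atTop_atTop (R := ℝ)))
  rw [add_zero] at hlim
  refine squeeze_zero' (Eventually.of_forall fun _ => dist_nonneg) ?_ hlim
  filter_upwards [eventually_gt_atTop 0] with q hq
  have hq' : (0 : ℝ) < q := by exact_mod_cast hq
  have hφ : (0 : ℝ) < q.totient := by exact_mod_cast Nat.totient_pos.2 hq
  have hset : ((reducedNum q).filter fun a : ℕ => (a / q : ℝ) ≤ c) =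
      (Finset.Icc 1 ⌊c * q⌋₊).filter fun y => Nat.Coprime y q := by
    ext a
    have hfl : a ≤ ⌊c * q⌋₊ ↔ (a / q : ℝ) ≤ c := by
      rw [Nat.le_floor_iff (by positivity), div_le_iff₀ hq']
    have hle : (a / q : ℝ) ≤ c → a ≤ q := fun h => by
      have := (div_le_iff₀ hq').1 h
      have : (a : ℝ) ≤ q := by nlinarith
      exact_mod_cast this
    simp only [Finset.mem_filter, Finset.mem_Icc, hfl]
    tauto
  rw [hset, Real.dist_eq]
  have h1 := abs_card_coprime_sub_le q ⌊c * q⌋₊ hq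
  set A : ℝ := (((Finset.Icc 1 ⌊c * q⌋₊).filter fun y => Nat.Coprime y q).card : ℝ)
  have h2 : |(⌊c * q⌋₊ : ℝ) / q - c| ≤ (q : ℝ)⁻¹ := by
    have h3 := Nat.floor_le (show 0 ≤ c * q by positivity)
    have h4 := Nat.lt_floor_add_one (c * q)
    rw [abs_le, ← one_div, div_sub' hq'.ne', le_div_iff₀ hq', div_le_div_iff_of_pos_right hq']
    constructor
    · rw [neg_mul, one_div, inv_mul_cancel₀ hq'.ne']; linarith
    · linarith
  have e : A / q.totient - c = (A - ⌊c * q⌋₊ * (q.totient / q)) / q.totient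
      + ((⌊c * q⌋₊ : ℝ) / q - c) := by field_simp; ring
  rw [e]
  refine (abs_add_le _ _).trans (add_le_add ?_ h2)
  rw [abs_div, abs_of_pos hφ]
  gcongr

theorem div_mem_Ioc_of_mem_reducedNum {a q : ℕ} (ha : a ∈ reducedNum q) :
    (a / q : ℝ) ∈ Ioc (0 : ℝ) 1 := by
  have h := Finset.mem_Icc.1 (Finset.mem_filter.1 ha).1
  have h1 : (0 : ℝ) < a := by exact_mod_cast h.1
  have h2 : (a : ℝ) ≤ q := by exact_mod_cast h.2
  exact ⟨div_pos h1 (h1.trans_le h2), div_le_one_of_le₀ h2 (by positivity)⟩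

theorem tendsto_card_reducedNum_ceil_eq {N : ℕ} (hN : 0 < N) {m : ℕ} (hm1 : 1 ≤ m) (hm : m ≤ N) :
    Tendsto (fun q : ℕ => (((reducedNum q).filter fun a : ℕ => ⌈N * (a / q : ℝ)⌉₊ = m).card : ℝ)
      / q.totient) atTop (𝓝 (N : ℝ)⁻¹) := by
  have hN' : (0 : ℝ) < N := by exact_mod_cast hN
  have hdiff := (tendsto_card_reducedNum_le (c := m / N) (by positivity)
    (div_le_one_of_le₀ (by exact_mod_cast hm) hN'.le)).sub
    (tendsto_card_reducedNum_le (c := (m - 1 : ℕ) / N) (by positivity)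
      (div_le_one_of_le₀ (by exact_mod_cast (by omega : m - 1 ≤ N)) hN'.le))
  have e : (m / N : ℝ) - ((m - 1 : ℕ) : ℝ) / N = (N : ℝ)⁻¹ := by
    rw [Nat.cast_sub hm1]; push_cast; field_simp; ring
  rw [e] at hdiff
  refine hdiff.congr fun q => ?_
  rw [← sub_div]
  congr 1
  have hiff : ∀ (n a : ℕ), (a / q : ℝ) ≤ n / N ↔ ⌈N * (a / q : ℝ)⌉₊ ≤ n := fun n a => by
    rw [Nat.ceil_le, le_div_iff₀ hN', mul_comm]
  have hunion : ((reducedNum q).filter fun a : ℕ => (a / q : ℝ) ≤ m / N) =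
      ((reducedNum q).filter fun a : ℕ => ⌈N * (a / q : ℝ)⌉₊ = m) ∪
      ((reducedNum q).filter fun a : ℕ => (a / q : ℝ) ≤ (m - 1 : ℕ) / N) := by
    ext a
    simp only [Finset.mem_filter, Finset.mem_union, hiff, ← and_or_left]
    exact and_congr_right fun _ => by omega
  rw [hunion, Finset.card_union_of_disjoint]
  · push_cast; ring
  · rw [Finset.disjoint_left]
    intro a h1 h2
    have h3 := (Finset.mem_filter.1 h1).2
    have h4 := (hiff _ _).1 (Finset.mem_filter.1 h2).2
    omega

theorem tendsto_average_step {N : ℕ} (hN : 0 < N) (w : ℕ → ℝ) :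
    Tendsto (fun q : ℕ => (∑ a ∈ reducedNum q, w ⌈N * (a / q : ℝ)⌉₊) / q.totient) atTop
      (𝓝 (∑ m ∈ Finset.Icc 1 N, w m * (N : ℝ)⁻¹)) := by
  have hN' : (0 : ℝ) < N := by exact_mod_cast hN
  have : Tendsto (fun q : ℕ => ∑ m ∈ Finset.Icc 1 N, w m *
      ((((reducedNum q).filter fun a : ℕ => ⌈N * (a / q : ℝ)⌉₊ = m).card : ℝ) / q.totient)) atTop
      (𝓝 (∑ m ∈ Finset.Icc 1 N, w m * (N : ℝ)⁻¹)) :=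
    tendsto_finsetSum _ fun m hm =>
      (tendsto_card_reducedNum_ceil_eq hN (Finset.mem_Icc.1 hm).1 (Finset.mem_Icc.1 hm).2).const_mul _
  refine this.congr fun q => ?_
  have hmaps : ∀ a ∈ reducedNum q, ⌈N * (a / q : ℝ)⌉₊ ∈ Finset.Icc 1 N := fun a ha => by
    obtain ⟨h1, h2⟩ := div_mem_Ioc_of_mem_reducedNum ha
    refine Finset.mem_Icc.2 ⟨Nat.one_le_ceil_iff.2 (by positivity), ?_⟩
    rw [Nat.ceil_le]
    nlinarith
  rw [← Finset.sum_fiberwise_of_maps_to (s := reducedNum q) hmaps, Finset.sum_div]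
  refine Finset.sum_congr rfl fun m _ => ?_
  rw [Finset.sum_congr rfl fun a ha => by rw [(Finset.mem_filter.1 ha).2], Finset.sum_const,
    nsmul_eq_mul]
  ring

theorem integral_step {N : ℕ} (hN : 0 < N) (w : ℕ → ℝ) :
    ∫ x in Ioc (0 : ℝ) 1, w ⌈N * x⌉₊ = ∑ m ∈ Finset.Icc 1 N, w m * (N : ℝ)⁻¹ := by
  have hN' : (0 : ℝ) < N := by exact_mod_cast hN
  have hcongr : ∀ i : ℕ, EqOn (fun _ : ℝ => w (i + 1)) (fun x => w ⌈N * x⌉₊)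
      (Set.uIoc ((i : ℕ) / N : ℝ) ((i + 1 : ℕ) / N)) := by
    intro i x hx
    rw [uIoc_of_le (by gcongr; simp), mem_Ioc, div_lt_iff₀ hN', le_div_iff₀ hN'] at hx
    have : ⌈N * x⌉₊ = i + 1 := by
      rw [Nat.ceil_eq_iff (by simp)]
      push_cast at hx ⊢
      simpa [mul_comm (N : ℝ)] using hx
    simp only [this]
  have hint : ∀ i < N, IntervalIntegrable (fun x => w ⌈N * x⌉₊) volume ((i : ℕ) / N : ℝ)
      ((i + 1 : ℕ) / N) := fun i _ =>
    (intervalIntegrable_const (c := w (i + 1))).congr (hcongr i)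
  have hsum := intervalIntegral.sum_integral_adjacent_intervals hint
  rw [Nat.cast_zero, zero_div, div_self hN'.ne', intervalIntegral.integral_of_le zero_le_one] at hsum
  rw [← hsum, ← Finset.Ico_add_one_right_eq_Icc, Finset.sum_Ico_eq_sum_range]
  refine Finset.sum_congr rfl fun i _ => ?_
  rw [← intervalIntegral.integral_congr_ae (Eventually.of_forall fun x hx => hcongr i hx),
    intervalIntegral.integral_const, smul_eq_mul, add_comm 1 i]
  push_cast
  field_simp
  ring

/-- The supremum of `g` over the cell `((m - 1) / N, m / N]` of the unit interval. -/
noncomputable def cellSup (g : ℝ → ℝ) (N m : ℕ) : ℝ :=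
  sSup (g '' {y | y ∈ Ioc (0 : ℝ) 1 ∧ ⌈N * y⌉₊ = m})

theorem bddAbove_cell {g : ℝ → ℝ} {M : ℝ} (hM : ∀ x, |g x| ≤ M) (s : Set ℝ) :
    BddAbove (g '' s) :=
  ⟨M, by rintro _ ⟨y, -, rfl⟩; exact (abs_le.1 (hM y)).2⟩

theorem le_cellSup {g : ℝ → ℝ} {M : ℝ} (hM : ∀ x, |g x| ≤ M) (N : ℕ) {x : ℝ}
    (hx : x ∈ Ioc (0 : ℝ) 1) : g x ≤ cellSup g N ⌈N * x⌉₊ :=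
  le_csSup (bddAbove_cell hM _) ⟨x, ⟨hx, rfl⟩, rfl⟩

theorem abs_cellSup_le {g : ℝ → ℝ} {M : ℝ} (hM : ∀ x, |g x| ≤ M) (N m : ℕ) :
    |cellSup g N m| ≤ M := by
  have hM0 : 0 ≤ M := (abs_nonneg _).trans (hM 0)
  rw [abs_le]
  constructor
  · rcases eq_empty_or_nonempty {y | y ∈ Ioc (0 : ℝ) 1 ∧ ⌈N * y⌉₊ = m} with he | ⟨y, hy⟩
    · rw [cellSup, he, image_empty, Real.sSup_empty]; linarith
    · exact (abs_le.1 (hM y)).1.trans (le_csSup (bddAbove_cell hM _) ⟨y, hy, rfl⟩)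
  · refine Real.sSup_le ?_ hM0
    rintro _ ⟨y, -, rfl⟩
    exact (abs_le.1 (hM y)).2

theorem tendsto_cellSup {g : ℝ → ℝ} {M : ℝ} (hM : ∀ x, |g x| ≤ M) {x : ℝ}
    (hx : x ∈ Ioc (0 : ℝ) 1) (hg : ContinuousAt g x) :
    Tendsto (fun N : ℕ => cellSup g N ⌈N * x⌉₊) atTop (𝓝 (g x)) := by
  rw [Metric.tendsto_atTop]
  intro ε hε
  obtain ⟨η, hη, hgη⟩ := Metric.continuousAt_iff.1 hg (ε / 2) (half_pos hε)
  obtain ⟨N₀, hN₀⟩ := exists_nat_gt η⁻¹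
  refine ⟨N₀, fun N hN => ?_⟩
  have hN' : η⁻¹ < N := hN₀.trans_le (by exact_mod_cast hN)
  have hNpos : (0 : ℝ) < N := (inv_pos.2 hη).trans hN'
  have hle := le_cellSup hM N hx
  have hge : cellSup g N ⌈N * x⌉₊ ≤ g x + ε / 2 := by
    refine csSup_le ⟨g x, x, ⟨hx, rfl⟩, rfl⟩ ?_
    rintro _ ⟨y, ⟨hy, hyx⟩, rfl⟩
    have h1 := Nat.le_ceil (N * y)
    have h2 := Nat.le_ceil (N * x)
    have h3 := Nat.ceil_lt_add_one (mul_pos hNpos hy.1).le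
    have h4 := Nat.ceil_lt_add_one (mul_pos hNpos hx.1).le
    rw [hyx] at h1 h3
    have h5 : |(N : ℝ) * (y - x)| < 1 := by rw [abs_lt]; constructor <;> linarith
    rw [abs_mul, abs_of_pos hNpos] at h5
    have h6 : 1 < N * η := by rwa [inv_lt_iff_one_lt_mul₀ hη] at hN'
    have h7 : |y - x| < η := lt_of_mul_lt_mul_left (h5.trans h6) hNpos.le
    have h8 := hgη (x := y) (by rwa [Real.dist_eq])
    rw [Real.dist_eq, abs_lt] at h8
    linarith
  rw [Real.dist_eq, abs_lt]
  constructor <;> linarith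

theorem measurable_cellSup_ceil (g : ℝ → ℝ) (N : ℕ) :
    Measurable fun x : ℝ => cellSup g N ⌈N * x⌉₊ :=
  (measurable_from_nat (f := cellSup g N)).comp
    (Nat.measurable_ceil.comp (measurable_const_mul (N : ℝ)))

theorem ae_irrational_Ioc : ∀ᵐ x ∂volume.restrict (Ioc (0 : ℝ) 1),
    Irrational x ∧ x ∈ Ioo (0 : ℝ) 1 := by
  have hirr : ∀ᵐ x : ℝ, Irrational x :=
    (countable_range ((↑) : ℚ → ℝ)).ae_notMem volume
  filter_upwards [ae_restrict_of_ae hirr, ae_restrict_mem measurableSet_Ioc] with x h1 h2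
  exact ⟨h1, h2.1, h2.2.lt_of_ne fun h => h1 ⟨1, by simp [h]⟩⟩

theorem aestronglyMeasurable_of_continuousAt_irrational {g : ℝ → ℝ} {M : ℝ} (hM : ∀ x, |g x| ≤ M)
    (hg : ∀ x, Irrational x → x ∈ Ioo (0 : ℝ) 1 → ContinuousAt g x) :
    AEStronglyMeasurable g (volume.restrict (Ioc (0 : ℝ) 1)) := by
  refine aestronglyMeasurable_of_tendsto_ae atTop
    (fun N => (measurable_cellSup_ceil g N).aestronglyMeasurable) ?_
  filter_upwards [ae_irrational_Ioc] with x hx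
  exact tendsto_cellSup hM (Ioo_subset_Ioc_self hx.2) (hg x hx.1 hx.2)

theorem eventually_average_le {g : ℝ → ℝ} {M : ℝ} (hM : ∀ x, |g x| ≤ M)
    (hg : ∀ x, Irrational x → x ∈ Ioo (0 : ℝ) 1 → ContinuousAt g x) {η : ℝ} (hη : 0 < η) :
    ∀ᶠ q : ℕ in atTop, (∑ a ∈ reducedNum q, g (a / q)) / q.totient ≤
      (∫ x in Ioc (0 : ℝ) 1, g x) + η := by
  have hlim : Tendsto (fun N : ℕ => ∫ x in Ioc (0 : ℝ) 1, cellSup g N ⌈N * x⌉₊) atTop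
      (𝓝 (∫ x in Ioc (0 : ℝ) 1, g x)) := by
    refine tendsto_integral_of_dominated_convergence (fun _ => M)
      (fun N => (measurable_cellSup_ceil g N).aestronglyMeasurable) (integrable_const _)
      (fun N => Eventually.of_forall fun x => abs_cellSup_le hM _ _) ?_
    filter_upwards [ae_irrational_Ioc] with x hx
    exact tendsto_cellSup hM (Ioo_subset_Ioc_self hx.2) (hg x hx.1 hx.2)
  obtain ⟨N, hN, hN0⟩ := ((hlim.eventually (gt_mem_nhds (lt_add_of_pos_right _ (half_pos hη)))).and
    (eventually_gt_atTop 0)).exists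
  have havg := tendsto_average_step hN0 (cellSup g N)
  rw [← integral_step hN0] at havg
  filter_upwards [havg.eventually (gt_mem_nhds (lt_add_of_pos_right _ (half_pos hη)))] with q hq
  have : (∑ a ∈ reducedNum q, g (a / q)) / q.totient ≤
      (∑ a ∈ reducedNum q, cellSup g N ⌈N * (a / q : ℝ)⌉₊) / q.totient := by
    gcongr with a ha
    exact le_cellSup hM N (div_mem_Ioc_of_mem_reducedNum ha)
  linarith

theorem tendsto_average_of_continuousAt_irrational {g : ℝ → ℝ} {M : ℝ} (hM : ∀ x, |g x| ≤ M)
    (hg : ∀ x, Irrational x → x ∈ Ioo (0 : ℝ) 1 → ContinuousAt g x) :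
    Tendsto (fun q : ℕ => (∑ a ∈ reducedNum q, g (a / q)) / q.totient) atTop
      (𝓝 (∫ x in Ioc (0 : ℝ) 1, g x)) := by
  rw [Metric.tendsto_nhds]
  intro ε hε
  have hneg := eventually_average_le (g := fun x => -g x) (M := M) (by simpa using hM)
    (fun x h1 h2 => (hg x h1 h2).neg) (half_pos hε)
  filter_upwards [eventually_average_le hM hg (half_pos hε), hneg] with q h1 h2
  rw [Finset.sum_neg_distrib, neg_div, integral_neg] at h2
  rw [Real.dist_eq, abs_lt]
  constructor <;> linarith

open scoped ENNReal in
theorem tendsto_average_of_forall_lipschitz {y : ℕ → ℕ → ℂ} {F : ℝ → ℂ} (hF : Measurable F)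
    (hlip : ∀ G : ℂ → ℝ, (∃ M, ∀ z, |G z| ≤ M) → (∃ L, LipschitzWith L G) →
      Tendsto (fun q : ℕ => (∑ a ∈ reducedNum q, G (y q a)) / q.totient) atTop
        (𝓝 (∫ x in Ioc (0 : ℝ) 1, G (F x))))
    {G : ℂ → ℝ} (hG : Continuous G) {M : ℝ} (hGb : ∀ z, |G z| ≤ M) :
    Tendsto (fun q : ℕ => (∑ a ∈ reducedNum q, G (y q a)) / q.totient) atTop
      (𝓝 (∫ x in Ioc (0 : ℝ) 1, G (F x))) := by
  have hφ : ∀ q : ℕ, 0 < (q + 1).totient := fun q => Nat.totient_pos.2 q.succ_pos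
  let ν : ℕ → Measure ℂ := fun q =>
    ((q + 1).totient : ℝ≥0∞)⁻¹ • ∑ a ∈ reducedNum (q + 1), Measure.dirac (y (q + 1) a)
  have hν : ∀ q, IsProbabilityMeasure (ν q) := fun q => ⟨by
    simp only [ν, Measure.smul_apply, Measure.finsetSum_apply, Measure.dirac_apply_of_mem
      (mem_univ _), Finset.sum_const, card_reducedNum, smul_eq_mul, nsmul_eq_mul, mul_one]
    exact ENNReal.inv_mul_cancel (by exact_mod_cast (hφ q).ne') (ENNReal.natCast_ne_top _)⟩
  have hint : ∀ (H : ℂ → ℝ) q, ∫ z, H z ∂ν q =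
      (∑ a ∈ reducedNum (q + 1), H (y (q + 1) a)) / (q + 1).totient := fun H q => by
    rw [integral_smul_measure, integral_finsetSum_measure fun _ _ => integrable_dirac (by simp)]
    simp [integral_dirac, div_eq_inv_mul]
  have hprob : IsProbabilityMeasure (volume.restrict (Ioc (0 : ℝ) 1)) := ⟨by simp⟩
  have hμ : IsProbabilityMeasure ((volume.restrict (Ioc (0 : ℝ) 1)).map F) :=
    Measure.isProbabilityMeasure_map hF.aemeasurable
  have hmap : ∀ H : ℂ → ℝ, Continuous H → ∫ z, H z ∂(volume.restrict (Ioc (0 : ℝ) 1)).map F =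
      ∫ x in Ioc (0 : ℝ) 1, H (F x) := fun H hH =>
    integral_map hF.aemeasurable hH.aestronglyMeasurable
  let P : ℕ → ProbabilityMeasure ℂ := fun q => ⟨ν q, hν q⟩
  let Q : ProbabilityMeasure ℂ := ⟨_, hμ⟩
  have hP : ∀ (H : ℂ → ℝ) q, ∫ z, H z ∂(P q : Measure ℂ) =
      (∑ a ∈ reducedNum (q + 1), H (y (q + 1) a)) / (q + 1).totient := hint
  have hQ : ∀ H : ℂ → ℝ, Continuous H → ∫ z, H z ∂(Q : Measure ℂ) =
      ∫ x in Ioc (0 : ℝ) 1, H (F x) := hmap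
  have hconv : Tendsto P atTop (𝓝 Q) := by
    rw [tendsto_iff_forall_lipschitz_integral_tendsto]
    rintro H ⟨C, hC⟩ hL
    simp only [hP, hQ H hL.choose_spec.continuous]
    refine (hlip H ⟨C + |H 0|, fun z => ?_⟩ hL).comp (tendsto_add_atTop_nat 1)
    have h1 := hC z 0
    rw [Real.dist_eq] at h1
    linarith [abs_sub_abs_le_abs_sub (H z) (H 0)]
  rw [ProbabilityMeasure.tendsto_iff_forall_integral_tendsto] at hconv
  have h := hconv (BoundedContinuousFunction.ofNormedAddCommGroup G hG M hGb)
  simp only [BoundedContinuousFunction.coe_ofNormedAddCommGroup, hP, hQ G hG] at h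
  exact (tendsto_add_atTop_iff_nat 1).1 h

theorem abs_apply_sub_le {G : ℂ → ℝ} {M : ℝ} (hM : ∀ z, |G z| ≤ M) (z w : ℂ) :
    |G z - G w| ≤ 2 * M := by
  linarith [abs_sub (G z) (G w), hM z, hM w]

open scoped NNReal in
theorem abs_average_sub_le {G : ℂ → ℝ} {M : ℝ} (hM : ∀ z, |G z| ≤ M) {L : ℝ≥0}
    (hL : LipschitzWith L G) {q : ℕ} (hq : 0 < q) {y s : ℕ → ℂ} {W : Set ℕ} [DecidablePred (· ∈ W)]
    {η ε : ℝ} (hη : 0 ≤ η) (hys : ∀ a ∈ reducedNum q, a ∉ W → ‖y a - s a‖ ≤ η)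
    (hW : (((reducedNum q).filter (· ∈ W)).card : ℝ) ≤ ε * q.totient) :
    |(∑ a ∈ reducedNum q, G (y a)) / q.totient - (∑ a ∈ reducedNum q, G (s a)) / q.totient|
      ≤ L * η + 2 * M * ε := by
  have hM0 : 0 ≤ M := (abs_nonneg _).trans (hM 0)
  have hφ : (0 : ℝ) < q.totient := by exact_mod_cast Nat.totient_pos.2 hq
  rw [← sub_div, abs_div, abs_of_pos hφ, div_le_iff₀ hφ, ← Finset.sum_sub_distrib]
  calc _ ≤ ∑ a ∈ reducedNum q, |G (y a) - G (s a)| := Finset.abs_sum_le_sum_abs _ _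
    _ ≤ ∑ a ∈ reducedNum q, (L * η + if a ∈ W then 2 * M else 0) := by
      refine Finset.sum_le_sum fun a ha => ?_
      split_ifs with h
      · linarith [abs_apply_sub_le hM (y a) (s a), mul_nonneg L.coe_nonneg hη]
      · rw [add_zero]
        have h1 := hL.dist_le_mul (y a) (s a)
        rw [Real.dist_eq, dist_eq_norm] at h1
        exact h1.trans (by gcongr; exact hys a ha h)
    _ = L * η * q.totient + 2 * M * ((reducedNum q).filter (· ∈ W)).card := by
      rw [Finset.sum_add_distrib, ← Finset.sum_filter, Finset.sum_const, Finset.sum_const,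
        card_reducedNum, nsmul_eq_mul, nsmul_eq_mul]
      ring
    _ ≤ L * η * q.totient + 2 * M * (ε * q.totient) := by gcongr
    _ = _ := by ring

open scoped NNReal in
theorem abs_integral_sub_le {G : ℂ → ℝ} {M : ℝ} (hM : ∀ z, |G z| ≤ M) {L : ℝ≥0}
    (hL : LipschitzWith L G) {F S : ℝ → ℂ} (hF : Measurable F)
    (hS : AEStronglyMeasurable (fun x => G (S x)) (volume.restrict (Ioc (0 : ℝ) 1))) {W : Set ℝ}
    (hWm : MeasurableSet W) {η ε : ℝ} (hη : 0 ≤ η)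
    (hFS : ∀ᵐ x ∂volume.restrict (Ioc (0 : ℝ) 1), x ∉ W → ‖F x - S x‖ ≤ η)
    (hW : (volume (W ∩ Icc 0 1)).toReal ≤ ε) :
    |(∫ x in Ioc (0 : ℝ) 1, G (F x)) - ∫ x in Ioc (0 : ℝ) 1, G (S x)| ≤ L * η + 2 * M * ε := by
  have hM0 : 0 ≤ M := (abs_nonneg _).trans (hM 0)
  have hiF : Integrable (fun x => G (F x)) (volume.restrict (Ioc (0 : ℝ) 1)) :=
    Integrable.of_bound (hL.continuous.measurable.comp hF).aestronglyMeasurable M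
      (Eventually.of_forall fun x => hM _)
  have hiS : Integrable (fun x => G (S x)) (volume.restrict (Ioc (0 : ℝ) 1)) :=
    Integrable.of_bound hS M (Eventually.of_forall fun x => hM _)
  have hiW : Integrable (W.indicator fun _ => 2 * M) (volume.restrict (Ioc (0 : ℝ) 1)) :=
    (integrable_const _).indicator hWm
  rw [← integral_sub hiF hiS]
  calc _ ≤ ∫ x in Ioc (0 : ℝ) 1, |G (F x) - G (S x)| := abs_integral_le_integral_abs
    _ ≤ ∫ x in Ioc (0 : ℝ) 1, (L * η + W.indicator (fun _ => 2 * M) x) := by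
      refine integral_mono_ae (hiF.sub hiS).abs ((integrable_const _).add hiW) ?_
      filter_upwards [hFS] with x hx
      by_cases h : x ∈ W
      · rw [indicator_of_mem h]
        linarith [abs_apply_sub_le hM (F x) (S x), mul_nonneg L.coe_nonneg hη]
      · rw [indicator_of_notMem h, add_zero]
        have h1 := hL.dist_le_mul (F x) (S x)
        rw [Real.dist_eq, dist_eq_norm] at h1
        exact h1.trans (by gcongr; exact hx h)
    _ = L * η + 2 * M * (volume (W ∩ Ioc 0 1)).toReal := by
      rw [integral_add (integrable_const _) hiW, integral_indicator_const _ hWm]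
      simp [Measure.real, Measure.restrict_apply hWm, mul_comm]
    _ ≤ _ := by
      gcongr
      refine le_trans (ENNReal.toReal_mono ?_ (measure_mono (inter_subset_inter_right _
        Ioc_subset_Icc_self))) hW
      exact ne_top_of_le_ne_top (by simp) (measure_mono (inter_subset_right : _ ⊆ Icc (0 : ℝ) 1))

theorem cohCond.mono {δ δ' : ℝ} (h' : δ' ≤ δ) {h : ℝ → ℂ} (hcoh : cohCond δ h) :
    cohCond δ' h := by
  obtain ⟨h1, C, hC, h2⟩ := hcoh
  refine ⟨fun η hη => ?_, C, hC, fun x hx hx0 => (h2 x hx hx0).trans ?_⟩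
  · obtain ⟨ε₀, hε₀, H⟩ := h1 η hη
    refine ⟨min ε₀ 1, lt_min hε₀ one_pos, fun ε hε hlt x y hx hy hx0 hy0 hxy => ?_⟩
    refine H ε hε (hlt.trans_le (min_le_left _ _)) x y hx hy hx0 hy0 (hxy.trans_le ?_)
    exact Real.exp_le_exp.2 (neg_le_neg (Real.rpow_le_rpow_of_exponent_ge hε
      (hlt.le.trans (min_le_right _ _)) (by linarith)))
  · have : |x| ^ (δ - 1) ≤ |x| ^ (δ' - 1) :=
      Real.rpow_le_rpow_of_exponent_ge (abs_pos.2 hx0) (abs_le.2 hx) (by linarith)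
    gcongr

theorem cohCond.congr {δ : ℝ} {h h' : ℝ → ℂ} (hh : ∀ x, x ≠ 0 → h' x = h x)
    (hcoh : cohCond δ h) : cohCond δ h' := by
  obtain ⟨h1, C, hC, h2⟩ := hcoh
  refine ⟨fun η hη => ?_, C, hC, fun x hx hx0 => by rw [hh x hx0]; exact h2 x hx hx0⟩
  obtain ⟨ε₀, hε₀, H⟩ := h1 η hη
  refine ⟨ε₀, hε₀, fun ε hε hlt x y hx hy hx0 hy0 => ?_⟩
  rw [hh x hx0, hh y hy0]
  exact H ε hε hlt x y hx hy hx0 hy0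

theorem tendsto_average_of_lipschitz {k : ℂ} (hk : k.re < 0) {δ : ℝ} (hδ : 0 < δ) (hδ1 : δ < 1)
    {f : ℚ → ℂ} {h : ℝ → ℂ} (h0 : h 0 = 0)
    (hper : ∀ x : ℚ, x ∉ Set.Icc (-1 : ℚ) 0 → f (x + 1) = f x)
    (hrec : ∀ x : ℚ, x ∈ Set.Icc (-1 : ℚ) 1 → x ≠ 0 →
      f x - ((|((x : ℚ) : ℝ)| : ℝ) : ℂ) ^ (-k) * f (-1 / x) = h x)
    (hcoh : cohCond δ h) {F : ℝ → ℂ} (hF : Measurable F)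
    (hlim : ∀ᵐ x : ℝ, Tendsto (fun j : ℕ => f (cfConv x j)) atTop (𝓝 (F x)))
    {G : ℂ → ℝ} {M : ℝ} (hM : ∀ z, |G z| ≤ M) {L : NNReal} (hL : LipschitzWith L G) :
    Tendsto (fun q : ℕ => (∑ a ∈ reducedNum q, G (f ((a : ℚ) / q))) / q.totient) atTop
      (𝓝 (∫ x in Ioc (0 : ℝ) 1, G (F x))) := by
  classical
  have hM0 : 0 ≤ M := (abs_nonneg _).trans (hM 0)
  obtain ⟨C, hC, hbd⟩ := hcoh.2
  obtain ⟨E, hE0, hElim, hE⟩ := exists_norm_cfSum_sub_le hk hδ1 hC hbd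
  set ψ : ℕ → ℝ := fun r => 2 * cfGap (-k.re / 2) δ r with hψ
  have hc : 0 < -k.re / 2 := by linarith
  have hψ0 : ∀ r, 0 ≤ ψ r := fun r => mul_nonneg two_pos.le (cfGap_pos hc.le r).le
  have hψanti : Antitone ψ := fun r s hrs =>
    mul_le_mul_of_nonneg_left (cfGap_antitone hc.le hδ1 hrs) two_pos.le
  have hψlim : Tendsto ψ atTop (𝓝 0) := by
    simpa using (tendsto_cfGap hc hδ1).const_mul 2
  have hψsum : Summable fun r : ℕ => ψ r / r := by
    simpa only [hψ, mul_div_assoc] using (summable_cfGap_div hc hδ hδ1).mul_left 2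
  rw [Metric.tendsto_nhds]
  intro η hη
  obtain ⟨ε, hε, hLε⟩ : ∃ ε : ℝ, 0 < ε ∧ (3 * L + 4 * M + 1) * ε < η := by
    have hpos : 0 < 3 * (L : ℝ) + 4 * M + 1 := by positivity
    refine ⟨η / (3 * L + 4 * M + 1) / 2, by positivity, ?_⟩
    rw [mul_div_assoc', mul_div_cancel₀ _ hpos.ne']
    linarith
  obtain ⟨J₁, hJ₁⟩ := exists_card_wellApprox_le hψ0 hψanti hψlim hψsum ε hε
  obtain ⟨J₂, hJ₂⟩ := exists_measureReal_wellApprox_le hψ0 hψlim hψsum ε hε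
  obtain ⟨J, hJ, hEJ⟩ := ((eventually_ge_atTop (max J₁ J₂)).and
    (hElim.eventually (ge_mem_nhds hε))).exists
  have hcard := hJ₁ J ((le_max_left _ _).trans hJ)
  have hvol := hJ₂ J ((le_max_right _ _).trans hJ)
  set S : ℝ → ℂ := fun x => cfSum k h (fun j => gaussMap^[j] x) J with hS
  have hScont : ∀ x, Irrational x → x ∈ Ioo (0 : ℝ) 1 → ContinuousAt (fun x => G (S x)) x :=
    fun x hx h01 => hL.continuous.continuousAt.comp (tendsto_cfSum k hcoh
      (fun i => (hx.gaussMap_iterate h01 i).2) (fun i => hx.continuousAt_gaussMap_iterate h01 i) J)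
  have havg := tendsto_average_of_continuousAt_irrational (fun x => hM (S x)) hScont
  have hint := abs_integral_sub_le hM hL hF
    (aestronglyMeasurable_of_continuousAt_irrational (fun x => hM (S x)) hScont)
    (measurableSet_wellApprox ψ J) (hE0 J) (by
      filter_upwards [ae_irrational_Ioc, ae_restrict_of_ae hlim] with x hx hxlim hxW
      exact norm_sub_cfSum_le_of_tendsto hk hcoh hper hrec hE hx.1 hx.2 hxW hxlim) hvol
  have hqk : Tendsto (fun q : ℕ => (q : ℝ) ^ k.re * (‖f 1‖ + ‖f (-1)‖)) atTop (𝓝 0) := by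
    have h1 := (tendsto_rpow_neg_atTop (y := -k.re) (by linarith)).comp
      (tendsto_natCast_atTop_atTop (R := ℝ))
    simpa [Function.comp_def] using h1.mul_const (‖f 1‖ + ‖f (-1)‖)
  filter_upwards [hcard, Metric.tendsto_nhds.1 havg ε hε, hqk.eventually (ge_mem_nhds hε),
    eventually_gt_atTop 0] with q hq1 hq2 hq3 hq0
  have hsum := abs_average_sub_le hM hL hq0 (y := fun a => f ((a : ℚ) / q))
    (s := fun a => S (a / q)) (W := {a : ℕ | (a / q : ℝ) ∈ wellApprox ψ J})
    (add_nonneg (hE0 J) (by positivity : 0 ≤ (q : ℝ) ^ k.re * (‖f 1‖ + ‖f (-1)‖)))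
    (fun a ha hW => norm_apply_div_sub_cfSum_le hk h0 hper hrec hE0 hE hq0
      (Finset.mem_Icc.1 (Finset.mem_filter.1 ha).1).1
      (Finset.mem_Icc.1 (Finset.mem_filter.1 ha).1).2 (Finset.mem_filter.1 ha).2 hW)
    (by simpa using hq1)
  rw [Real.dist_eq] at hq2 ⊢
  have hLE : (L : ℝ) * (E J + (q : ℝ) ^ k.re * (‖f 1‖ + ‖f (-1)‖)) ≤ L * (2 * ε) := by
    gcongr; linarith
  have hLE' : (L : ℝ) * E J ≤ L * ε := by gcongr
  rw [abs_le] at hsum hint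
  rw [abs_lt] at hq2 ⊢
  constructor <;> linarith [hsum.1, hsum.2, hint.1, hint.2, hq2.1, hq2.2]

/-- Equidistribution of the values `f(a/q)`, `(a,q) = 1`, as `q → ∞`,
according to the pushforward of Lebesgue measure under the extension `f†`, for `Re k < 0`. -/
theorem stmt3 (k : ℂ) (hk : k.re < 0) (δ : ℝ) (hδ : 0 < δ)
    (f : ℚ → ℂ) (h : ℝ → ℂ)
    (hper : ∀ x : ℚ, x ∉ Set.Icc (-1 : ℚ) 0 → f (x + 1) = f x)
    (hrec : ∀ x : ℚ, x ∈ Set.Icc (-1 : ℚ) 1 → x ≠ 0 →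
      f x - ((|((x : ℚ) : ℝ)| : ℝ) : ℂ) ^ (-k) * f (-1 / x) = h x)
    (hcoh : cohCond δ h)
    (X : Set ℝ) (hXirr : ∀ x ∈ X, Irrational x) (hXfull : volume Xᶜ = 0)
    (F : ℝ → ℂ) (hFmeas : Measurable F)
    (hFlim : ∀ x ∈ X, Tendsto (fun j : ℕ => f (cfConv x j)) atTop (nhds (F x)))
    (G : ℂ → ℝ) (hG : Continuous G) (M : ℝ) (hGb : ∀ z : ℂ, |G z| ≤ M) :
    Tendsto (fun q : ℕ =>
        (∑ a ∈ (Finset.Icc 1 q).filter fun a => Nat.Coprime a q, G (f ((a : ℚ) / q)))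
          / (q.totient : ℝ))
      atTop (nhds (∫ x in Set.Icc (0 : ℝ) 1, G (F x))) := by
  rw [integral_Icc_eq_integral_Ioc]
  have hlim : ∀ᵐ x : ℝ, Tendsto (fun j : ℕ => f (cfConv x j)) atTop (𝓝 (F x)) := by
    have hX : ∀ᵐ x : ℝ, x ∈ X := hXfull
    exact hX.mono hFlim
  refine tendsto_average_of_forall_lipschitz (y := fun q a => f ((a : ℚ) / q)) hFmeas ?_ hG hGb
  rintro G' ⟨M', hM'⟩ ⟨L, hL⟩
  exact tendsto_average_of_lipschitz (h := fun x => if x = 0 then 0 else h x) hk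
    (lt_min hδ one_half_pos) ((min_le_right δ (1 / 2)).trans_lt one_half_lt_one) (if_pos rfl) hper
    (fun x hx hx0 => by rw [if_neg (Rat.cast_ne_zero.2 hx0)]; exact hrec x hx hx0)
    ((hcoh.mono (min_le_left _ _)).congr fun x hx => if_neg hx) hFmeas hlim hM' hL
end

section
/- Let k ∈ ℂ with Re(k) > 0, and let f : ℚ → ℂ be 1-periodic (f(x+1) = f(x) for all x ∈ ℚ) and satisfy f(x) − |x|^{−k}·f(−1/x) = h(x) for all x ∈ ℚ\{0}, where h : ℝ\{0} → ℂ satisfies |h(x)| ≤ C·|x|^{−Re(k)} for all 0 < |x| ≤ 1 and some C > 0. Define f‡(x) := den(x)^{−k}·f(x̄) for x ∈ ℚ. Then: (a) for every irrational x ∈ ℝ the limit lim_{ℚ∋y→x} f‡(y) exists, and the function f‡ : ℝ → ℂ (equal to the above on ℚ and to this limit at irrationals) is continuous at every irrational point; (b) if moreover h(x)·|x|^{Re(k)} → 0 as x → 0, then f‡ is continuous on all of ℝ. -/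
open Filter Topology MeasureTheory Set

/-- For a rational `y = a/q` in lowest terms, `ratBar y = ā/q` where `ā ∈ {1,…,q}` is
the multiplicative inverse of `a` modulo `q` (and `ā = 1` when `q = 1`). -/
def ratBar (y : ℚ) : ℚ :=
  (if ((y.num : ZMod y.den)⁻¹).val = 0 then (y.den : ℚ)
   else (((y.num : ZMod y.den)⁻¹).val : ℚ)) / (y.den : ℚ)

/-- `z < y` are neighbouring fractions: the determinant of their reduced forms is `1`. -/
def FareyAdj (z y : ℚ) : Prop := y.num * z.den - z.num * y.den = 1

theorem exists_rat_num_den {a q u v : ℤ} (hq : 0 < q) (huv : u * a + v * q = 1) :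
    ∃ r : ℚ, r.num = a ∧ (r.den : ℤ) = q := by
  have hc : a.natAbs.Coprime q.natAbs := Int.isCoprime_iff_nat_coprime.mp ⟨u, v, huv⟩
  exact ⟨(a : ℚ) / q, Rat.num_div_eq_of_coprime hq hc, Rat.den_div_eq_of_coprime hq hc⟩

theorem Rat.exists_bezout (r : ℚ) : ∃ u v : ℤ, u * r.num + v * r.den = 1 :=
  Int.isCoprime_iff_nat_coprime.mpr (by simpa using r.reduced)

theorem Rat.int_den_pos (r : ℚ) : 0 < (r.den : ℤ) := by exact_mod_cast r.den_pos

namespace FareyAdj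

theorem sub_eq {z y : ℚ} (hzy : FareyAdj z y) : y - z = 1 / ((z.den : ℚ) * y.den) := by
  have hz : (z.den : ℚ) ≠ 0 := by exact_mod_cast z.den_nz
  have hy : (y.den : ℚ) ≠ 0 := by exact_mod_cast y.den_nz
  have e : (y.num : ℚ) * z.den - z.num * y.den = 1 := by exact_mod_cast hzy
  nth_rewrite 1 [← Rat.num_div_den y, ← Rat.num_div_den z]
  rw [div_sub_div _ _ hy hz, div_eq_div_iff (by positivity) (by positivity)]
  linear_combination ((z.den : ℚ) * y.den) * e

theorem lt {z y : ℚ} (hzy : FareyAdj z y) : z < y := by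
  have hz : (0 : ℚ) < z.den := by exact_mod_cast z.den_pos
  have hy : (0 : ℚ) < y.den := by exact_mod_cast y.den_pos
  have : 0 < y - z := by rw [hzy.sub_eq]; positivity
  linarith

theorem den_add_den_le {z y w : ℚ} (hzy : FareyAdj z y) (h1 : z < w) (h2 : w < y) :
    z.den + y.den ≤ w.den := by
  rw [Rat.lt_iff] at h1 h2
  have hz := z.int_den_pos
  have hy := y.int_den_pos
  have e : y.num * z.den - z.num * y.den = 1 := hzy
  have key : (w.den : ℤ) = (w.num * z.den - z.num * w.den) * y.den
      + (y.num * w.den - w.num * y.den) * z.den := by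
    linear_combination (-(w.den : ℤ)) * e
  have i1 : 1 ≤ w.num * z.den - z.num * w.den := by linarith
  have i2 : 1 ≤ y.num * w.den - w.num * y.den := by linarith
  have : (z.den : ℤ) + y.den ≤ w.den := by nlinarith
  exact_mod_cast this

end FareyAdj

/-- The two Stern-Brocot parents of a non-integral rational. -/
theorem exists_fareyAdj_parents {y : ℚ} (hy : 2 ≤ y.den) :
    ∃ z w : ℚ, FareyAdj z y ∧ FareyAdj y w ∧ z.den + w.den = y.den := by
  obtain ⟨u, v, huv⟩ := y.exists_bezout
  have hd := y.int_den_pos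
  have hd2 : (2 : ℤ) ≤ y.den := by exact_mod_cast hy
  set d : ℤ := (y.den : ℤ) with hd_def
  obtain ⟨s, b, hs0, hsd, hsb⟩ : ∃ s b : ℤ, 0 ≤ s ∧ s < d ∧ y.num * s - b * d = 1 := by
    refine ⟨u % d, -v - y.num * (u / d), Int.emod_nonneg _ hd.ne', Int.emod_lt_of_pos _ hd, ?_⟩
    have := Int.emod_add_mul_ediv u d
    linear_combination huv + y.num * this
  have hs : 0 < s := by
    rcases hs0.lt_or_eq with h | h
    · exact h
    · exfalso
      have e : d * (-b) = 1 := by rw [← h] at hsb; linarith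
      have := Int.le_of_dvd one_pos ⟨_, e.symm⟩
      omega
  obtain ⟨z, hz1, hz2⟩ := exists_rat_num_den (a := b) (q := s) (u := -d) (v := y.num) hs
    (by linarith)
  obtain ⟨w, hw1, hw2⟩ := exists_rat_num_den (a := y.num - b) (q := d - s) (u := d)
    (v := -y.num) (by linarith) (by linarith)
  refine ⟨z, w, ?_, ?_, ?_⟩
  · rw [FareyAdj, hz1, hz2, ← hd_def]; linarith
  · rw [FareyAdj, hw1, hw2, ← hd_def]; linarith
  · omega

theorem exists_fareyAdj_right (r : ℚ) : ∃ v : ℕ → ℚ, (∀ m, FareyAdj r (v m)) ∧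
    (∀ m, FareyAdj (v (m + 1)) (v m)) ∧ ∀ m, m ≤ (v m).den := by
  obtain ⟨u, t, hut⟩ := r.exists_bezout
  have hq := r.int_den_pos
  set q : ℤ := (r.den : ℤ) with hq_def
  obtain ⟨b, s, hs, hbs⟩ : ∃ b s : ℤ, 0 < s ∧ b * q - r.num * s = 1 := by
    refine ⟨t + r.num * (|u| + 1), -u + q * (|u| + 1), ?_, by linear_combination hut⟩
    nlinarith [le_abs_self u, abs_nonneg u]
  have hpos : ∀ m : ℕ, 0 < s + m * q := fun m => by positivity
  choose v hv1 hv2 using fun m : ℕ => exists_rat_num_den (a := b + m * r.num) (q := s + m * q)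
    (u := q) (v := -r.num) (hpos m) (by linear_combination hbs)
  refine ⟨v, fun m => ?_, fun m => ?_, fun m => ?_⟩
  · rw [FareyAdj, hv1, hv2, ← hq_def]; linear_combination hbs
  · rw [FareyAdj, hv1, hv2, hv1, hv2]; push_cast; linear_combination hbs
  · have : (m : ℤ) ≤ (v m).den := by
      rw [hv2]
      nlinarith [Int.natCast_nonneg m]
    exact_mod_cast this

theorem Irrational.exists_fareyAdj {x : ℝ} (hx : Irrational x) (n : ℕ) :
    ∃ u v : ℚ, FareyAdj u v ∧ (u : ℝ) < x ∧ x < v ∧ n ≤ u.den + v.den := by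
  induction n with
  | zero =>
    refine ⟨(⌊x⌋ : ℤ), ((⌊x⌋ + 1 : ℤ) : ℚ), ?_, ?_, ?_, Nat.zero_le _⟩
    · simp only [FareyAdj, Rat.num_intCast, Rat.den_intCast]; push_cast; ring
    · rw [Rat.cast_intCast]
      exact lt_of_le_of_ne (Int.floor_le x) (hx.ne_int _).symm
    · rw [Rat.cast_intCast]; push_cast
      exact Int.lt_floor_add_one x
  | succ n ih =>
    obtain ⟨u, v, huv, hu, hv, hn⟩ := ih
    have e : v.num * u.den - u.num * v.den = 1 := huv
    have hud := u.int_den_pos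
    have hvd := v.int_den_pos
    obtain ⟨w, hw1, hw2⟩ := exists_rat_num_den (a := u.num + v.num) (q := u.den + v.den)
      (u := u.den) (v := -u.num) (by positivity) (by linear_combination e)
    have huw : FareyAdj u w := by rw [FareyAdj, hw1, hw2]; linear_combination e
    have hwv : FareyAdj w v := by rw [FareyAdj, hw1, hw2]; linear_combination e
    rcases lt_or_gt_of_ne (hx.ne_rat w) with h | h
    · exact ⟨u, w, huw, hu, h, by omega⟩
    · exact ⟨w, v, hwv, h, hv, by omega⟩

theorem Irrational.exists_fareyAdj_le_den {x : ℝ} (hx : Irrational x) (n : ℕ) :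
    ∃ u v : ℚ, FareyAdj u v ∧ (u : ℝ) < x ∧ x < v ∧ n ≤ u.den ∧ n ≤ v.den := by
  have h1 := (hx.eventually_forall_le_dist_cast_rat_of_den_le n).filter_mono
    (nhdsWithin_le_nhds (s := Ioi 0))
  obtain ⟨δ, hδ, hδ0⟩ := (h1.and self_mem_nhdsWithin).exists
  obtain ⟨m, hm⟩ := exists_nat_gt (1 / δ)
  obtain ⟨u, v, huv, hu, hv, hn⟩ := hx.exists_fareyAdj (m + 1)
  have hlen : (v : ℝ) - u < δ := by
    have e : (v : ℝ) - u = 1 / ((u.den : ℝ) * v.den) := by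
      have := congrArg (Rat.cast : ℚ → ℝ) huv.sub_eq
      push_cast at this
      exact this
    have hu1 : (1 : ℝ) ≤ u.den := by exact_mod_cast u.den_pos
    have hv1 : (1 : ℝ) ≤ v.den := by exact_mod_cast v.den_pos
    have hmn : (m : ℝ) + 1 ≤ u.den + v.den := by exact_mod_cast hn
    have hlt : 1 / δ < (u.den : ℝ) * v.den := by nlinarith
    rw [e]
    exact (one_div_lt hδ0 (by positivity)).mp hlt
  refine ⟨u, v, huv, hu, hv, ?_, ?_⟩
  · by_contra! hlt
    have := hδ u hlt.le
    rw [Real.dist_eq, abs_of_pos (by linarith)] at this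
    linarith
  · by_contra! hlt
    have := hδ v hlt.le
    rw [Real.dist_eq, abs_of_neg (by linarith)] at this
    linarith

theorem comap_ratCast_nhds_neBot (x : ℝ) : (comap ((↑) : ℚ → ℝ) (𝓝 x)).NeBot :=
  (Rat.isDenseEmbedding_coe_real.toIsDenseInducing).comap_nhds_neBot x

section Oscillation

variable {E : Type*} [SeminormedAddCommGroup E] {φ : ℚ → E} {C σ : ℝ}

theorem FareyAdj.exists_endpoint_norm_sub_le (hσ : 0 < σ) (hC : 0 < C)
    (hφ : ∀ z y, FareyAdj z y → ‖φ y - φ z‖ ≤ C * ((min z.den y.den : ℕ) : ℝ) ^ (-σ))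
    {u v : ℚ} (huv : FareyAdj u v) (n : ℕ) :
    ∀ y : ℚ, y.den = n → u ≤ y → y ≤ v → ∃ w, (w = u ∨ w = v) ∧
      ‖φ y - φ w‖ ≤ C / (1 - 2 ^ (-σ)) * ((w.den : ℝ) ^ (-σ) - (y.den : ℝ) ^ (-σ)) := by
  have h2 : (2 : ℝ) ^ (-σ) < 1 :=
    Real.rpow_lt_one_of_one_lt_of_neg one_lt_two (neg_lt_zero.mpr hσ)
  have h2' : 0 < 1 - (2 : ℝ) ^ (-σ) := by linarith
  induction n using Nat.strong_induction_on with
  | _ n ih =>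
    intro y hn huy hyv
    rcases huy.eq_or_lt with rfl | huy
    · exact ⟨u, Or.inl rfl, by simp⟩
    rcases hyv.eq_or_lt with rfl | hyv
    · exact ⟨y, Or.inr rfl, by simp⟩
    have hden := huv.den_add_den_le huy hyv
    have hu0 := u.den_pos
    have hv0 := v.den_pos
    obtain ⟨z, w, hzy, hyw, hzw⟩ := exists_fareyAdj_parents (y := y) (by omega)
    have hz0 := z.den_pos
    have hw0 := w.den_pos
    have huz : u ≤ z := by
      by_contra! hlt
      have := hzy.den_add_den_le hlt huy
      omega
    have hwv : w ≤ v := by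
      by_contra! hlt
      have := hyw.den_add_den_le hyv hlt
      omega
    obtain ⟨p, hup, hpv, hp2, hp⟩ : ∃ p : ℚ, u ≤ p ∧ p ≤ v ∧ 2 * p.den ≤ y.den ∧
        ‖φ y - φ p‖ ≤ C * (p.den : ℝ) ^ (-σ) := by
      rcases le_total z.den w.den with hle | hle
      · refine ⟨z, huz, hzy.lt.le.trans hyv.le, by omega, ?_⟩
        have := hφ z y hzy
        rwa [min_eq_left (by omega)] at this
      · refine ⟨w, huy.le.trans hyw.lt.le, hwv, by omega, ?_⟩
        have := hφ y w hyw
        rwa [min_eq_right (by omega), norm_sub_rev] at this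
    have hp0 := p.den_pos
    obtain ⟨e, he, hbound⟩ := ih p.den (by omega) p rfl hup hpv
    refine ⟨e, he, ?_⟩
    have hp0' : (0 : ℝ) < p.den := by exact_mod_cast hp0
    have hdecay : (y.den : ℝ) ^ (-σ) ≤ 2 ^ (-σ) * (p.den : ℝ) ^ (-σ) := by
      rw [← Real.mul_rpow (by norm_num) hp0'.le]
      exact Real.rpow_le_rpow_of_nonpos (by positivity) (by exact_mod_cast hp2) (by linarith)
    have hstep : C * (p.den : ℝ) ^ (-σ) ≤
        C / (1 - 2 ^ (-σ)) * ((p.den : ℝ) ^ (-σ) - (y.den : ℝ) ^ (-σ)) := by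
      rw [div_mul_eq_mul_div, le_div_iff₀ h2', mul_assoc]
      apply mul_le_mul_of_nonneg_left _ hC.le
      linarith
    calc ‖φ y - φ e‖ ≤ ‖φ y - φ p‖ + ‖φ p - φ e‖ := norm_sub_le_norm_sub_add_norm_sub _ _ _
      _ ≤ _ := by linarith

theorem exists_oscillation_bound (hσ : 0 < σ) (hC : 0 < C)
    (hφ : ∀ z y, FareyAdj z y → ‖φ y - φ z‖ ≤ C * ((min z.den y.den : ℕ) : ℝ) ^ (-σ)) :
    ∃ K : ℝ, ∀ u v : ℚ, FareyAdj u v → ∀ n : ℕ, 0 < n → n ≤ u.den → n ≤ v.den →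
      ∀ y ∈ Icc u v, ∀ y' ∈ Icc u v, ‖φ y - φ y'‖ ≤ K * (n : ℝ) ^ (-σ) := by
  have h2 : (2 : ℝ) ^ (-σ) < 1 :=
    Real.rpow_lt_one_of_one_lt_of_neg one_lt_two (neg_lt_zero.mpr hσ)
  have h2' : 0 < 1 - (2 : ℝ) ^ (-σ) := by linarith
  set K₀ := C / (1 - 2 ^ (-σ)) with hK₀
  have hK₀pos : 0 < K₀ := div_pos hC h2'
  refine ⟨K₀ + C + K₀, fun u v huv n hn hnu hnv y hy y' hy' => ?_⟩
  have hn' : (0 : ℝ) < n := by exact_mod_cast hn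
  have mono : ∀ m : ℕ, n ≤ m → (m : ℝ) ^ (-σ) ≤ (n : ℝ) ^ (-σ) := fun m hm =>
    Real.rpow_le_rpow_of_nonpos hn' (by exact_mod_cast hm) (by linarith)
  have hend : ‖φ v - φ u‖ ≤ C * (n : ℝ) ^ (-σ) :=
    (hφ u v huv).trans (mul_le_mul_of_nonneg_left (mono _ (le_min hnu hnv)) hC.le)
  have hnear : ∀ y ∈ Icc u v, ∃ w, (w = u ∨ w = v) ∧ ‖φ y - φ w‖ ≤ K₀ * (n : ℝ) ^ (-σ) := by
    intro y hy
    obtain ⟨w, hw, hb⟩ := huv.exists_endpoint_norm_sub_le hσ hC hφ y.den y rfl hy.1 hy.2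
    refine ⟨w, hw, hb.trans (mul_le_mul_of_nonneg_left ?_ hK₀pos.le)⟩
    have hw' : n ≤ w.den := by rcases hw with rfl | rfl <;> assumption
    have := mono _ hw'
    have : 0 ≤ (y.den : ℝ) ^ (-σ) := by positivity
    linarith
  obtain ⟨w, hw, hb⟩ := hnear y hy
  obtain ⟨w', hw', hb'⟩ := hnear y' hy'
  have hww : ‖φ w - φ w'‖ ≤ C * (n : ℝ) ^ (-σ) := by
    have : 0 ≤ C * (n : ℝ) ^ (-σ) := by positivity
    rcases hw with rfl | rfl <;> rcases hw' with rfl | rfl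
    · simpa using this
    · rwa [norm_sub_rev]
    · exact hend
    · simpa using this
  rw [norm_sub_rev] at hb'
  calc ‖φ y - φ y'‖ ≤ ‖φ y - φ w‖ + ‖φ w - φ y'‖ := norm_sub_le_norm_sub_add_norm_sub _ _ _
    _ ≤ ‖φ y - φ w‖ + (‖φ w - φ w'‖ + ‖φ w' - φ y'‖) := by
      gcongr; exact norm_sub_le_norm_sub_add_norm_sub _ _ _
    _ ≤ _ := by linarith

theorem exists_mul_rpow_neg_le (hσ : 0 < σ) (K : ℝ) {ε : ℝ} (hε : 0 < ε) :
    ∃ N : ℕ, ∀ n ≥ N, K * (n : ℝ) ^ (-σ) ≤ ε := by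
  have ht : Tendsto (fun n : ℕ => K * (n : ℝ) ^ (-σ)) atTop (𝓝 (K * 0)) :=
    ((tendsto_rpow_neg_atTop hσ).comp tendsto_natCast_atTop_atTop).const_mul K
  rw [mul_zero] at ht
  exact eventually_atTop.mp ((ht.eventually_lt_const hε).mono fun _ h => h.le)

theorem cauchy_map_comap_nhds_of_irrational (hσ : 0 < σ) (hC : 0 < C)
    (hφ : ∀ z y, FareyAdj z y → ‖φ y - φ z‖ ≤ C * ((min z.den y.den : ℕ) : ℝ) ^ (-σ))
    {x : ℝ} (hx : Irrational x) : Cauchy (map φ (comap ((↑) : ℚ → ℝ) (𝓝 x))) := by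
  obtain ⟨K, hK⟩ := exists_oscillation_bound hσ hC hφ
  have : (comap ((↑) : ℚ → ℝ) (𝓝 x)).NeBot := comap_ratCast_nhds_neBot x
  refine Metric.cauchy_iff.mpr ⟨inferInstance, fun ε hε => ?_⟩
  obtain ⟨N, hN⟩ := exists_mul_rpow_neg_le hσ K (half_pos hε)
  obtain ⟨u, v, huv, hu, hv, hnu, hnv⟩ := hx.exists_fareyAdj_le_den (N + 1)
  refine ⟨φ '' Icc u v, image_mem_map ?_, ?_⟩
  · refine mem_comap.mpr ⟨Icc (u : ℝ) v, Icc_mem_nhds hu hv, fun y hy => ?_⟩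
    exact ⟨by exact_mod_cast hy.1, by exact_mod_cast hy.2⟩
  · rintro _ ⟨y, hy, rfl⟩ _ ⟨y', hy', rfl⟩
    rw [dist_eq_norm]
    have := hK u v huv (N + 1) N.succ_pos hnu hnv y hy y' hy'
    have := hN (N + 1) N.le_succ
    linarith

theorem exists_right_nhd_norm_sub_le (hσ : 0 < σ) (hC : 0 < C)
    (hφ : ∀ z y, FareyAdj z y → ‖φ y - φ z‖ ≤ C * ((min z.den y.den : ℕ) : ℝ) ^ (-σ))
    {r : ℚ} (hr : ∀ ε > 0, ∃ M : ℕ, ∀ v, FareyAdj r v → M ≤ v.den → ‖φ v - φ r‖ ≤ ε)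
    {ε : ℝ} (hε : 0 < ε) : ∃ b > r, ∀ y, r ≤ y → y < b → ‖φ y - φ r‖ ≤ ε := by
  obtain ⟨K, hK⟩ := exists_oscillation_bound hσ hC hφ
  obtain ⟨M, hM⟩ := hr (ε / 2) (half_pos hε)
  obtain ⟨N, hN⟩ := exists_mul_rpow_neg_le hσ K (half_pos hε)
  obtain ⟨v, hrv, hvv, hden⟩ := exists_fareyAdj_right r
  have hanti : Antitone v := antitone_nat_of_succ_le fun m => (hvv m).lt.le
  refine ⟨v (max M N + 1), (hrv _).lt, fun y hry hy => ?_⟩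
  rcases hry.eq_or_lt with rfl | hry
  · simpa using hε.le
  classical
  have hex : ∃ j, v j ≤ y := by
    obtain ⟨j, hj⟩ := exists_nat_gt (1 / (y - r))
    refine ⟨j, ?_⟩
    have e := (hrv j).sub_eq
    have hd0 : (1 : ℚ) ≤ r.den := by exact_mod_cast r.den_pos
    have hd1 : (j : ℚ) ≤ (v j).den := by exact_mod_cast hden j
    have hpos : 0 < 1 / (y - r) := by
      have : 0 < y - r := by linarith
      positivity
    have hlt : 1 / (y - r) < (r.den : ℚ) * (v j).den := by nlinarith
    have := (one_div_lt (by linarith) (hpos.trans hlt)).mp hlt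
    linarith
  obtain ⟨m, hm⟩ : ∃ m, Nat.find hex = m + 1 := by
    refine Nat.exists_eq_succ_of_ne_zero fun h0 => ?_
    have h1 := Nat.find_spec hex
    rw [h0] at h1
    exact absurd (h1.trans_lt hy) (not_lt.mpr (hanti (Nat.zero_le _)))
  have h1 : v (m + 1) ≤ y := hm ▸ Nat.find_spec hex
  have h2 : y < v m := not_le.mp (Nat.find_min hex (by omega))
  have hmn : max M N + 1 ≤ m := by
    by_contra! hlt
    exact absurd (h1.trans_lt hy) (not_lt.mpr (hanti hlt))
  have hmm := hden m
  have hmm' := hden (m + 1)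
  have b1 := hK _ _ (hvv m) m (by omega) (by omega) hmm y ⟨h1, h2.le⟩ (v m)
    ⟨(hvv m).lt.le, le_rfl⟩
  have b2 := hN m (by omega)
  have b3 := hM (v m) (hrv m) (by omega)
  calc ‖φ y - φ r‖ ≤ ‖φ y - φ (v m)‖ + ‖φ (v m) - φ r‖ :=
        norm_sub_le_norm_sub_add_norm_sub _ _ _
    _ ≤ ε := by linarith

theorem FareyAdj.neg {z y : ℚ} (hzy : FareyAdj z y) : FareyAdj (-y) (-z) := by
  have e : y.num * z.den - z.num * y.den = 1 := hzy
  rw [FareyAdj, Rat.neg_num, Rat.neg_num, Rat.den_neg_eq_den, Rat.den_neg_eq_den]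
  linarith

theorem tendsto_comap_nhds_ratCast (hσ : 0 < σ) (hC : 0 < C)
    (hφ : ∀ z y, FareyAdj z y → ‖φ y - φ z‖ ≤ C * ((min z.den y.den : ℕ) : ℝ) ^ (-σ))
    {r : ℚ} (hr : ∀ ε > 0, ∃ M : ℕ, ∀ v, FareyAdj r v ∨ FareyAdj v r → M ≤ v.den →
      ‖φ v - φ r‖ ≤ ε) :
    Tendsto φ (comap ((↑) : ℚ → ℝ) (𝓝 (r : ℝ))) (𝓝 (φ r)) := by
  refine Metric.nhds_basis_closedBall.tendsto_right_iff.mpr fun ε hε => ?_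
  obtain ⟨b, hb, hb'⟩ := exists_right_nhd_norm_sub_le hσ hC hφ (r := r)
    (fun ε hε => (hr ε hε).imp fun M hM v hv => hM v (Or.inl hv)) hε
  obtain ⟨a, ha, ha'⟩ := exists_right_nhd_norm_sub_le (φ := fun y => φ (-y)) (r := -r) hσ hC
    (fun z y hzy => by
      have := hφ _ _ hzy.neg
      rwa [Rat.den_neg_eq_den, Rat.den_neg_eq_den, min_comm, norm_sub_rev] at this)
    (fun ε hε => (hr ε hε).imp fun M hM v hv hMv => by
      have := hM (-v) (Or.inr (by simpa using hv.neg)) (by rwa [Rat.den_neg_eq_den])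
      simpa using this) hε
  have ha0 : ((-a : ℚ) : ℝ) < r := by exact_mod_cast neg_lt.mp ha
  have hb0 : (r : ℝ) < b := by exact_mod_cast hb
  refine mem_comap.mpr ⟨Ioo ((-a : ℚ) : ℝ) b, Ioo_mem_nhds ha0 hb0, fun y hy => ?_⟩
  have hy1 : -a < y := by exact_mod_cast hy.1
  have hy2 : y < b := by exact_mod_cast hy.2
  simp only [mem_ofPred_eq, Metric.mem_closedBall, dist_eq_norm]
  rcases le_total r y with h | h
  · exact hb' y h hy2
  · simpa using ha' (-y) (neg_le_neg h) (by linarith)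

end Oscillation

theorem continuousAt_of_tendsto_comap_ratCast {E : Type*} [PseudoMetricSpace E] {F : ℝ → E}
    (hF : ∀ x, Irrational x →
      Tendsto (fun y : ℚ => F y) (comap ((↑) : ℚ → ℝ) (𝓝 x)) (𝓝 (F x)))
    {x : ℝ} (hx : Tendsto (fun y : ℚ => F y) (comap ((↑) : ℚ → ℝ) (𝓝 x)) (𝓝 (F x))) :
    ContinuousAt F x := by
  refine Metric.nhds_basis_closedBall.tendsto_right_iff.mpr fun ε hε => ?_
  obtain ⟨V, hV, hVsub⟩ := mem_comap.mp (hx (Metric.closedBall_mem_nhds _ hε))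
  obtain ⟨U, hUV, hUo, hxU⟩ := mem_nhds_iff.mp hV
  filter_upwards [hUo.mem_nhds hxU] with t ht
  by_cases hirr : Irrational t
  · have : (comap ((↑) : ℚ → ℝ) (𝓝 t)).NeBot := comap_ratCast_nhds_neBot t
    refine Metric.isClosed_closedBall.mem_of_tendsto (hF t hirr) ?_
    filter_upwards [preimage_mem_comap (hUo.mem_nhds ht)] with y hy
    exact hVsub (hUV hy)
  · obtain ⟨y, rfl⟩ := not_not.mp hirr
    exact hVsub (hUV ht)

section Reciprocity

variable {k : ℂ} {f : ℚ → ℂ} {h : ℝ → ℂ}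

theorem apply_add_intCast_of_periodic_one (hper : ∀ x : ℚ, f (x + 1) = f x) (x : ℚ) (n : ℤ) :
    f (x + n) = f x := by
  simpa using (Function.Periodic.int_mul hper n) x

theorem exists_ratBar_eq (y : ℚ) :
    ∃ e : ℤ, ratBar y = e / y.den ∧ (y.den : ℤ) ∣ y.num * e - 1 := by
  have hcop : IsUnit (y.num : ZMod y.den) := by
    obtain ⟨u, v, huv⟩ := y.exists_bezout
    refine IsUnit.of_mul_eq_one (u : ZMod y.den) ?_
    have := congrArg (Int.cast : ℤ → ZMod y.den) huv
    push_cast at this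
    rw [ZMod.natCast_self, mul_zero, add_zero] at this
    rwa [mul_comm]
  have : NeZero y.den := ⟨y.den_nz⟩
  have hinv : (y.num : ZMod y.den) * (y.num : ZMod y.den)⁻¹ = 1 := ZMod.mul_inv_of_unit _ hcop
  set i := (y.num : ZMod y.den)⁻¹ with hi
  have hcast : ((i.val : ℕ) : ZMod y.den) = i := ZMod.natCast_zmod_val i
  by_cases h0 : i.val = 0
  · refine ⟨y.den, by simp [ratBar, ← hi, h0], ?_⟩
    rw [← ZMod.intCast_zmod_eq_zero_iff_dvd]
    push_cast
    rw [h0, Nat.cast_zero] at hcast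
    rw [ZMod.natCast_self, mul_zero, ← hinv, ← hcast, mul_zero, sub_self]
  · refine ⟨i.val, by simp [ratBar, ← hi, h0], ?_⟩
    rw [← ZMod.intCast_zmod_eq_zero_iff_dvd]
    push_cast
    rw [hcast, hinv, sub_self]

theorem apply_ratBar_of_dvd (hper : ∀ x : ℚ, f (x + 1) = f x) (y : ℚ) {t : ℤ}
    (ht : (y.den : ℤ) ∣ y.num * t - 1) : f (ratBar y) = f (t / y.den) := by
  obtain ⟨e, he, hed⟩ := exists_ratBar_eq y
  obtain ⟨c, hc⟩ : (y.den : ℤ) ∣ e - t := by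
    have hcop : IsCoprime (y.den : ℤ) y.num := by
      obtain ⟨u, v, huv⟩ := y.exists_bezout
      exact ⟨v, u, by linarith⟩
    refine hcop.dvd_of_dvd_mul_left ?_
    have := dvd_sub hed ht
    rwa [show y.num * e - 1 - (y.num * t - 1) = y.num * (e - t) by ring] at this
  have hd : (y.den : ℚ) ≠ 0 := by exact_mod_cast y.den_nz
  have hec : (e : ℚ) = t + y.den * c := by
    have : e = t + y.den * c := by linarith
    exact_mod_cast this
  rw [he, hec, add_div, mul_div_cancel_left₀ _ hd, apply_add_intCast_of_periodic_one hper]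

theorem cpow_mul_div_cpow {q s : ℝ} (hq : 0 < q) (hs : 0 < s) (k : ℂ) :
    (q : ℂ) ^ k * ((s / q : ℝ) : ℂ) ^ k = (s : ℂ) ^ k := by
  rw [← Complex.mul_cpow_ofReal_nonneg hq.le (div_pos hs hq).le, ← Complex.ofReal_mul,
    mul_div_cancel₀ _ hq.ne']

/-- The renormalized function `f‡` on the rationals. -/
noncomputable def ratDagger (k : ℂ) (f : ℚ → ℂ) (y : ℚ) : ℂ :=
  ((y.den : ℝ) : ℂ) ^ (-k) * f (ratBar y)

theorem den_cpow_mul_reciprocity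
    (hrec : ∀ x : ℚ, x ≠ 0 → f x - ((|((x : ℚ) : ℝ)| : ℝ) : ℂ) ^ (-k) * f (-1 / x) = h x)
    (y z : ℚ) {x : ℚ} (hx0 : x ≠ 0) (hx : |x| = z.den / y.den) (hy : f (ratBar y) = f x)
    (hz : f (ratBar z) = f (-1 / x)) :
    ratDagger k f y - ratDagger k f z = ((y.den : ℝ) : ℂ) ^ (-k) * h x := by
  have hy0 : (0 : ℝ) < y.den := by exact_mod_cast y.den_pos
  have hz0 : (0 : ℝ) < z.den := by exact_mod_cast z.den_pos
  have hx' : |(x : ℝ)| = z.den / y.den := by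
    have := congrArg (Rat.cast : ℚ → ℝ) hx
    push_cast at this ⊢
    exact this
  rw [ratDagger, ratDagger, hy, hz, ← hrec x hx0, hx', ← cpow_mul_div_cpow hy0 hz0]
  ring

/-- The values of `f‡` at neighbouring fractions differ by a single value of `h`. -/
theorem exists_ratDagger_sub_eq (hper : ∀ x : ℚ, f (x + 1) = f x)
    (hrec : ∀ x : ℚ, x ≠ 0 → f x - ((|((x : ℚ) : ℝ)| : ℝ) : ℂ) ^ (-k) * f (-1 / x) = h x)
    {y z : ℚ} (hyz : FareyAdj z y ∨ FareyAdj y z) :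
    ∃ x : ℝ, |x| = z.den / y.den ∧
      ratDagger k f y - ratDagger k f z = ((y.den : ℝ) : ℂ) ^ (-k) * h x := by
  have hy0 : (0 : ℚ) < y.den := by exact_mod_cast y.den_pos
  have hz0 : (0 : ℚ) < z.den := by exact_mod_cast z.den_pos
  rcases hyz with e | e <;> rw [FareyAdj] at e
  · have hx : |(z.den / y.den : ℚ)| = z.den / y.den := abs_of_pos (by positivity)
    refine ⟨(z.den / y.den : ℚ), by
    have := congrArg (Rat.cast : ℚ → ℝ) hx
    push_cast at this ⊢
    exact this,
      den_cpow_mul_reciprocity hrec y z (by positivity) hx ?_ ?_⟩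
    · rw [apply_ratBar_of_dvd hper y (t := z.den) ⟨z.num, by linarith⟩, Int.cast_natCast]
    · rw [apply_ratBar_of_dvd hper z (t := -y.den) ⟨-y.num, by linarith⟩]
      congr 1
      push_cast
      field_simp
  · have hx : |(-(z.den / y.den) : ℚ)| = z.den / y.den := by
      rw [abs_neg]; exact abs_of_pos (by positivity)
    refine ⟨(-(z.den / y.den) : ℚ), by
    have := congrArg (Rat.cast : ℚ → ℝ) hx
    push_cast at this ⊢
    exact this,
      den_cpow_mul_reciprocity hrec y z (neg_ne_zero.mpr (by positivity)) hx ?_ ?_⟩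
    · rw [apply_ratBar_of_dvd hper y (t := -z.den) ⟨-z.num, by linarith⟩]
      congr 1
      push_cast
      ring
    · rw [apply_ratBar_of_dvd hper z (t := y.den) ⟨y.num, by linarith⟩]
      congr 1
      push_cast
      field_simp

theorem norm_ratDagger_sub_le (hper : ∀ x : ℚ, f (x + 1) = f x)
    (hrec : ∀ x : ℚ, x ≠ 0 → f x - ((|((x : ℚ) : ℝ)| : ℝ) : ℂ) ^ (-k) * f (-1 / x) = h x)
    {y z : ℚ} (hyz : FareyAdj z y ∨ FareyAdj y z) {A : ℝ}
    (hA : ∀ x : ℝ, |x| = z.den / y.den → ‖h x‖ ≤ A * |x| ^ (-k.re)) :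
    ‖ratDagger k f y - ratDagger k f z‖ ≤ A * (z.den : ℝ) ^ (-k.re) := by
  have hy0 : (0 : ℝ) < y.den := by exact_mod_cast y.den_pos
  have hz0 : (0 : ℝ) < z.den := by exact_mod_cast z.den_pos
  obtain ⟨x, hx, e⟩ := exists_ratDagger_sub_eq hper hrec hyz
  rw [e, norm_mul, Complex.norm_cpow_eq_rpow_re_of_pos hy0, Complex.neg_re]
  calc (y.den : ℝ) ^ (-k.re) * ‖h x‖
      ≤ (y.den : ℝ) ^ (-k.re) * (A * (z.den / y.den : ℝ) ^ (-k.re)) := by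
        gcongr; exact hx ▸ hA x hx
    _ = A * (z.den : ℝ) ^ (-k.re) := by
        rw [mul_left_comm, ← Real.mul_rpow hy0.le (by positivity), mul_div_cancel₀ _ hy0.ne']

end Reciprocity

/-- For `Re k > 0`, the renormalized function
`f‡(a/q) = q^{-k} f(ā/q)` extends continuously to the irrationals, and to all of `ℝ`
if `h(x)|x|^{Re k} → 0` as `x → 0`. -/
theorem stmt5 (k : ℂ) (hk : 0 < k.re) (f : ℚ → ℂ) (h : ℝ → ℂ)
    (hper : ∀ x : ℚ, f (x + 1) = f x)
    (hrec : ∀ x : ℚ, x ≠ 0 →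
      f x - ((|((x : ℚ) : ℝ)| : ℝ) : ℂ) ^ (-k) * f (-1 / x) = h x)
    (C : ℝ) (hC : 0 < C)
    (hbound : ∀ x : ℝ, x ≠ 0 → |x| ≤ 1 → ‖h x‖ ≤ C * |x| ^ (-k.re)) :
    ∃ fdd : ℝ → ℂ,
      -- `fdd` is the function `f‡` on the rationals
      (∀ y : ℚ, fdd (y : ℝ) = ((y.den : ℝ) : ℂ) ^ (-k) * f (ratBar y)) ∧
      -- (a) at every irrational point the limit defining `f‡` exists,
      -- and `f‡` is continuous there
      (∀ x : ℝ, Irrational x →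
        Tendsto (fun y : ℚ => ((y.den : ℝ) : ℂ) ^ (-k) * f (ratBar y))
          (Filter.comap ((↑) : ℚ → ℝ) (nhds x)) (nhds (fdd x)) ∧
        ContinuousAt fdd x) ∧
      -- (b) if `h(x)·|x|^{Re k} → 0` as `x → 0`, then `f‡` is continuous on `ℝ`
      (Tendsto (fun x : ℝ => h x * ((|x| ^ k.re : ℝ) : ℂ))
          (nhdsWithin 0 {(0 : ℝ)}ᶜ) (nhds 0) → Continuous fdd) := by
  have hφ : ∀ z y, FareyAdj z y → ‖ratDagger k f y - ratDagger k f z‖ ≤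
      C * ((min z.den y.den : ℕ) : ℝ) ^ (-k.re) := by
    have hA : ∀ y z : ℚ, z.den ≤ y.den → ∀ x : ℝ, |x| = z.den / y.den →
        ‖h x‖ ≤ C * |x| ^ (-k.re) := by
      intro y z hzy x hx
      have hy0 : (0 : ℝ) < y.den := by exact_mod_cast y.den_pos
      have hz0 : (0 : ℝ) < z.den := by exact_mod_cast z.den_pos
      refine hbound x (abs_pos.mp (by rw [hx]; positivity)) ?_
      rw [hx, div_le_one hy0]
      exact_mod_cast hzy
    intro z y hzy
    rcases le_total z.den y.den with hle | hle
    · rw [min_eq_left hle]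
      exact norm_ratDagger_sub_le hper hrec (Or.inl hzy) (hA y z hle)
    · rw [min_eq_right hle, norm_sub_rev]
      exact norm_ratDagger_sub_le hper hrec (Or.inr hzy) (hA z y hle)
  have hinj : Function.Injective ((↑) : ℚ → ℝ) := Rat.cast_injective
  set F : ℝ → ℂ := Function.extend ((↑) : ℚ → ℝ) (ratDagger k f)
    fun x => lim (map (ratDagger k f) (comap ((↑) : ℚ → ℝ) (𝓝 x))) with hF
  have hFrat : ∀ y : ℚ, F y = ratDagger k f y := fun y => hinj.extend_apply _ _ y
  have hFirr : ∀ x, Irrational x →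
      Tendsto (ratDagger k f) (comap ((↑) : ℚ → ℝ) (𝓝 x)) (𝓝 (F x)) := by
    intro x hx
    have hlim := (cauchy_map_comap_nhds_of_irrational hk hC hφ hx).le_nhds_lim
    rwa [hF, Function.extend_apply' _ _ _ hx]
  have hFirr' : ∀ x, Irrational x →
      Tendsto (fun y : ℚ => F y) (comap ((↑) : ℚ → ℝ) (𝓝 x)) (𝓝 (F x)) := by
    simpa only [hFrat] using hFirr
  refine ⟨F, hFrat, fun x hx => ⟨hFirr x hx,
    continuousAt_of_tendsto_comap_ratCast hFirr' (hFirr' x hx)⟩, fun hlim => ?_⟩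
  refine continuous_iff_continuousAt.mpr fun x =>
    continuousAt_of_tendsto_comap_ratCast hFirr' ?_
  by_cases hx : Irrational x
  · exact hFirr' x hx
  obtain ⟨r, rfl⟩ := not_not.mp hx
  simp only [hFrat]
  refine tendsto_comap_nhds_ratCast hk hC hφ fun ε hε => ?_
  obtain ⟨δ, hδ, hsmall⟩ := Metric.tendsto_nhdsWithin_nhds.mp hlim ε hε
  obtain ⟨M, hM⟩ := exists_nat_gt (r.den / δ)
  refine ⟨M, fun v hv hMv => ?_⟩
  have hr1 : (1 : ℝ) ≤ r.den := by exact_mod_cast r.den_pos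
  have hv0 : (0 : ℝ) < v.den := by exact_mod_cast v.den_pos
  have hMv' : (M : ℝ) ≤ v.den := by exact_mod_cast hMv
  refine (norm_ratDagger_sub_le hper hrec hv (A := ε) fun x hx => ?_).trans
    (mul_le_of_le_one_right hε.le (Real.rpow_le_one_of_one_le_of_nonpos hr1 (by linarith)))
  have hx0 : 0 < |x| := by rw [hx]; positivity
  have hxδ : |x| < δ := by
    rw [hx, div_lt_comm₀ hv0 hδ]
    linarith
  have := hsmall (x := x) (abs_pos.mp hx0) (by simpa using hxδ)
  rw [dist_zero_right, norm_mul, Complex.norm_real, Real.norm_of_nonneg (by positivity)] at this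
  rw [Real.rpow_neg hx0.le, ← div_eq_mul_inv, le_div_iff₀ (by positivity)]
  exact this.le
end

section
/- Let k ∈ ℂ with Re(k) > 0, and let f : ℚ → ℂ be 1-periodic and satisfy f(x) − |x|^{−k}·f(−1/x) = h(x) for all x ∈ ℚ\{0}, where h : ℝ\{0} → ℂ satisfies |h(x)| ≤ C·|x|^{−Re(k)} for all 0 < |x| ≤ 1 and some C > 0. Let f‡ : ℝ → ℂ be defined by f‡(x) := den(x)^{−k}·f(x̄) for x ∈ ℚ and f‡(x) := lim_{ℚ∋y→x} f‡(y) for irrational x (this limit exists). Then there is a set X ⊆ ℝ of full Lebesgue measure such that for every x ∈ X and every real α < Re(k)/2, f‡ is α-Hölder continuous at x: there exist constants C', ρ > 0 with |f‡(y) − f‡(x)| ≤ C'·|y − x|^α for all y with |y − x| < ρ. In particular, if Re(k) > 2 then f‡ is differentiable at Lebesgue-almost every x ∈ ℝ with derivative 0. -/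
open Filter Topology MeasureTheory Set

/-- A 1-periodic function on `ℚ` is invariant under integer translations. -/
theorem periodic_ratBar {f : ℚ → ℂ} (hper : ∀ x : ℚ, f (x + 1) = f x) (y : ℚ) (c : ℤ)
    (hc : (y.den : ℤ) ∣ y.num * c - 1) : f (ratBar y) = f (c / y.den) := by
  have hp : Function.Periodic f 1 := hper
  have hd : (y.den : ℚ) ≠ 0 := by exact_mod_cast y.den_ne_zero
  have : NeZero y.den := ⟨y.den_ne_zero⟩
  have h1 : (y.num : ZMod y.den) * (c : ZMod y.den) = 1 := by
    have := (ZMod.intCast_zmod_eq_zero_iff_dvd (y.num * c - 1) y.den).2 hc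
    push_cast at this
    exact sub_eq_zero.1 this
  have h2 : ((y.num : ZMod y.den))⁻¹ = c := ZMod.inv_eq_of_mul_eq_one _ _ _ h1
  obtain ⟨e, he, hbar⟩ : ∃ e : ℤ, ((e : ZMod y.den) = c) ∧ ratBar y = e / y.den := by
    unfold ratBar
    split_ifs with h0
    · refine ⟨y.den, ?_, by push_cast; rfl⟩
      rw [ZMod.val_eq_zero, h2] at h0
      simp [h0]
    · refine ⟨((y.num : ZMod y.den)⁻¹).val, ?_, by push_cast; rfl⟩
      simp [h2]
  obtain ⟨t, ht⟩ := (ZMod.intCast_eq_intCast_iff_dvd_sub e c y.den).1 he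
  have : (c : ℚ) / y.den = ratBar y + t * 1 := by
    rw [hbar]
    have : (c : ℚ) - e = y.den * t := by exact_mod_cast ht
    field_simp
    linarith
  rw [this]
  exact (hp.int_mul t (ratBar y)).symm

/-- Reciprocity at Farey neighbours. -/
theorem norm_sub_le_of_farey_neighbours {k : ℂ} {f : ℚ → ℂ} {h : ℝ → ℂ}
    (hper : ∀ x : ℚ, f (x + 1) = f x)
    (hrec : ∀ x : ℚ, x ≠ 0 →
      f x - ((|((x : ℚ) : ℝ)| : ℝ) : ℂ) ^ (-k) * f (-1 / x) = h x)
    {C : ℝ} (hbound : ∀ x : ℝ, x ≠ 0 → |x| ≤ 1 → ‖h x‖ ≤ C * |x| ^ (-k.re))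
    {fdd : ℝ → ℂ}
    (hval : ∀ y : ℚ, fdd (y : ℝ) = ((y.den : ℝ) : ℂ) ^ (-k) * f (ratBar y))
    (y z : ℚ) (hyz : |y.num * z.den - z.num * y.den| = 1) (hle : z.den ≤ y.den) :
    ‖fdd y - fdd z‖ ≤ C * (z.den : ℝ) ^ (-k.re) := by
  obtain ⟨s, hs, hs2⟩ : ∃ s : ℤ, |s| = 1 ∧ y.num * z.den - z.num * y.den = s := ⟨_, hyz, rfl⟩
  have hss : s * s = 1 := by rw [← abs_mul_abs_self, hs]; rfl
  have hq : (0 : ℚ) < y.den := by exact_mod_cast y.den_pos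
  have hr : (0 : ℚ) < z.den := by exact_mod_cast z.den_pos
  have hqR : (0 : ℝ) < y.den := by exact_mod_cast y.den_pos
  have hrR : (0 : ℝ) < z.den := by exact_mod_cast z.den_pos
  have hsQ : (s : ℚ) * s = 1 := by exact_mod_cast hss
  have hs0 : (s : ℚ) ≠ 0 := by rintro h0; simp [h0] at hsQ
  have e1 : f (ratBar y) = f ((s * z.den : ℤ) / y.den) :=
    periodic_ratBar hper y _ ⟨s * z.num, by linear_combination s * hs2 + hss⟩
  have e2 : f (ratBar z) = f ((-s * y.den : ℤ) / z.den) :=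
    periodic_ratBar hper z _ ⟨- s * y.num, by linear_combination s * hs2 + hss⟩
  set x : ℚ := (s * z.den : ℤ) / y.den with hx
  have hx0 : x ≠ 0 := by rw [hx]; push_cast; positivity
  have hinv : -1 / x = (-s * y.den : ℤ) / z.den := by
    rw [hx]; push_cast; field_simp; linear_combination hsQ
  have habs : |(x : ℝ)| = z.den / y.den := by
    rw [hx]; push_cast
    rw [abs_div, abs_mul, abs_of_pos hqR, abs_of_pos hrR]
    have : |(s : ℝ)| = 1 := by exact_mod_cast hs
    rw [this, one_mul]
  have hmul : ((y.den : ℝ) : ℂ) ^ (-k) * ((|(x : ℝ)| : ℝ) : ℂ) ^ (-k) = ((z.den : ℝ) : ℂ) ^ (-k) := by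
    rw [← Complex.mul_cpow_ofReal_nonneg hqR.le (abs_nonneg _), habs, ← Complex.ofReal_mul,
      mul_div_cancel₀ _ hqR.ne']
  have key : fdd y - fdd z = ((y.den : ℝ) : ℂ) ^ (-k) * h x := by
    rw [hval, hval, e1, e2, ← hrec x hx0, hinv, ← hmul]; ring
  have hle1 : |(x : ℝ)| ≤ 1 := by
    rw [habs, div_le_one hqR]; exact_mod_cast hle
  rw [key, norm_mul, Complex.norm_cpow_eq_rpow_re_of_pos hqR, Complex.neg_re]
  calc (y.den : ℝ) ^ (-k.re) * ‖h x‖ ≤ (y.den : ℝ) ^ (-k.re) * (C * |(x : ℝ)| ^ (-k.re)) := by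
        gcongr
        exact hbound _ (by exact_mod_cast hx0) hle1
    _ = C * (z.den : ℝ) ^ (-k.re) := by
        rw [mul_left_comm, ← Real.mul_rpow hqR.le (abs_nonneg _), habs, mul_div_cancel₀ _ hqR.ne']

/-- Every `a / d` with `d ≥ 2` has a Farey neighbour of denominator at most `d / 2`. -/
theorem exists_farey_neighbour (y : ℚ) (hy : 2 ≤ y.den) :
    ∃ z : ℚ, |y.num * z.den - z.num * y.den| = 1 ∧ 2 * z.den ≤ y.den := by
  have build : ∀ b r : ℤ, 0 < r → |y.num * r - b * y.den| = 1 → 2 * r ≤ y.den →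
      ∃ z : ℚ, |y.num * z.den - z.num * y.den| = 1 ∧ 2 * z.den ≤ y.den := by
    intro b r hr h1 h2
    have hco : IsCoprime b r := by
      rcases (abs_eq zero_le_one).1 h1 with h | h
      · exact ⟨-y.den, y.num, by linarith⟩
      · exact ⟨y.den, -y.num, by linarith⟩
    have hc : Nat.Coprime b.natAbs r.natAbs := Int.isCoprime_iff_gcd_eq_one.1 hco
    refine ⟨b / r, ?_, ?_⟩
    · rw [Rat.num_div_eq_of_coprime hr hc, Rat.den_div_eq_of_coprime hr hc]; exact h1
    · have := Rat.den_div_eq_of_coprime hr hc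
      omega
  have hco : IsCoprime y.num (y.den : ℤ) := Int.isCoprime_iff_gcd_eq_one.2 y.reduced
  obtain ⟨u, v, huv⟩ := hco
  have hd : (0 : ℤ) < y.den := by exact_mod_cast y.den_pos
  have hd2 : (2 : ℤ) ≤ y.den := by exact_mod_cast hy
  have hr0 : 0 ≤ u % y.den := Int.emod_nonneg _ hd.ne'
  have hrlt : u % y.den < y.den := Int.emod_lt_of_pos _ hd
  have hdiv : u % y.den + y.den * (u / y.den) = u := Int.emod_add_mul_ediv _ _
  set r := u % y.den
  set t := u / (y.den : ℤ)
  have hrel : y.num * r - (-(v + y.num * t)) * y.den = 1 := by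
    rw [← huv]; linear_combination y.num * hdiv
  have hrpos : 0 < r := by
    rcases hr0.lt_or_eq with h | h
    · exact h
    · exfalso
      rw [← h] at hrel
      have : (y.den : ℤ) ∣ 1 := ⟨v + y.num * t, by linarith⟩
      have := Int.le_of_dvd one_pos this
      omega
  by_cases h2 : 2 * r ≤ y.den
  · exact build _ r hrpos (by rw [hrel]; rfl) h2
  · refine build (y.num - (-(v + y.num * t))) (y.den - r) (by omega) ?_ (by omega)
    have : y.num * (y.den - r) - (y.num - (-(v + y.num * t))) * y.den = -1 := by
      linear_combination - hrel
    rw [this]; rfl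

/-- A Farey neighbour of smaller denominator stays in any Farey interval. -/
theorem mem_Icc_of_farey_neighbour {L R y z : ℚ} (hLR : R.num * L.den - L.num * R.den = 1)
    (hLy : L < y) (hyR : y < R) (hyz : |y.num * z.den - z.num * y.den| = 1) :
    L ≤ z ∧ z ≤ R := by
  rw [Rat.le_iff, Rat.le_iff]
  rw [Rat.lt_iff] at hLy hyR
  have hq : (0 : ℤ) < L.den := by exact_mod_cast L.den_pos
  have hq' : (0 : ℤ) < R.den := by exact_mod_cast R.den_pos
  have hd : (0 : ℤ) < y.den := by exact_mod_cast y.den_pos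
  have hr : (0 : ℤ) < z.den := by exact_mod_cast z.den_pos
  generalize (L.den : ℤ) = q at *
  generalize (R.den : ℤ) = q' at *
  generalize (y.den : ℤ) = d at *
  generalize (z.den : ℤ) = r at *
  generalize L.num = p at *
  generalize R.num = p' at *
  generalize y.num = a at *
  generalize z.num = b at *
  obtain ⟨u, hu⟩ : ∃ u, u = a * q - p * d := ⟨_, rfl⟩
  obtain ⟨v, hv⟩ : ∃ v, v = p' * d - a * q' := ⟨_, rfl⟩
  have hu1 : 1 ≤ u := by linarith
  have hv1 : 1 ≤ v := by linarith
  have hdu : d = u * q' + v * q := by rw [hu, hv]; linear_combination - d * hLR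
  have hdq : q + q' ≤ d := by nlinarith
  obtain ⟨s, hs⟩ : ∃ s, s = b * q - p * r := ⟨_, rfl⟩
  obtain ⟨t, ht⟩ : ∃ t, t = p' * r - b * q' := ⟨_, rfl⟩
  have hs0 : 0 ≤ s := by
    by_contra! hneg
    have h1 : s * d ≤ -d := by nlinarith
    have h2 : 0 < u * r := by positivity
    rcases (abs_eq zero_le_one).1 hyz with h | h
    · have : s * d = u * r - q := by rw [hs, hu]; linear_combination - q * h
      linarith
    · have : s * d = u * r + q := by rw [hs, hu]; linear_combination - q * h
      linarith
  have ht0 : 0 ≤ t := by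
    by_contra! hneg
    have h1 : t * d ≤ -d := by nlinarith
    have h2 : 0 < v * r := by positivity
    rcases (abs_eq zero_le_one).1 hyz with h | h
    · have : t * d = v * r + q' := by rw [ht, hv]; linear_combination q' * h
      linarith
    · have : t * d = v * r - q' := by rw [ht, hv]; linear_combination q' * h
      linarith
  constructor <;> linarith

theorem two_le_den_of_mem_farey {L R y : ℚ} (hLR : R.num * L.den - L.num * R.den = 1)
    (hLy : L < y) (hyR : y < R) : 2 ≤ y.den := by
  rw [Rat.lt_iff] at hLy hyR
  have hq : (0 : ℤ) < L.den := by exact_mod_cast L.den_pos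
  have hq' : (0 : ℤ) < R.den := by exact_mod_cast R.den_pos
  have hdu : (y.den : ℤ) = (y.num * L.den - L.num * y.den) * R.den
      + (R.num * y.den - y.num * R.den) * L.den := by linear_combination - (y.den : ℤ) * hLR
  have : (2 : ℤ) ≤ y.den := by nlinarith
  exact_mod_cast this

theorem norm_sub_left_le {g : ℝ → ℂ} {C κ : ℝ} (hC : 0 < C) (hκ : 0 < κ)
    (hg : ∀ y z : ℚ, |y.num * z.den - z.num * y.den| = 1 → z.den ≤ y.den →
      ‖g y - g z‖ ≤ C * (z.den : ℝ) ^ (-κ))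
    {L R : ℚ} (hLR : R.num * L.den - L.num * R.den = 1) (y : ℚ) (hLy : L ≤ y) (hyR : y ≤ R) :
    ‖g y - g L‖ ≤ (C + C / (1 - 2 ^ (-κ))) * ((min L.den R.den : ℕ) : ℝ) ^ (-κ) := by
  have h2 : (0 : ℝ) < 1 - 2 ^ (-κ) :=
    sub_pos.2 (Real.rpow_lt_one_of_one_lt_of_neg one_lt_two (neg_lt_zero.2 hκ))
  set A := C / (1 - 2 ^ (-κ)) with hA
  have hA0 : 0 < A := by positivity
  have hM : 0 < min L.den R.den := lt_min L.den_pos R.den_pos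
  set M := min L.den R.den with hMdef
  have hMR : (0 : ℝ) < M := by exact_mod_cast hM
  have mono : ∀ d : ℕ, M ≤ d → (d : ℝ) ^ (-κ) ≤ (M : ℝ) ^ (-κ) := fun d hd =>
    Real.rpow_le_rpow_of_nonpos hMR (by exact_mod_cast hd) (by linarith)
  have main : ∀ n : ℕ, ∀ y : ℚ, y.den = n → L ≤ y → y ≤ R →
      ‖g y - g L‖ ≤ C * (M : ℝ) ^ (-κ) + A * ((M : ℝ) ^ (-κ) - (y.den : ℝ) ^ (-κ)) := by
    intro n
    induction n using Nat.strong_induction_on with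
    | _ n ih =>
      intro y hyn hLy hyR
      rcases hLy.eq_or_lt with rfl | hLy'
      · have := mono L.den (min_le_left _ _)
        rw [sub_self, norm_zero]
        have : 0 ≤ A * ((M : ℝ) ^ (-κ) - (L.den : ℝ) ^ (-κ)) :=
          mul_nonneg hA0.le (sub_nonneg.2 this)
        positivity
      rcases hyR.eq_or_lt with rfl | hyR'
      · have h1 := mono y.den (min_le_right _ _)
        have h3 : 0 ≤ A * ((M : ℝ) ^ (-κ) - (y.den : ℝ) ^ (-κ)) :=
          mul_nonneg hA0.le (sub_nonneg.2 h1)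
        have h4 : ‖g y - g L‖ ≤ C * (M : ℝ) ^ (-κ) := by
          rcases le_total L.den y.den with hle | hle
          · have := hg y L (by rw [hLR]; rfl) hle
            rwa [hMdef, min_eq_left hle]
          · have := hg L y (by rw [abs_sub_comm, hLR]; rfl) hle
            rw [hMdef, min_eq_right hle, norm_sub_rev]
            exact this
        linarith
      obtain ⟨z, hz, hzd⟩ := exists_farey_neighbour y (two_le_den_of_mem_farey hLR hLy' hyR')
      obtain ⟨hLz, hzR⟩ := mem_Icc_of_farey_neighbour hLR hLy' hyR' hz
      have hzpos := z.den_pos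
      have hzR' : (0 : ℝ) < z.den := by exact_mod_cast hzpos
      have h1 := ih z.den (by omega) z rfl hLz hzR
      have h3 := hg y z hz (by omega)
      have h4 : (y.den : ℝ) ^ (-κ) ≤ 2 ^ (-κ) * (z.den : ℝ) ^ (-κ) := by
        rw [← Real.mul_rpow zero_le_two hzR'.le]
        exact Real.rpow_le_rpow_of_nonpos (by positivity) (by exact_mod_cast hzd) (by linarith)
      have h5 : C = A * (1 - 2 ^ (-κ)) := by rw [hA]; field_simp
      have h6 : C * (z.den : ℝ) ^ (-κ) ≤ A * ((z.den : ℝ) ^ (-κ) - (y.den : ℝ) ^ (-κ)) := by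
        rw [h5, mul_assoc]
        gcongr
        linarith
      have h7 := norm_sub_le_norm_sub_add_norm_sub (g y) (g z) (g L)
      linarith
  have h8 := main y.den y rfl hLy hyR
  have : 0 ≤ A * (y.den : ℝ) ^ (-κ) := by positivity
  linarith

theorem norm_sub_le_of_mem_farey {g : ℝ → ℂ} {C κ : ℝ} (hC : 0 < C) (hκ : 0 < κ)
    (hg : ∀ y z : ℚ, |y.num * z.den - z.num * y.den| = 1 → z.den ≤ y.den →
      ‖g y - g z‖ ≤ C * (z.den : ℝ) ^ (-κ))
    (hlim : ∀ x : ℝ, Irrational x →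
      Tendsto (fun y : ℚ => g y) (comap ((↑) : ℚ → ℝ) (𝓝 x)) (𝓝 (g x)))
    {L R : ℚ} (hLR : R.num * L.den - L.num * R.den = 1) {x y : ℝ}
    (hx : x ∈ Icc (L : ℝ) R) (hy : y ∈ Icc (L : ℝ) R) :
    ‖g y - g x‖ ≤ 2 * (C + C / (1 - 2 ^ (-κ))) * ((min L.den R.den : ℕ) : ℝ) ^ (-κ) := by
  have main : ∀ y : ℝ, y ∈ Icc (L : ℝ) R →
      ‖g y - g L‖ ≤ (C + C / (1 - 2 ^ (-κ))) * ((min L.den R.den : ℕ) : ℝ) ^ (-κ) := by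
    rintro y ⟨hLy, hyR⟩
    by_cases hirr : Irrational y
    · have hLy' : (L : ℝ) < y := hLy.lt_of_ne (hirr.ne_rat L).symm
      have hyR' : y < R := hyR.lt_of_ne (hirr.ne_rat R)
      have : (comap ((↑) : ℚ → ℝ) (𝓝 y)).NeBot :=
        Rat.isDenseEmbedding_coe_real.isDenseInducing.comap_nhds_neBot y
      refine le_of_tendsto ((hlim y hirr).sub_const (g L)).norm ?_
      filter_upwards [preimage_mem_comap (Ioo_mem_nhds hLy' hyR')] with z hz
      obtain ⟨h1, h2⟩ := hz
      exact norm_sub_left_le hC hκ hg hLR z (by exact_mod_cast h1.le) (by exact_mod_cast h2.le)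
    · obtain ⟨z, rfl⟩ := not_not.1 hirr
      exact norm_sub_left_le hC hκ hg hLR z (by exact_mod_cast hLy) (by exact_mod_cast hyR)
  have h1 := main y hy
  have h2 := main x hx
  have h3 := norm_sub_le_norm_sub_add_norm_sub (g y) (g L) (g x)
  rw [norm_sub_rev (g L)] at h3
  linarith

/-- The Farey interval of order `N` around an irrational number. -/
theorem exists_farey_interval {x : ℝ} (hx : Irrational x) (N : ℕ) (hN : 1 ≤ N) :
    ∃ L R : ℚ, R.num * L.den - L.num * R.den = 1 ∧ (L : ℝ) < x ∧ x < R ∧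
      L.den ≤ N ∧ R.den ≤ N ∧ N < L.den + R.den := by
  induction N, hN using Nat.le_induction with
  | base =>
    refine ⟨(⌊x⌋ : ℤ), (⌊x⌋ + 1 : ℤ), ?_, ?_, ?_, ?_, ?_, ?_⟩
    · rw [Rat.num_intCast, Rat.num_intCast, Rat.den_intCast, Rat.den_intCast]; push_cast; ring
    · push_cast
      exact (Int.floor_le x).lt_of_ne (hx.ne_int _).symm
    · push_cast
      exact Int.lt_floor_add_one x
    all_goals simp only [Rat.den_intCast]; norm_num
  | succ N hN ih =>
    obtain ⟨L, R, hLR, hLx, hxR, hL, hR, hs⟩ := ih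
    by_cases hlt : N + 1 < L.den + R.den
    · exact ⟨L, R, hLR, hLx, hxR, by omega, by omega, hlt⟩
    have hLp := L.den_pos
    have hRp := R.den_pos
    have hd : (0 : ℤ) < L.den + R.den := by positivity
    have hco : IsCoprime (L.num + R.num) ((L.den : ℤ) + R.den) := ⟨L.den, -L.num, by linarith⟩
    have hc : Nat.Coprime (L.num + R.num).natAbs ((L.den : ℤ) + R.den).natAbs :=
      Int.isCoprime_iff_gcd_eq_one.1 hco
    have hnum := Rat.num_div_eq_of_coprime hd hc
    have hden := Rat.den_div_eq_of_coprime hd hc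
    set z : ℚ := (L.num + R.num : ℤ) / ((L.den : ℤ) + R.den : ℤ) with hz
    rcases (hx.ne_rat z).lt_or_gt with h | h
    · refine ⟨L, z, ?_, hLx, h, by omega, by omega, by omega⟩
      rw [hnum, hden]; linarith
    · refine ⟨z, R, ?_, h, hxR, by omega, by omega, by omega⟩
      rw [hnum, hden]; linarith

theorem exists_pos_le_abs_sub_of_not_liouvilleWith {x p : ℝ} (hx : Irrational x) (hp : 0 < p)
    (hL : ¬ LiouvilleWith p x) :
    ∃ c : ℝ, 0 < c ∧ c ≤ 1 ∧ ∀ z : ℚ, c * (z.den : ℝ) ^ (-p) ≤ |x - z| := by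
  unfold LiouvilleWith at hL
  push Not at hL
  obtain ⟨n₀, hn₀⟩ := eventually_atTop.1 (hL 1)
  obtain ⟨ε, hε, hεpos⟩ := (((hx.eventually_forall_le_dist_cast_div_of_denom_le n₀).filter_mono
    nhdsWithin_le_nhds).and (self_mem_nhdsWithin : Ioi (0 : ℝ) ∈ 𝓝[>] 0)).exists
  have hεpos : 0 < ε := hεpos
  refine ⟨min ε 1, by positivity, min_le_right _ _, fun z => ?_⟩
  have hd : (1 : ℝ) ≤ z.den := by exact_mod_cast z.den_pos
  have hz : (z : ℝ) = z.num / z.den := Rat.cast_def z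
  rcases le_total z.den n₀ with h | h
  · calc min ε 1 * (z.den : ℝ) ^ (-p) ≤ ε * 1 := by
          gcongr
          · exact min_le_left _ _
          · exact Real.rpow_le_one_of_one_le_of_nonpos hd (by linarith)
      _ ≤ |x - z| := by
          rw [mul_one, hz]
          exact hε z.den h z.num
  · have := hn₀ z.den h z.num (by rw [← hz]; exact hx.ne_rat z)
    rw [← hz, one_div, ← Real.rpow_neg (by positivity)] at this
    refine le_trans ?_ this
    exact mul_le_of_le_one_left (by positivity) (min_le_right _ _)

/-- A bound on all Farey intervals gives Hölder continuity at Diophantine points. -/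
theorem exists_holder_of_farey_bound {g : ℝ → ℂ} {K κ ε : ℝ} (hK : 0 < K) (hκ : 0 < κ)
    (hε : 0 < ε)
    (hg : ∀ L R : ℚ, R.num * L.den - L.num * R.den = 1 → ∀ x ∈ Icc (L : ℝ) R,
      ∀ y ∈ Icc (L : ℝ) R, ‖g y - g x‖ ≤ K * ((min L.den R.den : ℕ) : ℝ) ^ (-κ))
    {x : ℝ} (hx : Irrational x) (hL : ¬ LiouvilleWith (2 + ε) x) :
    ∃ C' : ℝ, 0 < C' ∧ ∃ ρ : ℝ, 0 < ρ ∧ ρ ≤ 1 ∧ ∀ y : ℝ, |y - x| < ρ →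
      ‖g y - g x‖ ≤ C' * |y - x| ^ (κ / ((1 + ε) * (2 + ε))) := by
  obtain ⟨c, hc, hc1, hdio⟩ :=
    exists_pos_le_abs_sub_of_not_liouvilleWith hx (by positivity) hL
  set θ := κ / (1 + ε) with hθ
  have hθ0 : 0 < θ := by positivity
  have hθ2 : κ / ((1 + ε) * (2 + ε)) = θ / (2 + ε) := by rw [hθ, div_div]
  rw [hθ2]
  refine ⟨K * (c / 4) ^ (-θ) * c ^ (-(θ / (2 + ε))), by positivity, c, hc, hc1, fun y hy => ?_⟩
  rcases eq_or_ne y x with rfl | hne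
  · rw [sub_self, norm_zero]; positivity
  have hδ : 0 < |y - x| := abs_pos.2 (sub_ne_zero.2 hne)
  set δ := |y - x| with hδdef
  set T : ℝ := (c / δ) ^ (1 / (2 + ε)) with hT
  have hT1 : 1 ≤ T := Real.one_le_rpow ((one_le_div hδ).2 hy.le) (by positivity)
  have hT0 : 0 < T := by linarith
  have hTp : T ^ (2 + ε) = c / δ := by
    rw [hT, ← Real.rpow_mul (by positivity), one_div_mul_cancel (by positivity), Real.rpow_one]
  set N := ⌊T⌋₊ with hNdef
  have hN1 : 1 ≤ N := Nat.one_le_floor_iff _ |>.2 hT1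
  have hNT : (N : ℝ) ≤ T := Nat.floor_le hT0.le
  have hTN : T < N + 1 := Nat.lt_floor_add_one T
  have hN1R : (1 : ℝ) ≤ N := by exact_mod_cast hN1
  obtain ⟨L, R, hLR, hLx, hxR, hLN, hRN, hsum⟩ := exists_farey_interval hx N hN1
  have hdist : ∀ z : ℚ, z.den ≤ N → δ ≤ |x - z| := by
    intro z hz
    refine le_trans ?_ (hdio z)
    have hzpos : (0 : ℝ) < z.den := by exact_mod_cast z.den_pos
    have hzT : (z.den : ℝ) ≤ T := le_trans (by exact_mod_cast hz) hNT
    calc δ = c * T ^ (-(2 + ε)) := by rw [Real.rpow_neg hT0.le, hTp]; field_simp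
      _ ≤ c * (z.den : ℝ) ^ (-(2 + ε)) :=
          mul_le_mul_of_nonneg_left
            (Real.rpow_le_rpow_of_nonpos hzpos hzT (by linarith)) hc.le
  have hyLR : y ∈ Icc (L : ℝ) R := by
    have h1 := hdist L hLN
    have h2 := hdist R hRN
    rw [abs_of_pos (by linarith)] at h1
    rw [abs_of_neg (by linarith)] at h2
    have h3 := abs_le.1 hδdef.ge
    constructor <;> linarith [h3.1, h3.2]
  have hbd := hg L R hLR x ⟨hLx.le, hxR.le⟩ y hyLR
  have hLp : (0 : ℝ) < L.den := by exact_mod_cast L.den_pos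
  have hRp : (0 : ℝ) < R.den := by exact_mod_cast R.den_pos
  have hgap : (R : ℝ) - L = 1 / (L.den * R.den) := by
    rw [Rat.cast_def R, Rat.cast_def L]
    have : (R.num : ℝ) * L.den - L.num * R.den = 1 := by exact_mod_cast hLR
    field_simp
    linarith
  have hpow : ∀ q q' : ℝ, 0 < q → 0 < q' → N < q + q' → q ≤ q' →
      c * q ^ (-(2 + ε)) ≤ 1 / (q * q') → c / 4 * T ≤ q ^ (1 + ε) := by
    intro q q' hq hq' hs hle hb
    have h1 : q ^ (-(2 + ε)) = (q ^ (1 + ε))⁻¹ * q⁻¹ := by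
      rw [← Real.rpow_neg hq.le, ← Real.rpow_neg_one q, ← Real.rpow_add hq]
      congr 1; ring
    have hP : 0 < q ^ (1 + ε) := by positivity
    rw [h1] at hb
    have h2 : c * q' ≤ q ^ (1 + ε) := by
      field_simp at hb
      linarith
    have h3 : T ≤ 4 * q' := by linarith
    nlinarith
  have hM : c / 4 * T ≤ ((min L.den R.den : ℕ) : ℝ) ^ (1 + ε) := by
    rcases le_total L.den R.den with h | h
    · rw [min_eq_left h]
      refine hpow _ R.den hLp hRp (by exact_mod_cast hsum) (by exact_mod_cast h) ?_
      refine (hdio L).trans ?_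
      rw [abs_of_pos (by linarith), ← hgap]
      linarith
    · rw [min_eq_right h]
      refine hpow _ L.den hRp hLp (by rw [add_comm]; exact_mod_cast hsum) (by exact_mod_cast h) ?_
      refine (hdio R).trans ?_
      rw [abs_of_neg (by linarith), mul_comm (R.den : ℝ), ← hgap]
      linarith
  have hMpos : (0 : ℝ) < (min L.den R.den : ℕ) := by
    exact_mod_cast lt_min L.den_pos R.den_pos
  calc ‖g y - g x‖ ≤ K * ((min L.den R.den : ℕ) : ℝ) ^ (-κ) := hbd
    _ = K * (((min L.den R.den : ℕ) : ℝ) ^ (1 + ε)) ^ (-θ) := by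
        rw [← Real.rpow_mul hMpos.le, hθ]
        congr 2; field_simp
    _ ≤ K * (c / 4 * T) ^ (-θ) :=
        mul_le_mul_of_nonneg_left
          (Real.rpow_le_rpow_of_nonpos (by positivity) hM (by linarith)) hK.le
    _ = K * (c / 4) ^ (-θ) * c ^ (-(θ / (2 + ε))) * δ ^ (θ / (2 + ε)) := by
        have : T ^ (-θ) = c ^ (-(θ / (2 + ε))) * δ ^ (θ / (2 + ε)) := by
          rw [hT, ← Real.rpow_mul (by positivity), Real.div_rpow hc.le hδ.le,
            show 1 / (2 + ε) * -θ = -(θ / (2 + ε)) by ring, Real.rpow_neg hδ.le (θ / (2 + ε)),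
            div_inv_eq_mul]
        rw [Real.mul_rpow (by positivity) hT0.le, this]
        ring

theorem exists_pos_le_div {α κ : ℝ} (hα : α < κ / 2) :
    ∃ ε : ℝ, 0 < ε ∧ α ≤ κ / ((1 + ε) * (2 + ε)) := by
  have hcont : ContinuousAt (fun ε : ℝ => κ / ((1 + ε) * (2 + ε))) 0 := by
    refine ContinuousAt.div continuousAt_const (by fun_prop) (by norm_num)
  have hev : ∀ᶠ ε : ℝ in 𝓝 0, α < κ / ((1 + ε) * (2 + ε)) :=
    hcont.eventually (lt_mem_nhds (by norm_num; exact hα))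
  obtain ⟨ε, h1, h2⟩ := ((hev.filter_mono nhdsWithin_le_nhds).and
    (self_mem_nhdsWithin : Ioi (0 : ℝ) ∈ 𝓝[>] 0)).exists
  exact ⟨ε, h2, h1.le⟩

theorem hasDerivAt_zero_of_holder {g : ℝ → ℂ} {x α C ρ : ℝ} (hα : 1 < α) (hρ : 0 < ρ)
    (hg : ∀ y : ℝ, |y - x| < ρ → ‖g y - g x‖ ≤ C * |y - x| ^ α) : HasDerivAt g 0 x := by
  rw [hasDerivAt_iff_isLittleO]
  simp only [smul_zero, sub_zero]
  have hO : (fun y => g y - g x) =O[𝓝 x] fun y => |y - x| ^ α := by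
    refine Asymptotics.IsBigO.of_bound C ?_
    filter_upwards [Metric.ball_mem_nhds x hρ] with y hy
    rw [Real.norm_of_nonneg (by positivity)]
    exact hg y hy
  refine hO.trans_isLittleO ?_
  refine Asymptotics.isLittleO_of_tendsto (fun y hy => ?_) ?_
  · rw [hy, abs_zero, Real.zero_rpow (by linarith)]
  · refine squeeze_zero_norm (a := fun y => |y - x| ^ (α - 1)) (fun y => ?_) ?_
    · rcases eq_or_ne (y - x) 0 with h | h
      · rw [h]; simp; positivity
      · rw [norm_div, Real.norm_of_nonneg (by positivity), Real.norm_eq_abs,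
          Real.rpow_sub_one (abs_pos.2 h).ne']
    · have hc : ContinuousAt (fun y : ℝ => |y - x| ^ (α - 1)) x :=
        ContinuousAt.rpow_const (by fun_prop) (Or.inr (by linarith))
      have := hc.tendsto
      simpa [Real.zero_rpow (by linarith : α - 1 ≠ 0)] using this

/-- For `Re k > 0`, the extension `f‡` is almost everywhere locally
`α`-Hölder continuous for every `α < Re(k)/2`; in particular, if `Re k > 2`, then `f‡`
is differentiable almost everywhere with derivative `0`. -/
theorem stmt6 (k : ℂ) (hk : 0 < k.re) (f : ℚ → ℂ) (h : ℝ → ℂ)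
    (hper : ∀ x : ℚ, f (x + 1) = f x)
    (hrec : ∀ x : ℚ, x ≠ 0 →
      f x - ((|((x : ℚ) : ℝ)| : ℝ) : ℂ) ^ (-k) * f (-1 / x) = h x)
    (C : ℝ) (hC : 0 < C)
    (hbound : ∀ x : ℝ, x ≠ 0 → |x| ≤ 1 → ‖h x‖ ≤ C * |x| ^ (-k.re))
    (fdd : ℝ → ℂ)
    (hval : ∀ y : ℚ, fdd (y : ℝ) = ((y.den : ℝ) : ℂ) ^ (-k) * f (ratBar y))
    (hlim : ∀ x : ℝ, Irrational x →
      Tendsto (fun y : ℚ => ((y.den : ℝ) : ℂ) ^ (-k) * f (ratBar y))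
        (Filter.comap ((↑) : ℚ → ℝ) (nhds x)) (nhds (fdd x))) :
    (∃ X : Set ℝ, volume Xᶜ = 0 ∧
      ∀ x ∈ X, ∀ α : ℝ, α < k.re / 2 →
        ∃ C' : ℝ, 0 < C' ∧ ∃ ρ : ℝ, 0 < ρ ∧
          ∀ y : ℝ, |y - x| < ρ → ‖fdd y - fdd x‖ ≤ C' * |y - x| ^ α) ∧
    (2 < k.re → ∀ᵐ x : ℝ, HasDerivAt fdd 0 x) := by
  simp only [← hval] at hlim
  have h2 : (0 : ℝ) < 1 - 2 ^ (-k.re) :=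
    sub_pos.2 (Real.rpow_lt_one_of_one_lt_of_neg one_lt_two (neg_lt_zero.2 hk))
  have hfarey := fun (L R : ℚ) (hLR : R.num * L.den - L.num * R.den = 1) (x : ℝ)
    (hx : x ∈ Icc (L : ℝ) R) (y : ℝ) (hy : y ∈ Icc (L : ℝ) R) =>
    norm_sub_le_of_mem_farey hC hk (norm_sub_le_of_farey_neighbours hper hrec hbound hval)
      hlim hLR hx hy
  have hirr : ∀ᵐ x : ℝ, Irrational x := by
    rw [ae_iff]
    simp only [Irrational, not_not]
    exact (countable_range _).measure_zero volume
  have hae : ∀ᵐ x : ℝ, ∀ α : ℝ, α < k.re / 2 →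
      ∃ C' : ℝ, 0 < C' ∧ ∃ ρ : ℝ, 0 < ρ ∧
        ∀ y : ℝ, |y - x| < ρ → ‖fdd y - fdd x‖ ≤ C' * |y - x| ^ α := by
    filter_upwards [hirr, ae_not_liouvilleWith] with x hx hL α hα
    obtain ⟨ε, hε, hle⟩ := exists_pos_le_div hα
    obtain ⟨C', hC', ρ, hρ, hρ1, H⟩ :=
      exists_holder_of_farey_bound (by positivity) hk hε hfarey hx (hL (2 + ε) (by linarith))
    refine ⟨C', hC', ρ, hρ, fun y hy => ?_⟩
    rcases eq_or_ne y x with rfl | hne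
    · rw [sub_self, norm_zero]; positivity
    refine (H y hy).trans ?_
    gcongr C' * ?_
    exact Real.rpow_le_rpow_of_exponent_ge (abs_pos.2 (sub_ne_zero.2 hne)) (hy.le.trans hρ1) hle
  refine ⟨⟨_, hae, fun x hx => hx⟩, fun hk2 => ?_⟩
  filter_upwards [hae] with x hx
  obtain ⟨C', -, ρ, hρ, H⟩ := hx ((1 + k.re / 2) / 2) (by linarith)
  exact hasDerivAt_zero_of_holder (by linarith) hρ H
end
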